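/- Let H̃_n be the height of a random admissible walk of length n on ℤ, i.e. E H̃_n = (Σ_{h≥0} h·W(n,h))/(Σ_{h≥0} W(n,h)). Then, as n → ∞, E H̃_n = (√(2π³)/4)√n − 2 + 3√(2π³)/(16√n) − 539√(2π³)/(5760 n^{3/2}) + 50713√(2π³)/(483840 n^{5/2}) + O(n^{−7/2}). -/

import Mathlib

open Real

/-- Partial sum `S_k` of the `±1`-walk encoded by `ε : Fin n → Bool`
(`true` = step `+1`, `false` = step `-1`). -/
def walkSum (n : ℕ) (ε : Fin n → Bool) (k : ℕ) : ℤ :=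
  ∑ i : Fin n, if (i : ℕ) < k then (if ε i then 1 else -1) else 0

/-- `W n h`: number of `±1`-paths of length `n` with `0 ≤ S_k ≤ h` for all `k` and `S_n = h`. -/
noncomputable def W (n h : ℕ) : ℕ :=
  Nat.card {ε : Fin n → Bool //
    (∀ k ≤ n, 0 ≤ walkSum n ε k ∧ walkSum n ε k ≤ (h : ℤ)) ∧ walkSum n ε n = (h : ℤ)}

/-- Expected height `E H̃_n = (Σ_h h·W(n,h))/(Σ_h W(n,h))` of a random admissible walk on `ℤ`. -/
noncomputable def expHeightZ (n : ℕ) : ℝ :=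
  (∑' h : ℕ, (h : ℝ) * (W n h : ℝ)) / (∑' h : ℕ, (W n h : ℝ))

open Real
namespace EH
open SchwartzMap FourierTransform MeasureTheory

theorem exists_schwartz (C : Set (ℝ → ℂ))
    (hd : ∀ f ∈ C, ∃ g ∈ C, ∀ x, HasDerivAt f (g x) x)
    (hb : ∀ f ∈ C, ∀ k : ℕ, ∃ M, ∀ x : ℝ, |x| ^ k * ‖f x‖ ≤ M) {f : ℝ → ℂ} (hf : f ∈ C) :
    ∃ F : 𝓢(ℝ, ℂ), ∀ x, F x = f x := by
  have hderiv : ∀ f ∈ C, deriv f ∈ C := by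
    intro f hf
    obtain ⟨g, hg, h⟩ := hd f hf
    have : deriv f = g := funext fun x => (h x).deriv
    rwa [this]
  have hit : ∀ n : ℕ, ∀ f ∈ C, iteratedDeriv n f ∈ C := by
    intro n
    induction n with
    | zero => intro f hf; simpa using hf
    | succ n ih => intro f hf; rw [iteratedDeriv_succ']; exact ih _ (hderiv f hf)
  refine ⟨⟨f, ?_, ?_⟩, fun x => rfl⟩
  · refine contDiff_of_differentiable_iteratedDeriv ?_
    intro m _
    obtain ⟨g, _, h⟩ := hd _ (hit m f hf)
    exact fun x => (h x).differentiableAt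
  · intro k n
    obtain ⟨M, hM⟩ := hb _ (hit n f hf) k
    refine ⟨M, fun x => ?_⟩
    rw [norm_iteratedFDeriv_eq_norm_iteratedDeriv]
    exact hM x

theorem schwartz_decay (S : 𝓢(ℝ, ℂ)) (N : ℕ) :
    ∃ C, 0 < C ∧ ∀ x : ℝ, |x| ^ N * ‖S x‖ ≤ C := by
  obtain ⟨C, hC, h⟩ := S.decay N 0
  refine ⟨C, hC, fun x => ?_⟩
  simpa using h x

noncomputable def scaleS (S : 𝓢(ℝ, ℂ)) (h : ℝ) (hh : h ≠ 0) : 𝓢(ℝ, ℂ) :=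
  compCLMOfContinuousLinearEquiv ℂ (ContinuousLinearEquiv.unitsEquivAut ℝ (Units.mk0 h hh)) S

theorem scaleS_apply (S : 𝓢(ℝ, ℂ)) (h : ℝ) (hh : h ≠ 0) (x : ℝ) :
    scaleS S h hh x = S (h * x) := by
  simp [scaleS, mul_comm]

theorem fourier_scaleS (S : 𝓢(ℝ, ℂ)) (h : ℝ) (hh : 0 < h) (ξ : ℝ) :
    𝓕 (scaleS S h hh.ne') ξ = (1 / h : ℂ) * 𝓕 S (ξ / h) := by
  rw [fourier_coe, fourier_coe, Real.fourier_real_eq_integral_exp_smul,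
    Real.fourier_real_eq_integral_exp_smul]
  have := Measure.integral_comp_mul_left
    (fun v : ℝ => Complex.exp (↑(-2 * π * v * (ξ / h)) * Complex.I) • S v) h
  rw [abs_of_pos (inv_pos.mpr hh)] at this
  have h2 : ((1 / h : ℂ)) = ((h⁻¹ : ℝ) : ℂ) := by push_cast; simp
  rw [h2, ← Complex.real_smul, ← this]
  congr 1
  ext v
  rw [scaleS_apply]
  congr 4
  field_simp

theorem summable_int_inv_sq : Summable fun k : ℤ => 1 / |(k : ℝ)| ^ 2 := by
  have := Real.summable_one_div_int_pow (p := 2)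
  simpa using this

theorem poisson_bound (S : 𝓢(ℝ, ℂ)) (N : ℕ) :
    ∃ C, 0 < C ∧ ∀ h > (0 : ℝ), ∀ a : ℝ,
      ‖∑' s : ℤ, S (h * s + a) - (1 / h : ℂ) * 𝓕 S 0‖ ≤ C * h ^ (N + 1) := by
  obtain ⟨C, hC, hdec⟩ := schwartz_decay (𝓕 S) (N + 2)
  refine ⟨C * ((∑' k : ℤ, 1 / |(k : ℝ)| ^ 2) + 1), ?_, ?_⟩
  · have : 0 ≤ ∑' k : ℤ, 1 / |(k : ℝ)| ^ 2 := tsum_nonneg fun k => by positivity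
    positivity
  intro h hh a
  have hP := SchwartzMap.tsum_eq_tsum_fourier (scaleS S h hh.ne') (a / h)
  have h1 : ∀ s : ℤ, scaleS S h hh.ne' (a / h + s) = S (h * s + a) := by
    intro s; rw [scaleS_apply]; congr 1; field_simp; ring
  simp_rw [h1, fourier_scaleS S h hh] at hP
  rw [hP]
  set T : ℤ → ℂ := fun n => (1 / h : ℂ) * 𝓕 S (n / h) * fourier n ((a / h : ℝ) : UnitAddCircle)
    with hT
  have hTb : ∀ n : ℤ, n ≠ 0 → ‖T n‖ ≤ C * h ^ (N + 1) * (1 / |(n : ℝ)| ^ 2) := by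
    intro n hn
    have hn1 : (1 : ℝ) ≤ |(n : ℝ)| := by exact_mod_cast Int.one_le_abs hn
    have e1 : ‖T n‖ = 1 / h * ‖𝓕 S (n / h)‖ := by
      rw [hT]
      have hf1 : ‖fourier n ((a / h : ℝ) : UnitAddCircle)‖ = 1 := by
        rw [fourier_apply]; exact Circle.norm_coe _
      simp only [norm_mul, hf1, mul_one]
      simp [abs_of_pos hh]
    rw [e1]
    have := hdec (n / h)
    rw [abs_div, abs_of_pos hh, div_pow, div_mul_eq_mul_div, div_le_iff₀ (by positivity)] at this
    have h3 : |(n : ℝ)| ^ 2 * ‖𝓕 S (n / h)‖ ≤ C * h ^ (N + 2) := by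
      refine le_trans ?_ this
      gcongr
      omega
    rw [mul_one_div, le_div_iff₀ (by positivity), div_mul_eq_mul_div, one_mul, div_mul_eq_mul_div,
      div_le_iff₀ hh]
    calc _ = |(n : ℝ)| ^ 2 * ‖𝓕 S (n / h)‖ := by ring
      _ ≤ _ := h3
      _ = _ := by ring
  have hsum : Summable T := by
    refine Summable.of_norm_bounded_eventually (g := fun n : ℤ => C * h ^ (N + 1) * (1 / |(n : ℝ)| ^ 2))
      (summable_int_inv_sq.mul_left _) ?_
    rw [Filter.eventually_cofinite]
    refine (Set.finite_singleton (0 : ℤ)).subset ?_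
    intro n hn
    by_contra h0
    exact hn (hTb n h0)
  rw [hsum.tsum_eq_add_tsum_ite 0]
  have hT0 : T 0 = (1 / h : ℂ) * 𝓕 S 0 := by simp [hT]
  rw [hT0, add_sub_cancel_left]
  have := tsum_of_norm_bounded (f := fun n => if n = 0 then (0 : ℂ) else T n)
    ((summable_int_inv_sq.mul_left (C * h ^ (N + 1))).hasSum) (by
      intro n
      by_cases h0 : n = 0
      · simp [h0]
      · simpa [h0] using hTb n h0)
  refine this.trans ?_
  rw [tsum_mul_left]
  have : 0 < h ^ (N + 1) := by positivity
  nlinarith [mul_pos hC this]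

theorem int_odd_ne (m : ℤ) : (1 : ℝ) ≤ |(2 * m + 1 : ℝ)| := by
  have : (1 : ℤ) ≤ |2 * m + 1| := Int.one_le_abs (by omega)
  exact_mod_cast this

theorem summable_odd_inv_sq : Summable fun k : ℤ => 1 / |(2 * k + 1 : ℝ)| ^ 2 := by
  have := summable_int_inv_sq.comp_injective (i := fun k : ℤ => 2 * k + 1)
    (fun a b h => by simpa using h)
  refine this.congr fun k => by simp

noncomputable def Phi (f : 𝓢(ℝ, ℂ)) (y : ℝ) : ℂ := ∑' m : ℤ, f ((2 * m + 1) * y)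

theorem term_bound (f : 𝓢(ℝ, ℂ)) (N : ℕ) : ∃ C, 0 < C ∧ ∀ y > (0 : ℝ), ∀ m : ℤ,
    ‖f ((2 * m + 1) * y)‖ ≤ C / y ^ (N + 2) * (1 / |(2 * m + 1 : ℝ)| ^ 2) := by
  obtain ⟨C, hC, hdec⟩ := schwartz_decay f (N + 2)
  refine ⟨C, hC, fun y hy m => ?_⟩
  have h := hdec ((2 * m + 1) * y)
  have h1 := int_odd_ne m
  rw [abs_mul, abs_of_pos hy, mul_pow] at h
  rw [div_mul_div_comm, mul_one, le_div_iff₀ (by positivity)]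
  refine le_trans ?_ h
  rw [mul_comm, mul_comm (y ^ (N + 2))]
  gcongr
  omega

theorem Phi_summable (f : 𝓢(ℝ, ℂ)) {y : ℝ} (hy : 0 < y) :
    Summable fun m : ℤ => f ((2 * m + 1) * y) := by
  obtain ⟨C, hC, h⟩ := term_bound f 0
  exact Summable.of_norm_bounded (summable_odd_inv_sq.mul_left _) (h y hy)

theorem Phi_decay (f : 𝓢(ℝ, ℂ)) (N : ℕ) : ∃ C, 0 < C ∧ ∀ y > (0 : ℝ),
    ‖Phi f y‖ ≤ C / y ^ (N + 2) := by
  obtain ⟨C, hC, h⟩ := term_bound f N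
  refine ⟨C * ((∑' k : ℤ, 1 / |(2 * k + 1 : ℝ)| ^ 2) + 1), ?_, fun y hy => ?_⟩
  · have : 0 ≤ ∑' k : ℤ, 1 / |(2 * k + 1 : ℝ)| ^ 2 := tsum_nonneg fun k => by positivity
    positivity
  refine (tsum_of_norm_bounded (summable_odd_inv_sq.mul_left _).hasSum (h y hy)).trans ?_
  rw [tsum_mul_left, mul_div_right_comm]
  gcongr
  linarith

theorem Phi_poisson (f : 𝓢(ℝ, ℂ)) (N : ℕ) : ∃ C, 0 < C ∧ ∀ y > (0 : ℝ),
    ‖Phi f y - (1 / (2 * y) : ℂ) * 𝓕 f 0‖ ≤ C * y ^ (N + 1) := by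
  obtain ⟨C, hC, h⟩ := poisson_bound f N
  refine ⟨C * 2 ^ (N + 1), by positivity, fun y hy => ?_⟩
  have := h (2 * y) (by positivity) y
  rw [mul_pow, ← mul_assoc] at this
  convert this using 3
  · unfold Phi; congr 1; ext m; congr 1; ring
  · push_cast; ring

theorem Phi_zpow (f : 𝓢(ℝ, ℂ)) (hf : 𝓕 f 0 = 0) (j : ℤ) : ∃ C, 0 < C ∧ ∀ y > (0 : ℝ),
    ‖Phi f y‖ ≤ C * y ^ j := by
  obtain ⟨C₁, hC₁, h₁⟩ := Phi_decay f j.natAbs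
  obtain ⟨C₂, hC₂, h₂⟩ := Phi_poisson f j.natAbs
  refine ⟨C₁ + C₂, by positivity, fun y hy => ?_⟩
  have h1 := h₁ y hy
  have h2 := h₂ y hy
  rw [hf, mul_zero, sub_zero] at h2
  rcases le_total 1 y with h | h
  · have : (y ^ (j.natAbs + 2))⁻¹ ≤ y ^ j := by
      rw [← zpow_natCast, ← zpow_neg]
      exact zpow_le_zpow_right₀ h (by push_cast; cases abs_cases j <;> omega)
    calc _ ≤ C₁ * (y ^ (j.natAbs + 2))⁻¹ := by rw [← div_eq_mul_inv]; exact h1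
      _ ≤ C₁ * y ^ j := by gcongr
      _ ≤ _ := by gcongr; linarith
  · have : y ^ (j.natAbs + 1) ≤ y ^ j := by
      rw [← zpow_natCast]
      exact zpow_le_zpow_right_of_le_one₀ hy h (by push_cast; cases abs_cases j <;> omega)
    calc _ ≤ C₂ * y ^ (j.natAbs + 1) := h2
      _ ≤ C₂ * y ^ j := by gcongr
      _ ≤ _ := by gcongr; linarith

end EH

open Real
namespace EH
open SchwartzMap FourierTransform MeasureTheory

noncomputable def mulX (f : 𝓢(ℝ, ℂ)) : 𝓢(ℝ, ℂ) := smulLeftCLM ℂ (fun x : ℝ => x) f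

theorem mulX_apply (f : 𝓢(ℝ, ℂ)) (x : ℝ) : mulX f x = (x : ℂ) * f x := by
  have : (fun x : ℝ => x).HasTemperateGrowth := by fun_prop
  rw [mulX, smulLeftCLM_apply_apply this]
  simp

noncomputable def derivS (f : 𝓢(ℝ, ℂ)) : 𝓢(ℝ, ℂ) := derivCLM ℂ ℂ f

theorem derivS_apply (f : 𝓢(ℝ, ℂ)) (x : ℝ) : derivS f x = deriv f x := rfl

noncomputable def Theta (f : 𝓢(ℝ, ℂ)) : 𝓢(ℝ, ℂ) := mulX (derivS f)

theorem fourier_derivS (f : 𝓢(ℝ, ℂ)) (ξ : ℝ) :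
    𝓕 (derivS f) ξ = 2 * π * Complex.I * ξ * 𝓕 f ξ := by
  have := Real.fourier_deriv f.integrable f.differentiable (derivS f).integrable
  have h2 := congrFun this ξ
  rw [fourier_coe, fourier_coe]
  exact h2

theorem derivS_fourier (f : 𝓢(ℝ, ℂ)) :
    derivS (𝓕 f) = (-2 * π * Complex.I : ℂ) • 𝓕 (mulX f) := by
  ext ξ
  have h1 : Integrable (fun x : ℝ => x • f x) := by
    refine (mulX f).integrable.congr (Filter.Eventually.of_forall fun x => ?_)
    simp [mulX_apply]
  have h := (Real.hasDerivAt_fourier f.integrable h1 ξ).deriv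
  rw [derivS_apply, fourier_coe, h]
  rw [← FourierTransform.fourier_smul]
  rw [fourier_coe]
  refine congrFun (congrArg 𝓕 ?_) ξ
  funext x
  simp [mulX_apply, mul_assoc]

theorem Theta_add_self (f : 𝓢(ℝ, ℂ)) : Theta f + f = derivS (mulX f) := by
  ext x
  have h : HasDerivAt (fun x : ℝ => (x : ℂ) * f x) (1 * f x + x * deriv f x) x :=
    (Complex.ofRealCLM.hasDerivAt).mul (f.hasDerivAt x)
  have e : (mulX f : ℝ → ℂ) = fun x : ℝ => (x : ℂ) * f x := funext (mulX_apply f)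
  rw [derivS_apply, e, h.deriv]
  simp [Theta, mulX_apply, derivS_apply]
  ring

theorem fourier_Theta_zero (f : 𝓢(ℝ, ℂ)) : 𝓕 (Theta f) 0 = - 𝓕 f 0 := by
  have h := congrArg (fun g : 𝓢(ℝ, ℂ) => 𝓕 g 0) (Theta_add_self f)
  simp only [fourier_derivS] at h
  rw [FourierTransform.fourier_add] at h
  simp at h
  linear_combination h

theorem Phi_add (f g : 𝓢(ℝ, ℂ)) {y : ℝ} (hy : 0 < y) : Phi (f + g) y = Phi f y + Phi g y := by
  unfold Phi
  rw [← (Phi_summable f hy).tsum_add (Phi_summable g hy)]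
  rfl

theorem Phi_smul (c : ℂ) (f : 𝓢(ℝ, ℂ)) (y : ℝ) : Phi (c • f) y = c * Phi f y := by
  unfold Phi
  rw [← tsum_mul_left]
  rfl

theorem Phi_hasDerivAt (f : 𝓢(ℝ, ℂ)) {y : ℝ} (hy : 0 < y) :
    HasDerivAt (Phi f) (Phi (Theta f) y / y) y := by
  obtain ⟨C, hC, hb⟩ := term_bound (Theta f) 0
  have hT : ∀ (m : ℤ) (z : ℝ), 0 < z →
      (2 * m + 1 : ℂ) * deriv f ((2 * m + 1) * z) = Theta f ((2 * m + 1) * z) / z := by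
    intro m z hz
    have : (z : ℂ) ≠ 0 := by exact_mod_cast hz.ne'
    rw [Theta, mulX_apply, derivS_apply]
    push_cast
    field_simp
  have key := hasDerivAt_tsum_of_isPreconnected (𝕜 := ℝ) (F := ℂ) (t := Set.Ioi (y / 2))
    (g := fun (m : ℤ) (z : ℝ) => f ((2 * m + 1) * z))
    (g' := fun (m : ℤ) (z : ℝ) => (2 * m + 1 : ℂ) * deriv f ((2 * m + 1) * z))
    (y₀ := y) (y := y)
    (summable_odd_inv_sq.mul_left (C / (y / 2) ^ 2 / (y / 2))) isOpen_Ioi isPreconnected_Ioi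
    ?_ ?_ (by simp; linarith) (Phi_summable f hy) (by simp; linarith)
  · have e : Phi (Theta f) y / y =
        ∑' m : ℤ, (2 * m + 1 : ℂ) * deriv f ((2 * m + 1) * y) := by
      unfold Phi
      rw [← tsum_div_const]
      refine tsum_congr fun m => ?_
      rw [hT m y hy]
    rw [e]
    exact key
  · intro m z _
    have h1 : HasDerivAt (fun z : ℝ => (2 * m + 1 : ℝ) * z) (2 * m + 1) z := by
      simpa using (hasDerivAt_id z).const_mul (2 * m + 1 : ℝ)
    have := HasDerivAt.scomp z (f.hasDerivAt ((2 * m + 1) * z)) h1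
    have e : (⇑f ∘ fun z : ℝ => (2 * m + 1 : ℝ) * z) = fun z : ℝ => f ((2 * m + 1) * z) := rfl
    rw [e] at this
    simpa using this
  · intro m z hz
    simp only [Set.mem_Ioi] at hz
    have hz0 : 0 < z := by linarith
    rw [hT m z hz0, norm_div, Complex.norm_real, Real.norm_of_nonneg hz0.le]
    have := hb z hz0 m
    calc _ ≤ (C / z ^ 2 * (1 / |(2 * m + 1 : ℝ)| ^ 2)) / z := by gcongr
      _ = C / z ^ 2 / z * (1 / |(2 * m + 1 : ℝ)| ^ 2) := by ring
      _ ≤ _ := by gcongr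

noncomputable def Psi (f : 𝓢(ℝ, ℂ)) (j : ℤ) (y : ℝ) : ℂ :=
  if 0 < y then (y : ℂ) ^ j * Phi f y else 0

theorem Psi_bound (f : 𝓢(ℝ, ℂ)) (hf : 𝓕 f 0 = 0) (j : ℤ) (k : ℕ) :
    ∃ C, 0 < C ∧ ∀ y : ℝ, ‖Psi f j y‖ ≤ C * |y| ^ k := by
  obtain ⟨C, hC, h⟩ := Phi_zpow f hf (k - j)
  refine ⟨C, hC, fun y => ?_⟩
  unfold Psi
  split_ifs with hy
  · rw [norm_mul, norm_zpow, Complex.norm_real, Real.norm_of_nonneg hy.le, abs_of_pos hy]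
    calc _ ≤ y ^ j * (C * y ^ ((k : ℤ) - j)) := by gcongr; exact h y hy
      _ = C * (y ^ j * y ^ ((k : ℤ) - j)) := by ring
      _ = _ := by rw [← zpow_add₀ hy.ne']; simp
  · simp; positivity

theorem Psi_bound' (f : 𝓢(ℝ, ℂ)) (hf : 𝓕 f 0 = 0) (j : ℤ) (k : ℕ) :
    ∃ C, ∀ y : ℝ, |y| ^ k * ‖Psi f j y‖ ≤ C := by
  obtain ⟨C, hC, h⟩ := Phi_zpow f hf (-k - j)
  refine ⟨C, fun y => ?_⟩
  unfold Psi
  split_ifs with hy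
  · rw [norm_mul, norm_zpow, Complex.norm_real, Real.norm_of_nonneg hy.le, abs_of_pos hy]
    calc _ ≤ y ^ k * (y ^ j * (C * y ^ (-(k : ℤ) - j))) := by gcongr; exact h y hy
      _ = C * (y ^ (k : ℤ) * y ^ j * y ^ (-(k : ℤ) - j)) := by rw [zpow_natCast]; ring
      _ = C := by rw [← zpow_add₀ hy.ne', ← zpow_add₀ hy.ne']; simp
  · simp; positivity

theorem Psi_hasDerivAt (f : 𝓢(ℝ, ℂ)) (hf : 𝓕 f 0 = 0) (j : ℤ) (y : ℝ) :
    HasDerivAt (Psi f j) (Psi (Theta f + (j : ℂ) • f) (j - 1) y) y := by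
  rcases lt_trichotomy y 0 with hy | hy | hy
  · have : Psi f j =ᶠ[nhds y] fun _ => 0 := by
      filter_upwards [gt_mem_nhds hy] with z hz
      simp [Psi, hz.le]
    have h0 : Psi (Theta f + (j : ℂ) • f) (j - 1) y = 0 := by simp [Psi, hy.le]
    rw [h0]
    exact (hasDerivAt_const y (0 : ℂ)).congr_of_eventuallyEq this
  · subst hy
    have h0 : Psi (Theta f + (j : ℂ) • f) (j - 1) 0 = 0 := by simp [Psi]
    rw [h0]
    obtain ⟨C, hC, h⟩ := Psi_bound f hf j 2
    have hO : (Psi f j) =O[nhds 0] fun x => ‖x - 0‖ ^ 2 := by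
      refine Asymptotics.IsBigO.of_bound C (Filter.Eventually.of_forall fun x => ?_)
      simpa using h x
    have := hO.hasFDerivAt (𝕜 := ℝ) (by norm_num)
    simpa using this.hasDerivAt
  · have hyC : (y : ℂ) ≠ 0 := by exact_mod_cast hy.ne'
    have h1 : HasDerivAt (fun z : ℝ => (z : ℂ) ^ j) ((j : ℂ) * (y : ℂ) ^ (j - 1)) y :=
      (hasDerivAt_zpow j (y : ℂ) (Or.inl hyC)).comp_ofReal
    have h2 := h1.mul (Phi_hasDerivAt f hy)
    have e : Psi f j =ᶠ[nhds y] fun z : ℝ => (z : ℂ) ^ j * Phi f z := by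
      filter_upwards [lt_mem_nhds hy] with z hz
      simp [Psi, hz]
    refine (h2.congr_of_eventuallyEq e).congr_deriv ?_
    simp only [Psi, hy, if_true]
    rw [Phi_add _ _ hy, Phi_smul, zpow_sub_one₀ hyC]
    field_simp
    ring

theorem Psi_schwartz (f : 𝓢(ℝ, ℂ)) (hf : 𝓕 f 0 = 0) (j : ℤ) :
    ∃ F : 𝓢(ℝ, ℂ), ∀ x, F x = Psi f j x := by
  refine exists_schwartz {g | ∃ (f : 𝓢(ℝ, ℂ)) (j : ℤ), 𝓕 f 0 = 0 ∧ g = Psi f j} ?_ ?_ ⟨f, j, hf, rfl⟩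
  · rintro g ⟨f, j, hf, rfl⟩
    refine ⟨_, ⟨Theta f + (j : ℂ) • f, j - 1, ?_, rfl⟩, Psi_hasDerivAt f hf j⟩
    rw [FourierTransform.fourier_add, FourierTransform.fourier_smul]
    simp [fourier_Theta_zero, hf]
  · rintro g ⟨f, j, hf, rfl⟩ k
    exact Psi_bound' f hf j k

theorem fourier_zero (f : 𝓢(ℝ, ℂ)) : 𝓕 f 0 = ∫ x, f x := by
  rw [fourier_coe, Real.fourier_real_eq_integral_exp_smul]
  simp

/-- Summation of `Psi` over an arithmetic progression of step two. -/
theorem Psi_sum (f : 𝓢(ℝ, ℂ)) (hf : 𝓕 f 0 = 0) (j : ℤ) (N : ℕ) :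
    ∃ C, 0 < C ∧ ∀ ε > (0 : ℝ), ∀ p : ℤ,
      ‖∑' s : ℤ, Psi f j (ε * (2 * s + p)) - (1 / (2 * ε) : ℂ) *
        ∫ y in Set.Ioi (0 : ℝ), (y : ℂ) ^ j * Phi f y‖ ≤ C * ε ^ (N + 1) := by
  obtain ⟨F, hF⟩ := Psi_schwartz f hf j
  obtain ⟨C, hC, h⟩ := poisson_bound F N
  refine ⟨C * 2 ^ (N + 1), by positivity, fun ε hε p => ?_⟩
  have := h (2 * ε) (by positivity) (ε * p)
  rw [mul_pow, ← mul_assoc] at this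
  convert this using 3
  · congr 1; ext s; rw [hF]; congr 1; ring
  · rw [fourier_zero, ← integral_indicator measurableSet_Ioi]
    push_cast
    congr 1
    congr 1
    ext x
    rw [hF, Psi]
    simp [Set.indicator_apply]

theorem Psi_integrable (f : 𝓢(ℝ, ℂ)) (hf : 𝓕 f 0 = 0) (j : ℤ) :
    IntegrableOn (fun y : ℝ => (y : ℂ) ^ j * Phi f y) (Set.Ioi 0) := by
  obtain ⟨F, hF⟩ := Psi_schwartz f hf j
  refine (F.integrable.integrableOn (s := Set.Ioi 0)).congr_fun ?_ measurableSet_Ioi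
  intro x hx
  simp only [Set.mem_Ioi] at hx
  simp only [hF, Psi, hx, if_true]

theorem Psi_summable (f : 𝓢(ℝ, ℂ)) (hf : 𝓕 f 0 = 0) (j : ℤ) {ε : ℝ} (hε : 0 < ε) (p : ℤ) :
    Summable fun s : ℤ => Psi f j (ε * (2 * s + p)) := by
  obtain ⟨C, hC⟩ := Psi_bound' f hf j 2
  have hs : Summable fun s : ℤ => C / ε ^ 2 * (1 / |((2 * s + p : ℤ) : ℝ)| ^ 2) := by
    refine Summable.mul_left _ ?_
    exact summable_int_inv_sq.comp_injective (i := fun k : ℤ => 2 * k + p)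
      (fun a b h => by simpa using h)
  refine Summable.of_norm_bounded hs fun s => ?_
  by_cases h0 : 2 * s + p = 0
  · have : (2 * s + p : ℝ) = 0 := by exact_mod_cast h0
    rw [this, h0]; simp [Psi]
  have h1 : (0 : ℝ) < |((2 * s + p : ℤ) : ℝ)| := by positivity
  have := hC (ε * (2 * s + p))
  rw [abs_mul, abs_of_pos hε, mul_pow] at this
  rw [div_mul_div_comm, mul_one, le_div_iff₀ (by positivity), mul_comm]
  push_cast
  exact this

end EH

open Real
namespace EH
open SchwartzMap FourierTransform MeasureTheory

theorem pow_mul_gauss_le (j : ℕ) (x : ℝ) : |x| ^ j * Real.exp (-π * x ^ 2) ≤ 1 + j.factorial := by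
  have h1 : |x| ^ j ≤ 1 + (x ^ 2) ^ j := by
    have : (x ^ 2) ^ j = (|x| ^ j) ^ 2 := by rw [← sq_abs, ← pow_mul, ← pow_mul, mul_comm]
    rw [this]; nlinarith [sq_nonneg (|x| ^ j - 1)]
  have h2 := Real.pow_div_factorial_le_exp (x ^ 2) (by positivity) j
  have h3 : Real.exp (-π * x ^ 2) ≤ Real.exp (-(x ^ 2)) := by
    apply Real.exp_le_exp.mpr; nlinarith [Real.pi_gt_three, sq_nonneg x]
  have h4 : (x ^ 2) ^ j * Real.exp (-(x ^ 2)) ≤ j.factorial := by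
    rw [Real.exp_neg, ← div_eq_mul_inv, div_le_iff₀ (Real.exp_pos _)]
    rw [div_le_iff₀ (by positivity)] at h2
    linarith
  have h5 : Real.exp (-(x ^ 2)) ≤ 1 := by apply Real.exp_le_one_iff.mpr; nlinarith
  calc _ ≤ (1 + (x ^ 2) ^ j) * Real.exp (-(x ^ 2)) := by gcongr
    _ = Real.exp (-(x ^ 2)) + (x ^ 2) ^ j * Real.exp (-(x ^ 2)) := by ring
    _ ≤ _ := by linarith

theorem exists_gauss : ∃ F : 𝓢(ℝ, ℂ), ∀ x : ℝ, F x = (Real.exp (-π * x ^ 2) : ℂ) := by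
  refine exists_schwartz {g | ∃ p : Polynomial ℝ, g = fun x : ℝ => ((p.eval x * Real.exp (-π * x ^ 2) : ℝ) : ℂ)}
    ?_ ?_ ⟨1, by ext; simp⟩
  · rintro g ⟨p, rfl⟩
    refine ⟨_, ⟨p.derivative - Polynomial.C (2 * π) * Polynomial.X * p, rfl⟩, fun x => ?_⟩
    apply HasDerivAt.ofReal_comp
    have h1 : HasDerivAt (fun x : ℝ => Real.exp (-π * x ^ 2))
        (Real.exp (-π * x ^ 2) * (-π * (2 * x))) x := by
      have := ((hasDerivAt_pow 2 x).const_mul (-π)).exp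
      simpa using this
    refine ((p.hasDerivAt x).mul h1).congr_deriv ?_
    simp
    ring
  · rintro g ⟨p, rfl⟩ k
    induction p using Polynomial.induction_on' with
    | add p q hp hq =>
      obtain ⟨M, hM⟩ := hp
      obtain ⟨M', hM'⟩ := hq
      refine ⟨M + M', fun x => ?_⟩
      refine le_trans ?_ (add_le_add (hM x) (hM' x))
      rw [← mul_add]
      gcongr
      dsimp only
      rw [Polynomial.eval_add, add_mul, Complex.ofReal_add]
      exact norm_add_le _ _
    | monomial n a =>
      refine ⟨|a| * (1 + (k + n).factorial), fun x => ?_⟩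
      have := pow_mul_gauss_le (k + n) x
      dsimp only
      rw [Complex.norm_real, Polynomial.eval_monomial, Real.norm_eq_abs, abs_mul, abs_mul, abs_pow,
        Real.abs_exp]
      calc _ = |a| * (|x| ^ (k + n) * Real.exp (-π * x ^ 2)) := by ring
        _ ≤ _ := by gcongr

noncomputable def gS : ℕ → 𝓢(ℝ, ℂ)
  | 0 => exists_gauss.choose
  | k + 1 => mulX (mulX (gS k))

theorem gS_apply (k : ℕ) (x : ℝ) : gS k x = ((x ^ (2 * k) * Real.exp (-π * x ^ 2) : ℝ) : ℂ) := by
  induction k with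
  | zero => rw [gS, exists_gauss.choose_spec]; simp
  | succ k ih => rw [gS, mulX_apply, mulX_apply, ih]; push_cast; ring

theorem Theta_gS (k : ℕ) : Theta (gS k) = (2 * k : ℂ) • gS k - (2 * π : ℂ) • gS (k + 1) := by
  ext x
  have h1 : HasDerivAt (fun x : ℝ => Real.exp (-π * x ^ 2))
      (Real.exp (-π * x ^ 2) * (-π * (2 * x))) x := by
    have := ((hasDerivAt_pow 2 x).const_mul (-π)).exp
    simpa using this
  have h2 := ((hasDerivAt_pow (2 * k) x).mul h1).ofReal_comp
  have e : (gS k : ℝ → ℂ) = fun x : ℝ => ((x ^ (2 * k) * Real.exp (-π * x ^ 2) : ℝ) : ℂ) :=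
    funext (gS_apply k)
  have h3 : derivS (gS k) x = ((((2 * k : ℕ) : ℝ) * x ^ (2 * k - 1) * Real.exp (-π * x ^ 2) +
      x ^ (2 * k) * (Real.exp (-π * x ^ 2) * (-π * (2 * x))) : ℝ) : ℂ) := by
    rw [derivS_apply, e]
    exact h2.deriv
  rw [Theta, mulX_apply, h3, sub_apply, smul_apply, smul_apply, gS_apply, gS_apply]
  rcases k with _ | k
  · simp; ring
  · rw [show 2 * (k + 1) - 1 = 2 * k + 1 by omega]
    simp
    ring

theorem Theta_fourier (h : 𝓢(ℝ, ℂ)) : Theta (𝓕 h) + 𝓕 h = - 𝓕 (Theta h) := by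
  rw [Theta_add_self]
  have h1 : mulX (𝓕 h) = (1 / (2 * π * Complex.I) : ℂ) • 𝓕 (derivS h) := by
    ext x
    rw [mulX_apply, smul_apply, fourier_derivS, smul_eq_mul]
    field_simp
  have hI : (2 * π * Complex.I : ℂ) ≠ 0 := by
    simp [Real.pi_ne_zero]
  have h2 : ∀ (c : ℂ) (g : 𝓢(ℝ, ℂ)), derivS (c • g) = c • derivS g := fun c g => by
    simp [derivS]
  have h3 : (1 / (2 * π * Complex.I) : ℂ) * (-2 * π * Complex.I) = -1 := by
    field_simp
  rw [h1, h2, derivS_fourier, smul_smul, h3, neg_one_smul, Theta]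

theorem fourier_fourier_zero (g : 𝓢(ℝ, ℂ)) : 𝓕 (𝓕 g) 0 = g 0 := by
  have h1 : 𝓕⁻ (𝓕 g) 0 = g 0 := by rw [FourierTransform.fourierInv_fourier_eq]
  rw [← h1, fourierInv_apply_eq]
  simp

theorem integral_Phi_deriv (f : 𝓢(ℝ, ℂ)) :
    ∫ y in Set.Ioi (0 : ℝ), Phi (Theta f + f) y = -(1 / 2) * 𝓕 f 0 := by
  have hz : 𝓕 (Theta f + f) 0 = 0 := by
    rw [FourierTransform.fourier_add, add_apply, fourier_Theta_zero]; simp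
  have hd : ∀ y ∈ Set.Ioi (0 : ℝ), HasDerivAt (fun y : ℝ => (y : ℂ) * Phi f y)
      (Phi (Theta f + f) y) y := by
    intro y hy
    simp only [Set.mem_Ioi] at hy
    have hyC : (y : ℂ) ≠ 0 := by exact_mod_cast hy.ne'
    refine ((Complex.ofRealCLM.hasDerivAt (x := y)).mul (Phi_hasDerivAt f hy)).congr_deriv ?_
    rw [Phi_add _ _ hy]
    simp
    field_simp
    ring
  have hIntg : IntegrableOn (fun y => Phi (Theta f + f) y) (Set.Ioi 0) := by
    simpa using Psi_integrable _ hz 0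
  have ht : Filter.Tendsto (fun y : ℝ => (y : ℂ) * Phi f y) Filter.atTop (nhds 0) := by
    obtain ⟨C, hC, h⟩ := Phi_decay f 0
    rw [tendsto_zero_iff_norm_tendsto_zero]
    refine squeeze_zero' (g := fun y : ℝ => C * y⁻¹) (Filter.Eventually.of_forall fun _ => norm_nonneg _) ?_ ?_
    · filter_upwards [Filter.eventually_gt_atTop 0] with y hy
      rw [norm_mul, Complex.norm_real, Real.norm_of_nonneg hy.le]
      calc _ ≤ y * (C / y ^ (0 + 2)) := by gcongr; exact h y hy
        _ = _ := by field_simp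
    · simpa using tendsto_inv_atTop_zero.const_mul C
  have h0 : Filter.Tendsto (fun y : ℝ => (y : ℂ) * Phi f y) (nhdsWithin 0 (Set.Ioi 0))
      (nhds ((1 / 2) * 𝓕 f 0)) := by
    obtain ⟨C, hC, h⟩ := Phi_poisson f 0
    rw [tendsto_iff_norm_sub_tendsto_zero]
    refine squeeze_zero' (g := fun y : ℝ => y * (C * y ^ (0 + 1))) (Filter.Eventually.of_forall fun _ => norm_nonneg _) ?_ ?_
    · filter_upwards [self_mem_nhdsWithin] with y hy
      simp only [Set.mem_Ioi] at hy
      have hyC : (y : ℂ) ≠ 0 := by exact_mod_cast hy.ne'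
      have e : (y : ℂ) * Phi f y - 1 / 2 * 𝓕 f 0 = y * (Phi f y - (1 / (2 * y) : ℂ) * 𝓕 f 0) := by
        field_simp
      rw [e, norm_mul, Complex.norm_real, Real.norm_of_nonneg hy.le]
      gcongr
      exact h y hy
    · have : Continuous fun y : ℝ => y * (C * y ^ (0 + 1)) := by fun_prop
      have h := this.tendsto 0
      simp only [zero_mul] at h
      exact h.mono_left nhdsWithin_le_nhds
  set G : ℝ → ℂ := Function.update (fun y : ℝ => (y : ℂ) * Phi f y) 0 ((1 / 2) * 𝓕 f 0) with hG
  have hGe : ∀ y : ℝ, 0 < y → G =ᶠ[nhds y] (fun y : ℝ => (y : ℂ) * Phi f y) := by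
    intro y hy
    filter_upwards [lt_mem_nhds hy] with z hz
    rw [hG, Function.update_of_ne hz.ne']
  have hc : ContinuousWithinAt G (Set.Ici 0) 0 := by
    rw [hG, continuousWithinAt_update_same]
    rwa [Set.Ici_sdiff_left]
  have key := integral_Ioi_of_hasDerivAt_of_tendsto hc
    (fun y hy => (hd y hy).congr_of_eventuallyEq (hGe y hy)) hIntg
    (ht.congr' (by
      filter_upwards [Filter.eventually_gt_atTop 0] with y hy
      exact (hGe y hy).eq_of_nhds.symm))
  rw [key, hG, Function.update_self]
  ring

theorem fourier_FgS_zero (k : ℕ) : 𝓕 (𝓕 (gS (k + 1))) 0 = 0 := by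
  rw [fourier_fourier_zero, gS_apply]; simp

theorem J_value (k : ℕ) : ∫ y in Set.Ioi (0 : ℝ), Phi (𝓕 (gS (k + 1))) y =
    -((k.factorial : ℂ) / (4 * π ^ (k + 1))) := by
  have hpi : (π : ℂ) ≠ 0 := by exact_mod_cast Real.pi_ne_zero
  have main : ∀ k : ℕ, ∫ y in Set.Ioi (0 : ℝ), Phi (Theta (𝓕 (gS k)) + 𝓕 (gS k)) y
      = -(1 / 2) * gS k 0 := by
    intro k
    rw [integral_Phi_deriv, fourier_fourier_zero]
  have e : ∀ k : ℕ, Theta (𝓕 (gS k)) + 𝓕 (gS k) =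
      (2 * π : ℂ) • 𝓕 (gS (k + 1)) + (-(2 * k) : ℂ) • 𝓕 (gS k) := by
    intro k
    rw [Theta_fourier, Theta_gS, sub_eq_add_neg, ← neg_smul, FourierTransform.fourier_add,
      FourierTransform.fourier_smul, FourierTransform.fourier_smul]
    module
  have hIntg : ∀ k, IntegrableOn (fun y => Phi (𝓕 (gS (k + 1))) y) (Set.Ioi 0) := fun k => by
    simpa using Psi_integrable _ (fourier_FgS_zero k) 0
  induction k with
  | zero =>
    have h := main 0
    rw [e 0] at h
    simp only [Nat.cast_zero, mul_zero, neg_zero, zero_smul, add_zero, Phi_smul] at h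
    rw [integral_const_mul, gS_apply] at h
    simp at h
    simp
    field_simp
    linear_combination 2 * h
  | succ k ih =>
    have h := main (k + 1)
    rw [e (k + 1)] at h
    have h2 : ∫ y in Set.Ioi (0 : ℝ), Phi ((2 * π : ℂ) • 𝓕 (gS (k + 1 + 1)) +
        (-(2 * (k + 1 : ℕ)) : ℂ) • 𝓕 (gS (k + 1))) y =
        ∫ y in Set.Ioi (0 : ℝ), ((2 * π : ℂ) * Phi (𝓕 (gS (k + 1 + 1))) y +
        (-(2 * (k + 1 : ℕ)) : ℂ) * Phi (𝓕 (gS (k + 1))) y) := by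
      refine setIntegral_congr_fun measurableSet_Ioi fun y hy => ?_
      simp only [Set.mem_Ioi] at hy
      simp only [Phi_add _ _ hy, Phi_smul]
    rw [h2, integral_add ((hIntg _).const_mul _) ((hIntg _).const_mul _), integral_const_mul,
      integral_const_mul, ih, gS_apply] at h
    simp at h
    have h3 : ∫ y in Set.Ioi (0 : ℝ), Phi (𝓕 (gS (k + 1 + 1))) y =
      (1 / (2 * π)) * (2 * π * ∫ y in Set.Ioi (0 : ℝ), Phi (𝓕 (gS (k + 1 + 1))) y) := by
      field_simp
    rw [h3]
    have h4 : 2 * π * ∫ y in Set.Ioi (0 : ℝ), Phi (𝓕 (gS (k + 1 + 1))) y =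
      -(2 * (k + 1) * (k.factorial / (4 * π ^ (k + 1))) : ℂ) := by linear_combination h
    rw [h4, Nat.factorial_succ]
    push_cast
    field_simp
    ring

theorem gauss_moment_odd (k : ℕ) : ∫ v in Set.Ioi (0 : ℝ), v ^ (2 * k + 1) * Real.exp (-π * v ^ 2) =
    (k.factorial : ℝ) / (2 * π ^ (k + 1)) := by
  have h := integral_rpow_mul_exp_neg_mul_rpow (p := 2) (q := 2 * k + 1) (b := π) (by norm_num)
    (by have : (0 : ℝ) ≤ k := by positivity
        linarith) Real.pi_pos
  have e : ∀ v : ℝ, v ^ (2 * (k : ℝ) + 1) * Real.exp (-π * v ^ (2 : ℝ)) =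
      v ^ (2 * k + 1) * Real.exp (-π * v ^ 2) := by
    intro v
    rw [show (2 * (k : ℝ) + 1) = ((2 * k + 1 : ℕ) : ℝ) by push_cast; ring, Real.rpow_natCast]
    norm_num
  simp_rw [e] at h
  rw [h]
  have e2 : (2 * (k : ℝ) + 1 + 1) / 2 = k + 1 := by ring
  have e3 : -(2 * (k : ℝ) + 1 + 1) / 2 = -((k + 1 : ℕ) : ℝ) := by push_cast; ring
  rw [e2, Real.Gamma_nat_eq_factorial, e3, Real.rpow_neg Real.pi_pos.le, Real.rpow_natCast]
  field_simp

/-- The summation formula giving the denominator. -/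
theorem sum_B (k N : ℕ) : ∃ C, 0 < C ∧ ∀ ε > (0 : ℝ), ∀ p : ℤ,
    ‖(1 / 2 : ℂ) * ∑' s : ℤ, Psi (𝓕 (gS (k + 1))) 0 (ε * (2 * s + p)) -
      ((-(1 / (8 * ε)) * ∫ v in Set.Ioi (0 : ℝ), v ^ (2 * k + 1) * Real.exp (-π * v ^ 2) : ℝ) : ℂ)‖
      ≤ C * ε ^ (N + 1) := by
  obtain ⟨C, hC, h⟩ := Psi_sum _ (fourier_FgS_zero k) 0 N
  refine ⟨C, hC, fun ε hε p => ?_⟩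
  have h1 := h ε hε p
  simp only [zpow_zero, one_mul] at h1
  rw [J_value] at h1
  rw [gauss_moment_odd]
  have e : ∀ a : ℂ, (1 / 2 : ℂ) * a - ((-(1 / (8 * ε)) * ((k.factorial : ℝ) / (2 * π ^ (k + 1))) : ℝ) : ℂ) =
     (1 / 2 : ℂ) * (a - (1 / (2 * ε) : ℂ) * (-((k.factorial : ℂ) / (4 * π ^ (k + 1))))) := by
    intro a
    have hpi : (π : ℂ) ≠ 0 := by exact_mod_cast Real.pi_ne_zero
    have : (ε : ℂ) ≠ 0 := by exact_mod_cast hε.ne'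
    push_cast
    field_simp
    ring
  rw [e, norm_mul]
  have : ‖(1 / 2 : ℂ)‖ ≤ 1 := by norm_num
  calc _ ≤ 1 * (C * ε ^ (N + 1)) := by gcongr
    _ = _ := one_mul _

end EH

open Real
namespace EH
open SchwartzMap FourierTransform MeasureTheory

theorem hasSum_odd_inv_sq : HasSum (fun m : ℤ => 1 / (2 * m + 1 : ℝ) ^ 2) (π ^ 2 / 4) := by
  have hz := hasSum_zeta_two
  have he : HasSum (fun k : ℕ => 1 / ((2 * k : ℕ) : ℝ) ^ 2) (π ^ 2 / 24) := by
    have := hz.mul_left (1 / 4)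
    have e : (1 / 4 : ℝ) * (π ^ 2 / 6) = π ^ 2 / 24 := by ring
    rw [e] at this
    have e2 : (fun k : ℕ => 1 / ((2 * k : ℕ) : ℝ) ^ 2) = fun k : ℕ => 1 / 4 * (1 / (k : ℝ) ^ 2) := by
      funext k
      push_cast; rw [mul_pow]; ring
    rw [e2]; exact this
  have hs : Summable (fun k : ℕ => 1 / ((2 * k + 1 : ℕ) : ℝ) ^ 2) :=
    hz.summable.comp_injective (i := fun k => 2 * k + 1) (fun a b h => by simpa using h)
  have ho : HasSum (fun k : ℕ => 1 / ((2 * k + 1 : ℕ) : ℝ) ^ 2) (π ^ 2 / 8) := by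
    have h1 := HasSum.even_add_odd (f := fun k : ℕ => 1 / (k : ℝ) ^ 2) he hs.hasSum
    have h2 := h1.unique hz
    have : ∑' k : ℕ, 1 / ((2 * k + 1 : ℕ) : ℝ) ^ 2 = π ^ 2 / 8 := by linarith
    rw [← this]; exact hs.hasSum
  have := HasSum.of_nat_of_neg_add_one (f := fun m : ℤ => 1 / (2 * m + 1 : ℝ) ^ 2) (m := π ^ 2 / 8)
    (m' := π ^ 2 / 8)
    (by convert ho using 1; ext; push_cast; rfl)
    (by convert ho using 1; ext k; push_cast; congr 1; ring)
  convert this using 1; ring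

theorem even_fourier_gS (k : ℕ) (x : ℝ) : 𝓕 (gS k) (-x) = 𝓕 (gS k) x := by
  rw [fourier_coe, ← Real.fourierInv_eq_fourier_neg, Real.fourierInv_eq_fourier_comp_neg]
  have : (fun x => (gS k) (-x)) = gS k := by
    funext v
    simp [gS_apply]
  rw [this]

theorem integral_mul_Phi (f : 𝓢(ℝ, ℂ)) (hf : ∀ x, f (-x) = f x) :
    ∫ y in Set.Ioi (0 : ℝ), (y : ℂ) * Phi f y =
      (π ^ 2 / 4 : ℝ) * ∫ y in Set.Ioi (0 : ℝ), (y : ℂ) * f y := by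
  have habs : ∀ (c y : ℝ), f (c * y) = f (|c| * y) := by
    intro c y
    rcases abs_cases c with ⟨h, _⟩ | ⟨h, _⟩ <;> rw [h]
    rw [neg_mul, hf]
  have hIntg : IntegrableOn (fun y : ℝ => (y : ℂ) * f y) (Set.Ioi 0) := by
    have := (mulX f).integrable.integrableOn (s := Set.Ioi (0 : ℝ)) (μ := volume)
    exact this.congr_fun (fun x _ => mulX_apply f x) measurableSet_Ioi
  have hpos : ∀ m : ℤ, (0 : ℝ) < |(2 * m + 1 : ℝ)| := fun m => lt_of_lt_of_le one_pos (int_odd_ne m)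
  have e1 : ∀ (m : ℤ) (y : ℝ), (y : ℂ) * f ((2 * m + 1) * y) =
      ((1 / |(2 * m + 1 : ℝ)| : ℝ) : ℂ) * (((|(2 * m + 1 : ℝ)| * y : ℝ) : ℂ) * f (|(2 * m + 1 : ℝ)| * y)) := by
    intro m y
    rw [habs]
    have : ((|(2 * m + 1 : ℝ)| : ℝ) : ℂ) ≠ 0 := by exact_mod_cast (hpos m).ne'
    push_cast
    field_simp
  have hi : ∀ m : ℤ, IntegrableOn (fun y : ℝ => (y : ℂ) * f ((2 * m + 1) * y)) (Set.Ioi 0) := by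
    intro m
    simp_rw [e1]
    refine Integrable.const_mul ?_ _
    have := (integrableOn_Ioi_comp_mul_left_iff (fun y : ℝ => (y : ℂ) * f y) 0 (hpos m)).mpr
      (by simpa using hIntg)
    exact this
  have hv : ∀ m : ℤ, ∫ y in Set.Ioi (0 : ℝ), (y : ℂ) * f ((2 * m + 1) * y) =
      ((1 / (2 * m + 1 : ℝ) ^ 2 : ℝ) : ℂ) * ∫ y in Set.Ioi (0 : ℝ), (y : ℂ) * f y := by
    intro m
    simp_rw [e1]
    rw [integral_const_mul, integral_comp_mul_left_Ioi (fun y : ℝ => (y : ℂ) * f y) 0 (hpos m), mul_zero,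
      Complex.real_smul, ← mul_assoc, ← Complex.ofReal_mul]
    congr 2
    rw [← sq_abs (2 * (m : ℝ) + 1)]
    field_simp
  have hn : ∀ m : ℤ, ∫ y in Set.Ioi (0 : ℝ), ‖(y : ℂ) * f ((2 * m + 1) * y)‖ =
      (1 / (2 * m + 1 : ℝ) ^ 2) * ∫ y in Set.Ioi (0 : ℝ), ‖(y : ℂ) * f y‖ := by
    intro m
    simp_rw [e1]
    simp_rw [norm_mul ((1 / |(2 * m + 1 : ℝ)| : ℝ) : ℂ) _]
    rw [integral_const_mul, integral_comp_mul_left_Ioi (fun y : ℝ => ‖(y : ℂ) * f y‖) 0 (hpos m), mul_zero,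
      smul_eq_mul, ← mul_assoc]
    congr 1
    rw [← sq_abs (2 * (m : ℝ) + 1), Complex.norm_real, Real.norm_of_nonneg (by positivity)]
    field_simp
  have hS := hasSum_integral_of_summable_integral_norm (μ := volume.restrict (Set.Ioi (0 : ℝ))) hi
    (by simp_rw [hn]; exact hasSum_odd_inv_sq.summable.mul_right _)
  simp_rw [hv] at hS
  have hS2 := (Complex.hasSum_ofReal.mpr hasSum_odd_inv_sq).mul_right (∫ y in Set.Ioi (0 : ℝ), (y : ℂ) * f y)
  rw [hS2.unique hS]
  refine setIntegral_congr_fun measurableSet_Ioi fun y _ => ?_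
  simp only [Phi]
  rw [tsum_mul_left]

theorem schwartz_tendsto (f : 𝓢(ℝ, ℂ)) : Filter.Tendsto f Filter.atTop (nhds 0) := by
  obtain ⟨C, hC, h⟩ := schwartz_decay f 1
  rw [tendsto_zero_iff_norm_tendsto_zero]
  refine squeeze_zero' (g := fun y : ℝ => C * y⁻¹) (Filter.Eventually.of_forall fun _ => norm_nonneg _) ?_ ?_
  · filter_upwards [Filter.eventually_gt_atTop 0] with y hy
    have := h y
    rw [pow_one, abs_of_pos hy] at this
    rw [← div_eq_mul_inv, le_div_iff₀ hy]; linarith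
  · simpa using tendsto_inv_atTop_zero.const_mul C

theorem integral_mul_F (k : ℕ) : ∫ y in Set.Ioi (0 : ℝ), (y : ℂ) * 𝓕 (gS (k + 1)) y =
    -(1 / (4 * π ^ 2) : ℂ) * ∫ v, gS k v := by
  set u := 𝓕 (gS k) with hu
  have hpi : (π : ℂ) ≠ 0 := by exact_mod_cast Real.pi_ne_zero
  have h2 : ∀ (c : ℂ) (g : 𝓢(ℝ, ℂ)), derivS (c • g) = c • derivS g := fun c g => by
    simp [derivS]
  have hF : ∀ y, 𝓕 (gS (k + 1)) y = -(1 / (4 * π ^ 2) : ℂ) * derivS (derivS u) y := by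
    intro y
    rw [hu, derivS_fourier, h2, derivS_fourier, smul_smul, smul_apply, smul_eq_mul, gS]
    have : (-2 * π * Complex.I) * (-2 * π * Complex.I) = -(4 * π ^ 2 : ℂ) := by
      linear_combination (4 * π ^ 2 : ℂ) * Complex.I_sq
    rw [this]
    field_simp
  have hd : ∀ (g : 𝓢(ℝ, ℂ)) (x : ℝ), HasDerivAt g (derivS g x) x := fun g x =>
    g.differentiable.differentiableAt.hasDerivAt
  have key := integral_Ioi_of_hasDerivAt_of_tendsto (a := 0) (f := fun y : ℝ => (y : ℂ) * derivS u y - u y)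
    (f' := fun y : ℝ => (y : ℂ) * derivS (derivS u) y) (m := 0) ?_ ?_ ?_ ?_
  · simp_rw [hF]
    simp_rw [mul_left_comm _ (-(1 / (4 * π ^ 2) : ℂ)) _]
    rw [integral_const_mul, key, ← fourier_zero, ← hu]
    simp
  · apply Continuous.continuousWithinAt
    exact (Complex.continuous_ofReal.mul (derivS u).continuous).sub u.continuous
  · intro x _
    refine (((Complex.ofRealCLM.hasDerivAt (x := x)).mul (hd (derivS u) x)).sub (hd u x)).congr_deriv ?_
    simp
  · have := (mulX (derivS (derivS u))).integrable.integrableOn (s := Set.Ioi (0 : ℝ)) (μ := volume)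
    exact this.congr_fun (fun x _ => mulX_apply _ x) measurableSet_Ioi
  · have h1 := (schwartz_tendsto (mulX (derivS u))).sub (schwartz_tendsto u)
    simpa only [mulX_apply, sub_zero] using h1

/-- The summation formula giving the numerator. -/
theorem sum_A (k N : ℕ) : ∃ C, 0 < C ∧ ∀ ε > (0 : ℝ), ∀ p : ℤ,
    ‖(1 / 2 : ℂ) * ∑' s : ℤ, Psi (𝓕 (gS (k + 1))) 1 (ε * (2 * s + p)) -
      ((-(1 / (64 * ε)) * ∫ v : ℝ, v ^ (2 * k) * Real.exp (-π * v ^ 2) : ℝ) : ℂ)‖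
      ≤ C * ε ^ (N + 1) := by
  obtain ⟨C, hC, h⟩ := Psi_sum _ (fourier_FgS_zero k) 1 N
  refine ⟨C, hC, fun ε hε p => ?_⟩
  have h1 := h ε hε p
  simp only [zpow_one] at h1
  rw [integral_mul_Phi _ (even_fourier_gS _), integral_mul_F] at h1
  simp_rw [gS_apply] at h1
  rw [integral_complex_ofReal] at h1
  set I := ∫ v : ℝ, v ^ (2 * k) * Real.exp (-π * v ^ 2)
  have e : ∀ a : ℂ, (1 / 2 : ℂ) * a - ((-(1 / (64 * ε)) * I : ℝ) : ℂ) =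
     (1 / 2 : ℂ) * (a - (1 / (2 * ε) : ℂ) * ((π ^ 2 / 4 : ℝ) * (-(1 / (4 * π ^ 2) : ℂ) * I))) := by
    intro a
    have hpi : (π : ℂ) ≠ 0 := by exact_mod_cast Real.pi_ne_zero
    have : (ε : ℂ) ≠ 0 := by exact_mod_cast hε.ne'
    push_cast
    field_simp
    ring
  rw [e, norm_mul]
  have : ‖(1 / 2 : ℂ)‖ ≤ 1 := by norm_num
  calc _ ≤ 1 * (C * ε ^ (N + 1)) := by gcongr
    _ = _ := one_mul _

end EH

open Real
namespace EH

/-- number of `±1`-paths of length `n` from `0` to `x` -/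
noncomputable def b : ℕ → ℤ → ℝ
  | 0, x => if x = 0 then 1 else 0
  | n + 1, x => b n (x - 1) + b n (x + 1)

theorem b_zero (x : ℤ) : b 0 x = if x = 0 then 1 else 0 := rfl
theorem b_succ (n : ℕ) (x : ℤ) : b (n + 1) x = b n (x - 1) + b n (x + 1) := rfl

theorem b_neg (n : ℕ) (x : ℤ) : b n (-x) = b n x := by
  induction n generalizing x with
  | zero => simp [b_zero]
  | succ n ih =>
    rw [b_succ, b_succ, ← ih (-x - 1), ← ih (-x + 1), add_comm]
    congr 2 <;> ring

theorem b_support (n : ℕ) (x : ℤ) (h : (n : ℤ) < |x|) : b n x = 0 := by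
  induction n generalizing x with
  | zero => rw [b_zero, if_neg]; rintro rfl; simp at h
  | succ n ih =>
    rw [b_succ, ih, ih, add_zero]
    all_goals
      push_cast at h
      rw [lt_abs] at h ⊢
      omega

theorem b_parity (n : ℕ) (x : ℤ) (h : (x - n) % 2 ≠ 0) : b n x = 0 := by
  induction n generalizing x with
  | zero => rw [b_zero, if_neg]; rintro rfl; simp at h
  | succ n ih =>
    push_cast at h
    rw [b_succ, ih, ih, add_zero] <;> omega

theorem b_summable (n : ℕ) (a c : ℤ) (ha : a ≠ 0) : Summable fun k : ℤ => b n (c + k * a) := by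
  apply summable_of_hasFiniteSupport
  have : (Function.support fun k : ℤ => b n (c + k * a)) ⊆ (fun k : ℤ => c + k * a) ⁻¹' (Set.Icc (-(n : ℤ)) n) := by
    intro k hk
    simp only [Function.mem_support] at hk
    by_contra hc
    apply hk
    apply b_support
    simp only [Set.mem_preimage, Set.mem_Icc] at hc
    rw [lt_abs]
    omega
  refine Set.Finite.subset (Set.Finite.preimage ?_ (Set.finite_Icc _ _)) this
  intro x _ y _ h
  simpa [ha] using h

/-- sum of `b` along a progression -/
noncomputable def bs (n : ℕ) (a c : ℤ) : ℝ := ∑' k : ℤ, b n (c + k * a)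

theorem bs_succ (n : ℕ) (a c : ℤ) (ha : a ≠ 0) : bs (n + 1) a c = bs n a (c - 1) + bs n a (c + 1) := by
  unfold bs
  rw [← (b_summable n a _ ha).tsum_add (b_summable n a _ ha)]
  congr 1; ext k
  rw [b_succ]
  congr 2 <;> ring

theorem bs_shift (n : ℕ) (a c : ℤ) : bs n a (c + a) = bs n a c := by
  unfold bs
  rw [← (Equiv.addRight (1 : ℤ)).tsum_eq (fun k : ℤ => b n (c + k * a))]
  congr 1; ext k
  congr 1
  simp
  ring

theorem bs_neg (n : ℕ) (a c : ℤ) : bs n a (-c) = bs n a c := by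
  unfold bs
  rw [← (Equiv.neg ℤ).tsum_eq (fun k : ℤ => b n (c + k * a))]
  congr 1; ext k
  rw [← b_neg]
  congr 1
  simp
  ring

theorem bs_zero (a c : ℤ) (hc : 0 ≤ c) (hca : c < a) : bs 0 a c = if c = 0 then 1 else 0 := by
  unfold bs
  rw [tsum_eq_single 0]
  · simp [b_zero]
  · intro k hk
    rw [b_zero, if_neg]
    intro h
    rcases lt_trichotomy k 0 with h1 | h1 | h1
    · nlinarith
    · exact hk h1
    · nlinarith

def adm (n h : ℕ) (s : ℤ) (ε : Fin n → Bool) : Prop :=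
  (∀ k ≤ n, 0 ≤ walkSum n ε k ∧ walkSum n ε k ≤ (h : ℤ)) ∧ walkSum n ε n = s

noncomputable def Wg (n h : ℕ) (s : ℤ) : ℕ := Nat.card {ε : Fin n → Bool // adm n h s ε}

theorem W_eq (n h : ℕ) : W n h = Wg n h h := rfl

theorem Wg_out (n h : ℕ) (s : ℤ) (hs : s < 0 ∨ (h : ℤ) < s) : Wg n h s = 0 := by
  have : IsEmpty {ε : Fin n → Bool // adm n h s ε} := by
    constructor
    rintro ⟨ε, h1, h2⟩
    have := h1 n le_rfl
    omega
  exact Nat.card_of_isEmpty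

theorem walkSum_snoc (n : ℕ) (ε : Fin n → Bool) (c : Bool) (k : ℕ) (hk : k ≤ n) :
    walkSum (n + 1) (Fin.snoc ε c) k = walkSum n ε k := by
  unfold walkSum
  rw [Fin.sum_univ_castSucc]
  simp
  omega

theorem walkSum_snoc_last (n : ℕ) (ε : Fin n → Bool) (c : Bool) :
    walkSum (n + 1) (Fin.snoc ε c) (n + 1) = walkSum n ε n + if c then 1 else -1 := by
  unfold walkSum
  rw [Fin.sum_univ_castSucc]
  simp

theorem adm_snoc (n h : ℕ) (s : ℤ) (hs : 0 ≤ s ∧ s ≤ h) (ε : Fin n → Bool) (c : Bool) :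
    adm (n + 1) h s (Fin.snoc ε c) ↔ adm n h (s - if c then 1 else -1) ε := by
  unfold adm
  rw [walkSum_snoc_last]
  constructor
  · rintro ⟨h1, h2⟩
    refine ⟨fun k hk => ?_, by linarith⟩
    have := h1 k (by omega)
    rwa [walkSum_snoc _ _ _ _ hk] at this
  · rintro ⟨h1, h2⟩
    refine ⟨fun k hk => ?_, by linarith⟩
    rcases Nat.lt_or_ge n k with h3 | h3
    · obtain rfl : k = n + 1 := by omega
      rw [walkSum_snoc_last, h2]
      simpa using hs
    · rw [walkSum_snoc _ _ _ _ h3]; exact h1 k h3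

theorem Wg_succ (n h : ℕ) (s : ℤ) (hs : 0 ≤ s ∧ s ≤ h) :
    Wg (n + 1) h s = Wg n h (s - 1) + Wg n h (s + 1) := by
  unfold Wg
  rw [← Nat.card_sum]
  refine Nat.card_congr (Equiv.ofBijective (fun x : {ε // adm n h (s - 1) ε} ⊕ {ε // adm n h (s + 1) ε} =>
    (Sum.elim (fun e => ⟨Fin.snoc e.1 true, (adm_snoc n h s hs e.1 true).mpr (by simpa using e.2)⟩)
    (fun e => ⟨Fin.snoc e.1 false, (adm_snoc n h s hs e.1 false).mpr (by simpa using e.2)⟩) x :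
      {ε : Fin (n + 1) → Bool // adm (n + 1) h s ε})) ⟨?_, ?_⟩).symm
  · rintro (⟨e, he⟩ | ⟨e, he⟩) (⟨f, hf⟩ | ⟨f, hf⟩) hef <;> simp [Fin.snoc_inj] at hef ⊢
    · exact hef
    · exact hef
  · rintro ⟨e, he⟩
    obtain ⟨e', c, rfl⟩ : ∃ (e' : Fin n → Bool) (c : Bool), e = Fin.snoc e' c :=
      ⟨Fin.init e, e (Fin.last n), by simp⟩
    have := (adm_snoc n h s hs e' c).mp he
    cases c
    · exact ⟨Sum.inr ⟨e', by simpa using this⟩, rfl⟩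
    · exact ⟨Sum.inl ⟨e', by simpa using this⟩, rfl⟩

theorem Wg_zero (h : ℕ) (s : ℤ) : (Wg 0 h s : ℝ) = if s = 0 then 1 else 0 := by
  unfold Wg
  split_ifs with hs
  · have : Unique {ε : Fin 0 → Bool // adm 0 h s ε} := by
      refine ⟨⟨⟨fun _ => true, ?_⟩⟩, ?_⟩
      · refine ⟨fun k hk => ?_, ?_⟩ <;> simp [walkSum, hs]
      · intro a; exact Subsingleton.elim _ _
    simp
  · have : IsEmpty {ε : Fin 0 → Bool // adm 0 h s ε} := by
      constructor
      rintro ⟨ε, h1, h2⟩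
      apply hs
      rw [← h2]; simp [walkSum]
    simp

theorem Wg_formula (n h : ℕ) (s : ℤ) (hs : -1 ≤ s ∧ s ≤ h + 1) :
    (Wg n h s : ℝ) = bs n (2 * (h + 2)) s - bs n (2 * (h + 2)) (-s - 2) := by
  have hbd : ∀ (n : ℕ) (s : ℤ), (s = -1 ∨ s = h + 1) →
    (Wg n h s : ℝ) = bs n (2 * (h + 2)) s - bs n (2 * (h + 2)) (-s - 2) := by
    intro n s hs
    rw [Wg_out n h s (by omega)]
    rcases hs with rfl | rfl
    · norm_num
    · rw [← bs_shift n (2 * (h + 2)) (-(h + 1) - 2),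
        show (-((h : ℤ) + 1) - 2 + 2 * (h + 2)) = h + 1 by ring]
      simp
  induction n generalizing s with
  | zero =>
    by_cases hb : s = -1 ∨ s = h + 1
    · exact hbd 0 s hb
    have h1 := bs_zero (2 * (h + 2)) (-s - 2 + 2 * (h + 2)) (by omega) (by omega)
    rw [bs_shift, if_neg (by omega)] at h1
    rw [Wg_zero, bs_zero _ _ (by omega) (by omega), h1, sub_zero]
  | succ n ih =>
    by_cases hb : s = -1 ∨ s = h + 1
    · exact hbd _ s hb
    rw [Wg_succ n h s (by omega)]
    push_cast
    rw [ih _ (by omega), ih _ (by omega), bs_succ _ _ _ (by omega), bs_succ _ _ _ (by omega)]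
    rw [show -(s - 1) - 2 = -s - 2 + 1 by ring, show -(s + 1) - 2 = -s - 2 - 1 by ring]
    ring

noncomputable def g (n : ℕ) (x : ℤ) : ℝ := b n (x - 2) - 2 * b n x + b n (x + 2)

theorem g_summable (n : ℕ) (t : ℤ) (ht : t ≠ 0) : Summable fun m : ℤ => g n ((2 * m + 1) * t) := by
  have h := fun c => b_summable n (2 * t) c (by simpa using ht)
  have := ((h (t - 2)).sub ((h t).mul_left 2)).add (h (t + 2))
  refine this.congr fun m => ?_
  unfold g
  congr 2
  · congr 1; ring_nf
  · ring_nf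
  · ring_nf

theorem g_sum (n : ℕ) (t : ℤ) (ht : t ≠ 0) : (1 / 2) * ∑' m : ℤ, g n ((2 * m + 1) * t) =
    bs n (2 * t) (t - 2) - bs n (2 * t) t := by
  have h := fun c => b_summable n (2 * t) c (by simpa using ht)
  have e : ∑' m : ℤ, g n ((2 * m + 1) * t) =
      bs n (2 * t) (t - 2) - 2 * bs n (2 * t) t + bs n (2 * t) (t + 2) := by
    unfold bs
    rw [← tsum_mul_left, ← (h _).tsum_sub ((h _).mul_left 2), ← ((h _).sub ((h _).mul_left 2)).tsum_add (h _)]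
    congr 1; ext m
    unfold g
    congr 2
    · congr 1; ring_nf
    · ring_nf
    · ring_nf
  have e2 : bs n (2 * t) (t + 2) = bs n (2 * t) (t - 2) := by
    rw [← bs_neg, ← bs_shift]; congr 1; ring
  rw [e, e2]; ring

theorem W_formula (n h : ℕ) : (W n h : ℝ) = (1 / 2) * ∑' m : ℤ, g n ((2 * m + 1) * (h + 2)) := by
  rw [W_eq, Wg_formula n h h (by omega), g_sum _ _ (by omega)]
  congr 1
  · congr 1; ring
  · rw [← bs_shift]; congr 1; ring

theorem g_sum_one (n : ℕ) : (1 / 2) * ∑' m : ℤ, g n ((2 * m + 1) * 1) = 0 := by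
  rw [g_sum _ _ (by omega)]
  have := bs_shift n (2 * 1) (1 - 2)
  norm_num at this ⊢
  rw [this]; ring

theorem g_parity (n : ℕ) (x : ℤ) (h : (x - n) % 2 ≠ 0) : g n x = 0 := by
  unfold g
  rw [b_parity, b_parity, b_parity] <;> first | omega | norm_num

theorem g_support (n : ℕ) (x : ℤ) (h : (n : ℤ) + 2 < |x|) : g n x = 0 := by
  unfold g
  rw [b_support, b_support, b_support]
  · norm_num
  all_goals rw [lt_abs] at h ⊢; omega

theorem W_large (n h : ℕ) (hh : n < h) : W n h = 0 := by
  have : (W n h : ℝ) = 0 := by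
    rw [W_formula]
    have : (fun m : ℤ => g n ((2 * m + 1) * (h + 2))) = fun _ => 0 := by
      funext m
      apply g_support
      rw [abs_mul]
      have h1 : 1 ≤ |2 * m + 1| := Int.one_le_abs (by omega)
      have h2 : |(h : ℤ) + 2| = h + 2 := abs_of_nonneg (by omega)
      rw [h2]
      nlinarith
    rw [this]; simp
  exact_mod_cast this

end EH

open Real
namespace EH
open MeasureTheory

theorem b_integral (n : ℕ) (x : ℤ) :
    b n x = 1 / (2 * π) * ∫ t in (-π)..π, (2 * Real.cos t) ^ n * Real.cos (x * t) := by
  induction n generalizing x with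
  | zero =>
    rw [b_zero]
    split_ifs with h
    · subst h
      simp
      field_simp
      ring
    · have hx : (x : ℝ) ≠ 0 := by exact_mod_cast h
      simp only [pow_zero, one_mul]
      rw [intervalIntegral.integral_comp_mul_left (fun t => Real.cos t) hx, integral_cos]
      have h1 : Real.sin (x * π) = 0 := Real.sin_int_mul_pi x
      rw [mul_neg, Real.sin_neg, h1]
      simp
  | succ n ih =>
    rw [b_succ, ih, ih, ← mul_add, ← intervalIntegral.integral_add]
    · congr 2
      ext t
      push_cast
      rw [sub_mul, add_mul, one_mul, Real.cos_sub, Real.cos_add]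
      ring
    all_goals
      apply Continuous.intervalIntegrable
      fun_prop

theorem g_integral0 (n : ℕ) (x : ℤ) :
    g n x = -(2 * 2 ^ n / π) * ∫ t in (-π)..π, Real.cos t ^ n * Real.sin t ^ 2 * Real.cos (x * t) := by
  have hi : ∀ x : ℤ, IntervalIntegrable (fun t => (2 * Real.cos t) ^ n * Real.cos (x * t)) volume (-π) π := by
    intro x
    apply Continuous.intervalIntegrable
    fun_prop
  unfold g
  rw [b_integral, b_integral, b_integral, mul_left_comm, ← mul_sub, ← mul_add, ← intervalIntegral.integral_const_mul,
    ← intervalIntegral.integral_sub (hi _) ((hi _).const_mul _), ← intervalIntegral.integral_add ((hi _).sub ((hi _).const_mul _)) (hi _),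
    ← intervalIntegral.integral_const_mul, ← intervalIntegral.integral_const_mul]
  congr 1
  ext t
  push_cast
  rw [sub_mul, add_mul, Real.cos_sub, Real.cos_add, mul_pow, Real.cos_two_mul, Real.sin_sq]
  have := Real.pi_ne_zero
  field_simp
  ring

theorem cos_int_mul_pi_sub (x : ℤ) (t : ℝ) : Real.cos (x * (π - t)) = (-1 : ℝ) ^ x * Real.cos (x * t) := by
  rw [mul_sub, Real.cos_sub, Real.sin_int_mul_pi, zero_mul, add_zero, Real.cos_int_mul_pi]

theorem g_integral (n : ℕ) (x : ℤ) (h : (x - n) % 2 = 0) :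
    g n x = -(8 * 2 ^ n / π) * ∫ t in (0 : ℝ)..(π / 2), Real.cos t ^ n * Real.sin t ^ 2 * Real.cos (x * t) := by
  set f : ℝ → ℝ := fun t => Real.cos t ^ n * Real.sin t ^ 2 * Real.cos (x * t) with hf
  have hc : Continuous f := by rw [hf]; fun_prop
  have hi : ∀ a b, IntervalIntegrable f volume a b := fun a b => hc.intervalIntegrable a b
  have h1 : ∫ t in (-π)..0, f t = ∫ t in (0 : ℝ)..π, f t := by
    have := intervalIntegral.integral_comp_neg f (a := 0) (b := π)
    rw [neg_zero] at this
    rw [← this]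
    congr 1
    ext t
    simp [hf]
  have hpar : (-1 : ℝ) ^ n * (-1 : ℝ) ^ x = 1 := by
    have : x = n + 2 * ((x - n) / 2) := by omega
    rw [this, zpow_add₀ (by norm_num), zpow_mul, zpow_natCast, ← mul_assoc, ← mul_pow]
    norm_num
  have h2 : ∫ t in (π / 2)..π, f t = ∫ t in (0 : ℝ)..(π / 2), f t := by
    have := intervalIntegral.integral_comp_sub_left f (a := 0) (b := π / 2) π
    rw [sub_zero, show π - π / 2 = π / 2 by ring] at this
    rw [← this]
    congr 1
    ext t
    simp only [hf]
    rw [cos_int_mul_pi_sub, Real.cos_pi_sub, Real.sin_pi_sub, neg_pow]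
    linear_combination (Real.cos t ^ n * Real.sin t ^ 2 * Real.cos (x * t)) * hpar
  rw [g_integral0, ← intervalIntegral.integral_add_adjacent_intervals (hi (-π) 0) (hi 0 π), h1,
    ← intervalIntegral.integral_add_adjacent_intervals (hi 0 (π / 2)) (hi (π / 2) π), h2]
  ring

end EH

open Real
namespace EH

/-- even Taylor approximation on `[-1,1]` -/
def TM (M : ℕ) (f : ℝ → ℝ) : Prop :=
  ∃ p : Polynomial ℝ, ∃ C : ℝ, 0 ≤ C ∧ ∀ t : ℝ, |t| ≤ 1 → |f t - p.eval (t ^ 2)| ≤ C * (t ^ 2) ^ M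

theorem poly_bound (p : Polynomial ℝ) : ∃ B : ℝ, 0 ≤ B ∧ ∀ t : ℝ, |t| ≤ 1 → |p.eval (t ^ 2)| ≤ B := by
  obtain ⟨B, hB⟩ := (isCompact_Icc (a := (-1 : ℝ)) (b := 1)).exists_bound_of_continuousOn
    (f := fun t : ℝ => p.eval (t ^ 2)) (by fun_prop)
  refine ⟨|B|, abs_nonneg _, fun t ht => ?_⟩
  exact (hB t (abs_le.mp ht)).trans (le_abs_self B)

theorem sq_pow_le_one (t : ℝ) (ht : |t| ≤ 1) (M : ℕ) : (t ^ 2) ^ M ≤ 1 := by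
  apply pow_le_one₀ (by positivity)
  rw [← sq_abs]
  exact pow_le_one₀ (abs_nonneg _) ht

theorem TM.bound {M : ℕ} {f : ℝ → ℝ} (h : TM M f) : ∃ B : ℝ, 0 ≤ B ∧ ∀ t : ℝ, |t| ≤ 1 → |f t| ≤ B := by
  obtain ⟨p, C, hC, h⟩ := h
  obtain ⟨B, hB, hb⟩ := poly_bound p
  refine ⟨C + B, by positivity, fun t ht => ?_⟩
  have h1 := h t ht
  have h2 := hb t ht
  have h3 : C * (t ^ 2) ^ M ≤ C * 1 := by gcongr; exact sq_pow_le_one t ht M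
  calc |f t| = |(f t - p.eval (t ^ 2)) + p.eval (t ^ 2)| := by ring_nf
    _ ≤ |f t - p.eval (t ^ 2)| + |p.eval (t ^ 2)| := abs_add_le _ _
    _ ≤ _ := by linarith

theorem TM.mul {M : ℕ} {f g : ℝ → ℝ} (hf : TM M f) (hg : TM M g) : TM M (fun t => f t * g t) := by
  obtain ⟨Bg, hBg, hbg⟩ := hg.bound
  obtain ⟨p, C, hC, h⟩ := hf
  obtain ⟨q, C', hC', h'⟩ := hg
  obtain ⟨Bp, hBp, hbp⟩ := poly_bound p
  refine ⟨p * q, C * Bg + Bp * C', by positivity, fun t ht => ?_⟩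
  have e : f t * g t - (p * q).eval (t ^ 2) = (f t - p.eval (t ^ 2)) * g t +
      p.eval (t ^ 2) * (g t - q.eval (t ^ 2)) := by
    rw [Polynomial.eval_mul]; ring
  rw [e]
  refine (abs_add_le _ _).trans ?_
  rw [abs_mul, abs_mul]
  have h1 := h t ht
  have h2 := h' t ht
  have h3 := hbg t ht
  have h4 := hbp t ht
  calc _ ≤ C * (t ^ 2) ^ M * Bg + Bp * (C' * (t ^ 2) ^ M) := by gcongr
    _ = _ := by ring

theorem TM.sub {M : ℕ} {f g : ℝ → ℝ} (hf : TM M f) (hg : TM M g) : TM M (fun t => f t - g t) := by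
  obtain ⟨p, C, hC, h⟩ := hf
  obtain ⟨q, C', hC', h'⟩ := hg
  refine ⟨p - q, C + C', by positivity, fun t ht => ?_⟩
  have e : f t - g t - (p - q).eval (t ^ 2) = (f t - p.eval (t ^ 2)) - (g t - q.eval (t ^ 2)) := by
    rw [Polynomial.eval_sub]; ring
  rw [e]
  refine (abs_sub _ _).trans ?_
  have h1 := h t ht
  have h2 := h' t ht
  linarith

theorem TM.one (M : ℕ) : TM M (fun _ => 1) := ⟨1, 0, le_rfl, fun t _ => by simp⟩

theorem TM.pow {M : ℕ} {f : ℝ → ℝ} (hf : TM M f) (j : ℕ) : TM M (fun t => f t ^ j) := by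
  induction j with
  | zero => simpa using TM.one M
  | succ j ih => simp_rw [pow_succ]; exact ih.mul hf

theorem series_bound (f : ℝ → ℝ) (a : ℕ → ℝ) (ha : Summable fun k => |a k|)
    (h : ∀ t : ℝ, HasSum (fun k => a k * (t ^ 2) ^ k) (f t)) (M : ℕ) :
    ∃ C : ℝ, 0 ≤ C ∧ ∀ t : ℝ, |t| ≤ 1 → |f t - ∑ k ∈ Finset.range M, a k * (t ^ 2) ^ k| ≤ C * (t ^ 2) ^ M := by
  refine ⟨∑' k, |a (k + M)|, tsum_nonneg fun _ => abs_nonneg _, fun t ht => ?_⟩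
  have hs : Summable fun k => |a (k + M)| := (summable_nat_add_iff M).mpr ha
  rw [← (h t).tsum_eq, ← (h t).summable.sum_add_tsum_nat_add M, add_sub_cancel_left, ← tsum_mul_right]
  have := tsum_of_norm_bounded (f := fun k => a (k + M) * (t ^ 2) ^ (k + M)) (hs.mul_right ((t ^ 2) ^ M)).hasSum
    (fun k => by
      rw [Real.norm_eq_abs, abs_mul, abs_of_nonneg (by positivity : 0 ≤ (t ^ 2) ^ (k + M)), pow_add]
      have := sq_pow_le_one t ht k
      gcongr
      nlinarith [show 0 ≤ (t ^ 2) ^ M by positivity])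
  exact this

theorem TM_of_series (f : ℝ → ℝ) (a : ℕ → ℝ) (ha : Summable fun k => |a k|)
    (h : ∀ t : ℝ, HasSum (fun k => a k * (t ^ 2) ^ k) (f t)) (M : ℕ) : TM M f := by
  obtain ⟨C, hC, hb⟩ := series_bound f a ha h M
  refine ⟨∑ k ∈ Finset.range M, Polynomial.C (a k) * Polynomial.X ^ k, C, hC, fun t ht => ?_⟩
  rw [Polynomial.eval_finsetSum]
  simpa using hb t ht

theorem cos_series : (Summable fun k : ℕ => |(-1 : ℝ) ^ k / (2 * k).factorial|) ∧
    ∀ t : ℝ, HasSum (fun k : ℕ => (-1 : ℝ) ^ k / (2 * k).factorial * (t ^ 2) ^ k) (Real.cos t) := by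
  constructor
  · have h := (Real.summable_pow_div_factorial 1).comp_injective (i := fun k : ℕ => 2 * k)
      (fun a b h => by simpa using h)
    refine h.congr fun k => ?_
    simp [abs_div]
  · intro t
    convert Real.hasSum_cos t using 2 with k
    rw [← pow_mul]; ring

theorem exp_series : (Summable fun k : ℕ => |(1 / 2 : ℝ) ^ k / k.factorial|) ∧
    ∀ t : ℝ, HasSum (fun k : ℕ => (1 / 2 : ℝ) ^ k / k.factorial * (t ^ 2) ^ k) (Real.exp (t ^ 2 / 2)) := by
  constructor
  · exact (Real.summable_pow_div_factorial (1 / 2)).abs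
  · intro t
    have := NormedSpace.expSeries_div_hasSum_exp (𝔸 := ℝ) (t ^ 2 / 2)
    rw [← Real.exp_eq_exp_ℝ] at this
    have e : (fun k : ℕ => (1 / 2 : ℝ) ^ k / k.factorial * (t ^ 2) ^ k) =
        fun k : ℕ => (t ^ 2 / 2) ^ k / (k.factorial : ℝ) := by
      funext k
      rw [div_mul_eq_mul_div, ← mul_pow]; congr 2; ring
    rw [e]; exact this

noncomputable def dl (t : ℝ) : ℝ := 1 - Real.cos t * Real.exp (t ^ 2 / 2)

theorem TM_cos (M : ℕ) : TM M Real.cos := TM_of_series _ _ cos_series.1 cos_series.2 M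
theorem TM_exp (M : ℕ) : TM M (fun t => Real.exp (t ^ 2 / 2)) := TM_of_series _ _ exp_series.1 exp_series.2 M
theorem TM_dl (M : ℕ) : TM M dl := (TM.one M).sub ((TM_cos M).mul (TM_exp M))
theorem TM_sin_sq (M : ℕ) : TM M (fun t => Real.sin t ^ 2) := by
  simp_rw [Real.sin_sq]
  exact (TM.one M).sub ((TM_cos M).pow 2)

theorem cos_le_gauss (t : ℝ) (h0 : 0 ≤ t) (h1 : t ≤ π / 2) : Real.cos t * Real.exp (t ^ 2 / 2) ≤ 1 := by
  have hd : ∀ t : ℝ, HasDerivAt (fun t : ℝ => Real.cos t * Real.exp (t ^ 2 / 2))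
      (-Real.sin t * Real.exp (t ^ 2 / 2) + Real.cos t * (Real.exp (t ^ 2 / 2) * t)) t := by
    intro t
    have h2 : HasDerivAt (fun t : ℝ => Real.exp (t ^ 2 / 2)) (Real.exp (t ^ 2 / 2) * t) t := by
      have := ((hasDerivAt_pow 2 t).div_const 2).exp
      refine this.congr_deriv ?_
      simp
    exact (Real.hasDerivAt_cos t).mul h2
  have ha : AntitoneOn (fun t : ℝ => Real.cos t * Real.exp (t ^ 2 / 2)) (Set.Icc 0 (π / 2)) := by
    apply antitoneOn_of_deriv_nonpos (convex_Icc _ _)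
    · fun_prop
    · intro x _; exact (hd x).differentiableAt.differentiableWithinAt
    · intro x hx
      rw [interior_Icc] at hx
      rw [(hd x).deriv]
      have hc : 0 < Real.cos x := Real.cos_pos_of_mem_Ioo ⟨by linarith [hx.1, Real.pi_pos], hx.2⟩
      have ht := Real.lt_tan hx.1 hx.2
      rw [Real.tan_eq_sin_div_cos, lt_div_iff₀ hc] at ht
      nlinarith [Real.exp_pos (x ^ 2 / 2)]
  have := ha ⟨le_rfl, by positivity⟩ ⟨h0, h1⟩ h0
  simpa using this

theorem dl_nonneg (t : ℝ) (h0 : 0 ≤ t) (h1 : t ≤ π / 2) : 0 ≤ dl t := by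
  have := cos_le_gauss t h0 h1
  unfold dl; linarith

theorem dl_le_one (t : ℝ) (h0 : 0 ≤ t) (h1 : t ≤ π / 2) : dl t ≤ 1 := by
  have : 0 ≤ Real.cos t := Real.cos_nonneg_of_mem_Icc ⟨by linarith [Real.pi_pos], h1⟩
  unfold dl
  have := mul_nonneg this (Real.exp_pos (t ^ 2 / 2)).le
  linarith

theorem dl_bound : ∃ C : ℝ, 0 ≤ C ∧ ∀ t : ℝ, |t| ≤ 1 → |dl t| ≤ C * (t ^ 2) ^ 2 := by
  obtain ⟨C, hC, h⟩ := series_bound _ _ cos_series.1 cos_series.2 2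
  obtain ⟨C', hC', h'⟩ := series_bound _ _ exp_series.1 exp_series.2 2
  refine ⟨1 + C * Real.exp 1 + 2 * C', by positivity, fun t ht => ?_⟩
  have h1 := h t ht
  have h2 := h' t ht
  have ht2 : t ^ 2 ≤ 1 := by simpa using sq_pow_le_one t ht 1
  simp only [Finset.sum_range_succ, Finset.sum_range_zero] at h1 h2
  norm_num at h1 h2
  have e : dl t = (t ^ 2) ^ 2 / 4 - (Real.cos t - (1 + -(1 / 2 * t ^ 2))) * Real.exp (t ^ 2 / 2) -
      (1 + -(1 / 2 * t ^ 2)) * (Real.exp (t ^ 2 / 2) - (1 + 1 / 2 * t ^ 2)) := by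
    unfold dl; ring
  have h3 : Real.exp (t ^ 2 / 2) ≤ Real.exp 1 := by apply Real.exp_le_exp.mpr; nlinarith
  have h4 : |1 + -(1 / 2 * t ^ 2)| ≤ 2 := by rw [abs_le]; constructor <;> nlinarith [sq_nonneg t]
  rw [e]
  refine (abs_sub _ _).trans ?_
  refine (add_le_add_left (abs_sub _ _) _).trans ?_
  rw [abs_mul, abs_mul, Real.abs_exp, abs_of_nonneg (by positivity : 0 ≤ (t ^ 2) ^ 2 / 4)]
  calc _ ≤ (t ^ 2) ^ 2 / 4 + C * (t ^ 2) ^ 2 * Real.exp 1 + 2 * (C' * (t ^ 2) ^ 2) := by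
        gcongr
    _ ≤ _ := by nlinarith [show 0 ≤ (t ^ 2) ^ 2 by positivity]

theorem binom_rem (d : ℝ) (h0 : 0 ≤ d) (h1 : d ≤ 1) (n J : ℕ) :
    |(1 - d) ^ n - ∑ j ∈ Finset.range J, (n.choose j : ℝ) * (-d) ^ j| ≤ n.choose J * d ^ J := by
  induction n generalizing J with
  | zero =>
    rcases J with _ | J
    · simp
    · rw [Finset.sum_range_succ']; simp
  | succ n ih =>
    rcases J with _ | J
    · simp
      rw [abs_of_nonneg (by linarith)]
      exact pow_le_one₀ (by linarith) (by linarith)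
    · have e : ∑ j ∈ Finset.range (J + 1), ((n + 1).choose j : ℝ) * (-d) ^ j =
        ∑ j ∈ Finset.range (J + 1), (n.choose j : ℝ) * (-d) ^ j -
          d * ∑ j ∈ Finset.range J, (n.choose j : ℝ) * (-d) ^ j := by
        rw [Finset.sum_range_succ', Finset.sum_range_succ' _ J, Finset.mul_sum]
        simp only [Nat.choose_succ_succ, Nat.choose_zero_right, Nat.cast_add, add_mul, Finset.sum_add_distrib, pow_succ]
        have : ∑ x ∈ Finset.range J, d * ((n.choose x : ℝ) * (-d) ^ x) =
          - ∑ x ∈ Finset.range J, (n.choose x : ℝ) * ((-d) ^ x * -d) := by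
          rw [← Finset.sum_neg_distrib]; exact Finset.sum_congr rfl fun x _ => by ring
        rw [this]; simp; ring
      have e2 : (1 - d) ^ (n + 1) - ∑ j ∈ Finset.range (J + 1), ((n + 1).choose j : ℝ) * (-d) ^ j =
        ((1 - d) ^ n - ∑ j ∈ Finset.range (J + 1), (n.choose j : ℝ) * (-d) ^ j) -
        d * ((1 - d) ^ n - ∑ j ∈ Finset.range J, (n.choose j : ℝ) * (-d) ^ j) := by
        rw [e]; ring
      rw [e2]
      refine (abs_sub _ _).trans ?_
      rw [abs_mul, abs_of_nonneg h0, Nat.choose_succ_succ]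
      calc _ ≤ n.choose (J + 1) * d ^ (J + 1) + d * (n.choose J * d ^ J) := by
            gcongr
            · exact ih (J + 1)
            · exact ih J
        _ = _ := by push_cast; ring

theorem gauss_sup (m n : ℕ) (hn : 1 ≤ n) (t : ℝ) :
    (t ^ 2) ^ m * Real.exp (-(n * t ^ 2 / 2)) ≤ 2 ^ m * m.factorial / (n : ℝ) ^ m := by
  have hn' : (0 : ℝ) < n := by exact_mod_cast hn
  have h := Real.pow_div_factorial_le_exp (n * t ^ 2 / 2) (by positivity) m
  rw [div_le_iff₀ (by positivity), div_pow, mul_pow, div_le_iff₀ (by positivity)] at h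
  rw [Real.exp_neg, ← div_eq_mul_inv, div_le_div_iff₀ (by positivity) (by positivity)]
  linarith

end EH

open Real
namespace EH

set_option maxHeartbeats 4000000 in
theorem gauss_approx (K : ℕ) : ∃ D J : ℕ, ∃ C : ℝ, 0 < C ∧ ∀ n : ℕ, 1 ≤ n → ∃ a : ℕ → ℝ,
    (∀ k < D, |a k| ≤ C * (n : ℝ) ^ J) ∧ ∀ t > (0 : ℝ),
      |(if t ≤ π / 2 then Real.cos t ^ n * Real.sin t ^ 2 else 0) -
        ∑ k ∈ Finset.range D, a k * (t ^ (2 * k + 2) * Real.exp (-(n * t ^ 2 / 2)))| ≤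
        C / (n : ℝ) ^ K * (t ^ 2 / (1 + t ^ 2) ^ 2) := by
  have hT : ∀ j : ℕ, TM (2 * K + 1) (fun t => Real.sin t ^ 2 * dl t ^ j) := fun j =>
    (TM_sin_sq _).mul ((TM_dl _).pow j)
  choose p Cp hCp hp using hT
  have hp0 : ∀ j, (p j).coeff 0 = 0 := by
    intro j
    have := hp j 0 (by simp)
    simp at this
    rwa [Polynomial.coeff_zero_eq_eval_zero]
  have hpq : ∀ (j : ℕ) (s : ℝ), (p j).eval s = (p j).divX.eval s * s := by
    intro j s
    conv_lhs => rw [← Polynomial.divX_mul_X_add (p j), hp0]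
    simp
  set q := fun j => (p j).divX with hq
  set D := ∑ j ∈ Finset.range K, (q j).natDegree + 1 with hD
  have hqe : ∀ j < K, ∀ s : ℝ, (q j).eval s = ∑ k ∈ Finset.range D, (q j).coeff k * s ^ k := by
    intro j hj s
    apply Polynomial.eval_eq_sum_range'
    rw [hD, Nat.lt_succ_iff]
    exact Finset.single_le_sum (f := fun j => (q j).natDegree) (fun _ _ => Nat.zero_le _) (Finset.mem_range.mpr hj)
  set Cq : ℝ := ∑ j ∈ Finset.range K, ∑ k ∈ Finset.range D, |(q j).coeff k| with hCq
  have hCq0 : 0 ≤ Cq := Finset.sum_nonneg fun _ _ => Finset.sum_nonneg fun _ _ => abs_nonneg _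
  obtain ⟨Cd, hCd, hd⟩ := dl_bound
  set C1 : ℝ := (Cd ^ K + ∑ j ∈ Finset.range K, Cp j) * (2 ^ (2 * K) * (2 * K).factorial) with hC1
  have hSp : 0 ≤ ∑ j ∈ Finset.range K, Cp j := Finset.sum_nonneg fun j _ => hCp j
  have hC10 : 0 ≤ C1 := by positivity
  set m := D + 2 * K + 2 with hm
  set S : ℝ := 2 ^ m * m.factorial with hS
  have hS0 : 0 ≤ S := by positivity
  refine ⟨D, K, 4 * (C1 + (1 + D * Cq) * S) + Cq + 1, by positivity, fun n hn => ?_⟩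
  have hn1 : (1 : ℝ) ≤ n := by exact_mod_cast hn
  have hn0 : (0 : ℝ) < n := by linarith
  set a : ℕ → ℝ := fun k => ∑ j ∈ Finset.range K, (n.choose j : ℝ) * (-1) ^ j * (q j).coeff k with ha
  have hch : ∀ j ≤ K, (n.choose j : ℝ) ≤ (n : ℝ) ^ K := by
    intro j hj
    calc (n.choose j : ℝ) ≤ (n : ℝ) ^ j := by exact_mod_cast Nat.choose_le_pow n j
      _ ≤ _ := pow_le_pow_right₀ hn1 hj
  have hab : ∀ k < D, |a k| ≤ Cq * (n : ℝ) ^ K := by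
    intro k hk
    rw [ha, hCq, Finset.sum_mul]
    refine (Finset.abs_sum_le_sum_abs _ _).trans (Finset.sum_le_sum fun j hj => ?_)
    rw [abs_mul, abs_mul, abs_pow, abs_neg, abs_one, one_pow, mul_one, mul_comm, Nat.abs_cast]
    have h1 := Finset.single_le_sum (f := fun k => |(q j).coeff k|) (fun _ _ => abs_nonneg _) (Finset.mem_range.mpr hk)
    have h2 := hch j (Finset.mem_range.mp hj).le
    gcongr
  refine ⟨a, fun k hk => (hab k hk).trans ?_, fun t ht => ?_⟩
  · gcongr
    have : 0 ≤ 4 * (C1 + (1 + D * Cq) * S) := by positivity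
    linarith
  set E := Real.exp (-(n * t ^ 2 / 2)) with hE
  have hE0 : 0 < E := Real.exp_pos _
  have ht2 : 0 < t ^ 2 := by positivity
  have hcn : ∀ t : ℝ, Real.cos t ^ n = (1 - dl t) ^ n * Real.exp (-(n * t ^ 2 / 2)) := by
    intro t
    have : (1 - dl t) = Real.cos t * Real.exp (t ^ 2 / 2) := by unfold dl; ring
    rw [this, mul_pow, ← Real.exp_nat_mul, mul_assoc, ← Real.exp_add]
    have : (n : ℝ) * (t ^ 2 / 2) + -(n * t ^ 2 / 2) = 0 := by ring
    rw [this]; simp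
  rcases le_or_gt t 1 with h1 | h1
  · have hpi : t ≤ π / 2 := by linarith [Real.pi_gt_three]
    have htabs : |t| ≤ 1 := by rw [abs_of_pos ht]; exact h1
    rw [if_pos hpi]
    have es : ∑ k ∈ Finset.range D, a k * (t ^ (2 * k + 2) * E) =
        E * ∑ j ∈ Finset.range K, (n.choose j : ℝ) * (-1) ^ j * (p j).eval (t ^ 2) := by
      have : ∀ j ∈ Finset.range K, (n.choose j : ℝ) * (-1) ^ j * (p j).eval (t ^ 2) =
          ∑ k ∈ Finset.range D, (n.choose j : ℝ) * (-1) ^ j * (q j).coeff k * t ^ (2 * k + 2) := by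
        intro j hj
        rw [hpq, hqe j (Finset.mem_range.mp hj), Finset.sum_mul, Finset.mul_sum]
        refine Finset.sum_congr rfl fun k _ => ?_
        rw [pow_add, pow_mul]; ring
      rw [Finset.sum_congr rfl this, Finset.sum_comm, Finset.mul_sum]
      refine Finset.sum_congr rfl fun k _ => ?_
      rw [ha, ← Finset.sum_mul]; ring
    have ed : Real.cos t ^ n * Real.sin t ^ 2 - E * ∑ j ∈ Finset.range K, (n.choose j : ℝ) * (-1) ^ j * (p j).eval (t ^ 2) =
        E * (Real.sin t ^ 2 * ((1 - dl t) ^ n - ∑ j ∈ Finset.range K, (n.choose j : ℝ) * (-dl t) ^ j) +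
        ∑ j ∈ Finset.range K, (n.choose j : ℝ) * (-1) ^ j * (Real.sin t ^ 2 * dl t ^ j - (p j).eval (t ^ 2))) := by
      have : ∑ j ∈ Finset.range K, (n.choose j : ℝ) * (-1) ^ j * (Real.sin t ^ 2 * dl t ^ j - (p j).eval (t ^ 2)) =
        Real.sin t ^ 2 * ∑ j ∈ Finset.range K, (n.choose j : ℝ) * (-dl t) ^ j -
          ∑ j ∈ Finset.range K, (n.choose j : ℝ) * (-1) ^ j * (p j).eval (t ^ 2) := by
        rw [Finset.mul_sum, ← Finset.sum_sub_distrib]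
        refine Finset.sum_congr rfl fun j _ => ?_
        rw [neg_pow (dl t)]; ring
      rw [this, hcn, ← hE]; ring
    rw [es, ed, abs_mul, abs_of_pos hE0]
    have hdl0 := dl_nonneg t ht.le hpi
    have b1 := binom_rem (dl t) hdl0 (dl_le_one t ht.le hpi) n K
    have b2 : dl t ^ K ≤ Cd ^ K * (t ^ 2) ^ (2 * K) := by
      have := hd t htabs
      rw [abs_of_nonneg hdl0] at this
      calc _ ≤ (Cd * (t ^ 2) ^ 2) ^ K := by gcongr
        _ = _ := by rw [mul_pow, pow_mul (t ^ 2)]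
    have b3 : Real.sin t ^ 2 ≤ t ^ 2 := by
      rw [sq_le_sq, abs_of_pos ht]; exact Real.abs_sin_le_abs.trans (abs_of_pos ht).le
    have b4 : |∑ j ∈ Finset.range K, (n.choose j : ℝ) * (-1) ^ j * (Real.sin t ^ 2 * dl t ^ j - (p j).eval (t ^ 2))| ≤
        (n : ℝ) ^ K * (∑ j ∈ Finset.range K, Cp j) * (t ^ 2) ^ (2 * K + 1) := by
      rw [Finset.mul_sum, Finset.sum_mul]
      refine (Finset.abs_sum_le_sum_abs _ _).trans (Finset.sum_le_sum fun j hj => ?_)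
      rw [abs_mul, abs_mul, abs_pow, abs_neg, abs_one, one_pow, mul_one, Nat.abs_cast, mul_assoc]
      have h2 := hch j (Finset.mem_range.mp hj).le
      have h3 := hp j t htabs
      have := hCp j
      gcongr
    have b5 : |Real.sin t ^ 2 * ((1 - dl t) ^ n - ∑ j ∈ Finset.range K, (n.choose j : ℝ) * (-dl t) ^ j)| ≤
        (n : ℝ) ^ K * Cd ^ K * (t ^ 2) ^ (2 * K + 1) := by
      rw [abs_mul, abs_of_nonneg (sq_nonneg (Real.sin t))]
      calc _ ≤ t ^ 2 * ((n : ℝ) ^ K * (Cd ^ K * (t ^ 2) ^ (2 * K))) := by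
            gcongr
            refine b1.trans ?_
            gcongr
            exact hch K le_rfl
        _ = _ := by ring
    have b6 := gauss_sup (2 * K) n hn t
    rw [← hE] at b6
    have b7 : E * |Real.sin t ^ 2 * ((1 - dl t) ^ n - ∑ j ∈ Finset.range K, (n.choose j : ℝ) * (-dl t) ^ j) +
        ∑ j ∈ Finset.range K, (n.choose j : ℝ) * (-1) ^ j * (Real.sin t ^ 2 * dl t ^ j - (p j).eval (t ^ 2))| ≤
        C1 / (n : ℝ) ^ K * t ^ 2 := by
      calc _ ≤ E * ((n : ℝ) ^ K * Cd ^ K * (t ^ 2) ^ (2 * K + 1) +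
            (n : ℝ) ^ K * (∑ j ∈ Finset.range K, Cp j) * (t ^ 2) ^ (2 * K + 1)) := by
            gcongr
            exact (abs_add_le _ _).trans (add_le_add b5 b4)
        _ = ((t ^ 2) ^ (2 * K) * E) * ((n : ℝ) ^ K * (Cd ^ K + ∑ j ∈ Finset.range K, Cp j) * t ^ 2) := by ring
        _ ≤ (2 ^ (2 * K) * (2 * K).factorial / (n : ℝ) ^ (2 * K)) *
            ((n : ℝ) ^ K * (Cd ^ K + ∑ j ∈ Finset.range K, Cp j) * t ^ 2) := by gcongr
        _ = _ := by
            rw [hC1, two_mul K, pow_add (n : ℝ)]; field_simp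
    refine b7.trans ?_
    have h4 : t ^ 2 ≤ 4 * (t ^ 2 / (1 + t ^ 2) ^ 2) := by
      rw [← mul_div_assoc, le_div_iff₀ (by positivity)]
      have h5 : t ^ 2 ≤ 1 := by nlinarith
      have : (1 + t ^ 2) ^ 2 ≤ 4 := by nlinarith
      nlinarith
    calc _ ≤ C1 / (n : ℝ) ^ K * (4 * (t ^ 2 / (1 + t ^ 2) ^ 2)) := by gcongr
      _ = (4 * C1) / (n : ℝ) ^ K * (t ^ 2 / (1 + t ^ 2) ^ 2) := by ring
      _ ≤ _ := by
        gcongr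
        have : 0 ≤ (1 + D * Cq) * S := by positivity
        linarith
  · have ht1 : 1 ≤ t ^ 2 := by nlinarith
    have b1 : |if t ≤ π / 2 then Real.cos t ^ n * Real.sin t ^ 2 else 0| ≤ E := by
      split_ifs with hpi
      · have hd0 := dl_nonneg t ht.le hpi
        have hd1 := dl_le_one t ht.le hpi
        rw [hcn, ← hE, abs_mul, abs_mul, abs_of_pos hE0, abs_of_nonneg (sq_nonneg (Real.sin t)), abs_of_nonneg (pow_nonneg (by linarith) _)]
        have h2 : (1 - dl t) ^ n ≤ 1 := pow_le_one₀ (by linarith) (by linarith)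
        have h3 := Real.sin_sq_le_one t
        calc _ ≤ 1 * E * 1 := by gcongr
          _ = E := by ring
      · simpa using hE0.le
    have b2 : |∑ k ∈ Finset.range D, a k * (t ^ (2 * k + 2) * E)| ≤ D * (Cq * (n : ℝ) ^ K * ((t ^ 2) ^ D * E)) := by
      refine (Finset.abs_sum_le_sum_abs _ _).trans ?_
      have := Finset.sum_le_card_nsmul (Finset.range D) (fun k => |a k * (t ^ (2 * k + 2) * E)|)
        (Cq * (n : ℝ) ^ K * ((t ^ 2) ^ D * E)) (fun k hk => by
          have hk' := Finset.mem_range.mp hk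
          rw [abs_mul, abs_of_nonneg (by positivity : 0 ≤ t ^ (2 * k + 2) * E)]
          have h3 : t ^ (2 * k + 2) ≤ (t ^ 2) ^ D := by
            rw [show 2 * k + 2 = 2 * (k + 1) by ring, pow_mul]
            exact pow_le_pow_right₀ ht1 hk'
          have h4 := hab k hk'
          gcongr)
      simpa using this
    have b3 : E ≤ (n : ℝ) ^ K * ((t ^ 2) ^ D * E) := by
      have h2 : 1 ≤ (n : ℝ) ^ K := one_le_pow₀ hn1
      have h3 : 1 ≤ (t ^ 2) ^ D := one_le_pow₀ ht1
      nlinarith [mul_le_mul h2 h3 zero_le_one (by positivity)]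
    have b4 : (t ^ 2) ^ D * E ≤ S / (n : ℝ) ^ (2 * K) * (1 / t ^ 2) := by
      have h2 := gauss_sup m n hn t
      rw [← hE, ← hS] at h2
      rw [mul_one_div, le_div_iff₀ ht2]
      calc (t ^ 2) ^ D * E * t ^ 2 = (t ^ 2) ^ (D + 1) * E := by ring
        _ ≤ (t ^ 2) ^ m * E := by
            gcongr
            omega
        _ ≤ _ := h2
        _ ≤ _ := by
            gcongr
            omega
    have h4 : 1 / t ^ 2 ≤ 4 * (t ^ 2 / (1 + t ^ 2) ^ 2) := by
      rw [← mul_div_assoc, div_le_div_iff₀ ht2 (by positivity)]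
      nlinarith
    calc _ ≤ E + D * (Cq * (n : ℝ) ^ K * ((t ^ 2) ^ D * E)) := (abs_sub _ _).trans (add_le_add b1 b2)
      _ ≤ (n : ℝ) ^ K * ((t ^ 2) ^ D * E) + D * (Cq * (n : ℝ) ^ K * ((t ^ 2) ^ D * E)) := by linarith
      _ = ((t ^ 2) ^ D * E) * ((n : ℝ) ^ K * (1 + D * Cq)) := by ring
      _ ≤ (S / (n : ℝ) ^ (2 * K) * (4 * (t ^ 2 / (1 + t ^ 2) ^ 2))) * ((n : ℝ) ^ K * (1 + D * Cq)) := by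
          refine mul_le_mul_of_nonneg_right (b4.trans ?_) (by positivity)
          gcongr
      _ = (4 * ((1 + D * Cq) * S)) / (n : ℝ) ^ K * (t ^ 2 / (1 + t ^ 2) ^ 2) := by
          rw [two_mul K, pow_add]; field_simp
      _ ≤ _ := by
          gcongr
          linarith

end EH

open Real
namespace EH
open SchwartzMap FourierTransform MeasureTheory

noncomputable def GR (k : ℕ) (y : ℝ) : ℝ :=
  2 * ∫ v in Set.Ioi (0 : ℝ), v ^ (2 * k) * Real.exp (-π * v ^ 2) * Real.cos (2 * π * y * v)

theorem integrable_gauss_mom (j : ℕ) {c : ℝ} (hc : 0 < c) :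
    Integrable fun v : ℝ => v ^ j * Real.exp (-c * v ^ 2) := by
  have := integrable_rpow_mul_exp_neg_mul_sq hc (s := (j : ℝ)) (by
    have : (0 : ℝ) ≤ j := by positivity
    linarith)
  simpa using this

theorem FgS_eq (k : ℕ) (y : ℝ) : 𝓕 (gS k) y = (GR k y : ℂ) := by
  have hi : ∀ y : ℝ, Integrable fun v : ℝ => Complex.exp (↑(-2 * π * v * y) * Complex.I) • gS k v := by
    intro y
    have := (gS k).integrable (μ := volume)
    refine (this.norm).mono' ?_ ?_
    · apply Continuous.aestronglyMeasurable
      have := (gS k).continuous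
      fun_prop
    · filter_upwards with v
      rw [norm_smul, Complex.norm_exp_ofReal_mul_I, one_mul]
  have h1 : ∀ y : ℝ, 𝓕 (gS k) y = ∫ v : ℝ, Complex.exp (↑(-2 * π * v * y) * Complex.I) • gS k v := by
    intro y
    rw [SchwartzMap.fourier_coe, Real.fourier_eq']
    congr 1; ext v; congr 3; simp; ring
  have h2 : 𝓕 (gS k) y = (1 / 2 : ℂ) * (𝓕 (gS k) y + 𝓕 (gS k) (-y)) := by
    rw [even_fourier_gS]; ring
  rw [h2, h1, h1, ← integral_add (hi _) (hi _)]
  have h3 : (fun v : ℝ => Complex.exp (↑(-2 * π * v * y) * Complex.I) • gS k v +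
      Complex.exp (↑(-2 * π * v * -y) * Complex.I) • gS k v) =
      fun v : ℝ => ((2 * (|v| ^ (2 * k) * Real.exp (-π * |v| ^ 2) * Real.cos (2 * π * y * |v|)) : ℝ) : ℂ) := by
    ext v
    have e1 : Real.cos (2 * π * y * |v|) = Real.cos (2 * π * y * v) := by
      rcases abs_choice v with h | h <;> rw [h]
      rw [mul_neg, Real.cos_neg]
    rw [e1, sq_abs, pow_mul, sq_abs, ← pow_mul, gS_apply, ← add_smul]
    have e2 : Complex.exp (↑(-2 * π * v * y) * Complex.I) + Complex.exp (↑(-2 * π * v * -y) * Complex.I)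
      = ((2 * Real.cos (2 * π * y * v) : ℝ) : ℂ) := by
      push_cast
      rw [Complex.cos]
      rw [mul_div_cancel₀ _ (by norm_num), add_comm]
      congr 1 <;> congr 1 <;> ring
    rw [e2, smul_eq_mul]
    push_cast; ring
  rw [h3, integral_complex_ofReal]
  rw [integral_comp_abs (f := fun v : ℝ => 2 * (v ^ (2 * k) * Real.exp (-π * v ^ 2) * Real.cos (2 * π * y * v)))]
  rw [integral_const_mul, GR]
  push_cast; ring

theorem GR_decay (k N : ℕ) : ∃ C, 0 < C ∧ ∀ x : ℝ, |x| ^ N * |GR k x| ≤ C := by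
  obtain ⟨C, hC, h⟩ := schwartz_decay (𝓕 (gS k)) N
  refine ⟨C, hC, fun x => ?_⟩
  have := h x
  rwa [FgS_eq, Complex.norm_real, Real.norm_eq_abs] at this

/-- the scale sigma -/
noncomputable def sg (n : ℕ) : ℝ := Real.sqrt (2 * π / n)
noncomputable def ep (n : ℕ) : ℝ := sg n / (2 * π)

theorem sg_pos {n : ℕ} (hn : 1 ≤ n) : 0 < sg n := by
  have : (0 : ℝ) < n := by exact_mod_cast hn
  unfold sg; positivity

theorem sg_sq {n : ℕ} (hn : 1 ≤ n) : sg n ^ 2 = 2 * π / n := by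
  have : (0 : ℝ) < n := by exact_mod_cast hn
  unfold sg; rw [Real.sq_sqrt (by positivity)]

theorem ep_pos {n : ℕ} (hn : 1 ≤ n) : 0 < ep n := by
  have := sg_pos hn
  unfold ep; positivity

theorem ep_sq {n : ℕ} (hn : 1 ≤ n) : ep n ^ 2 = 1 / (2 * π * n) := by
  have : (0 : ℝ) < n := by exact_mod_cast hn
  unfold ep; rw [div_pow, sg_sq hn]; field_simp

theorem gauss_rescale {n : ℕ} (hn : 1 ≤ n) (j : ℕ) (x : ℝ) :
    ∫ t in Set.Ioi (0 : ℝ), t ^ j * Real.exp (-(n * t ^ 2 / 2)) * Real.cos (x * t) =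
    sg n ^ (j + 1) * ∫ v in Set.Ioi (0 : ℝ), v ^ j * Real.exp (-π * v ^ 2) * Real.cos (2 * π * (x * ep n) * v) := by
  have hs := sg_pos hn
  have hn' : (0 : ℝ) < n := by exact_mod_cast hn
  have h := integral_comp_mul_left_Ioi (fun t : ℝ => t ^ j * Real.exp (-(n * t ^ 2 / 2)) * Real.cos (x * t)) 0 hs
  rw [mul_zero, smul_eq_mul] at h
  have h2 : ∫ t in Set.Ioi (0 : ℝ), t ^ j * Real.exp (-(n * t ^ 2 / 2)) * Real.cos (x * t) =
    sg n * ((sg n)⁻¹ * ∫ t in Set.Ioi (0 : ℝ), t ^ j * Real.exp (-(n * t ^ 2 / 2)) * Real.cos (x * t)) := by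
    rw [← mul_assoc, mul_inv_cancel₀ hs.ne', one_mul]
  rw [h2, ← h, pow_succ', mul_assoc]
  congr 1
  rw [← integral_const_mul]
  apply integral_congr_ae
  filter_upwards with v
  rw [mul_pow, mul_pow, sg_sq hn, ep]
  have e1 : -(n * (2 * π / n * v ^ 2) / 2) = -π * v ^ 2 := by field_simp
  have e2 : x * (sg n * v) = 2 * π * (x * (sg n / (2 * π))) * v := by field_simp
  rw [e1, e2]; ring

theorem gauss_rescale0 {n : ℕ} (hn : 1 ≤ n) (j : ℕ) :
    ∫ t in Set.Ioi (0 : ℝ), t ^ j * Real.exp (-(n * t ^ 2 / 2)) =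
    sg n ^ (j + 1) * ∫ v in Set.Ioi (0 : ℝ), v ^ j * Real.exp (-π * v ^ 2) := by
  simpa using gauss_rescale hn j 0

theorem integrable_rat : IntegrableOn (fun t : ℝ => 1 / (1 + t ^ 2)) (Set.Ioi 0) := by
  have := integrable_inv_one_add_sq
  simpa using this.integrableOn

noncomputable def cut (n : ℕ) (t : ℝ) : ℝ := if t ≤ π / 2 then Real.cos t ^ n * Real.sin t ^ 2 else 0

theorem cut_integral (n : ℕ) (f : ℝ → ℝ) : ∫ t in Set.Ioi (0 : ℝ), cut n t * f t =
    ∫ t in (0 : ℝ)..(π / 2), Real.cos t ^ n * Real.sin t ^ 2 * f t := by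
  rw [intervalIntegral.integral_of_le (by positivity)]
  have : (fun t => cut n t * f t) = Set.indicator (Set.Iic (π / 2)) (fun t => Real.cos t ^ n * Real.sin t ^ 2 * f t) := by
    ext t
    unfold cut Set.indicator
    simp only [Set.mem_Iic]
    split_ifs <;> simp
  rw [this, setIntegral_indicator measurableSet_Iic, Set.Ioi_inter_Iic]

theorem cut_measurable (n : ℕ) : Measurable (cut n) := by
  unfold cut
  exact Measurable.ite measurableSet_Iic (by fun_prop) measurable_const

/-- generic transfer: multiply the gauss approximation by a weight and integrate -/
theorem transfer {n D K : ℕ} (hn : 1 ≤ n) {C B : ℝ} (hC : 0 < C) (a : ℕ → ℝ)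
    (h : ∀ t > (0 : ℝ), |(if t ≤ π / 2 then Real.cos t ^ n * Real.sin t ^ 2 else 0) -
      ∑ k ∈ Finset.range D, a k * (t ^ (2 * k + 2) * Real.exp (-(n * t ^ 2 / 2)))| ≤
      C / (n : ℝ) ^ K * (t ^ 2 / (1 + t ^ 2) ^ 2))
    (f : ℝ → ℝ) (hf : Measurable f) (hB : ∀ t > (0 : ℝ), |f t| * (t ^ 2 / (1 + t ^ 2) ^ 2) ≤ B * (1 / (1 + t ^ 2)))
    (hg : ∀ k, IntegrableOn (fun t => t ^ (2 * k + 2) * Real.exp (-(n * t ^ 2 / 2)) * f t) (Set.Ioi 0)) :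
    |(∫ t in (0 : ℝ)..(π / 2), Real.cos t ^ n * Real.sin t ^ 2 * f t) -
      ∑ k ∈ Finset.range D, a k * ∫ t in Set.Ioi (0 : ℝ), t ^ (2 * k + 2) * Real.exp (-(n * t ^ 2 / 2)) * f t|
      ≤ C / (n : ℝ) ^ K * B * (π / 2) := by
  have hn' : (0 : ℝ) < n := by exact_mod_cast hn
  set S : ℝ → ℝ := fun t => ∑ k ∈ Finset.range D, a k * (t ^ (2 * k + 2) * Real.exp (-(n * t ^ 2 / 2)) * f t) with hS
  have hSi : IntegrableOn S (Set.Ioi 0) := by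
    apply integrable_finsetSum
    intro k _
    exact (hg k).const_mul _
  have hSint : ∫ t in Set.Ioi (0 : ℝ), S t = ∑ k ∈ Finset.range D, a k * ∫ t in Set.Ioi (0 : ℝ), t ^ (2 * k + 2) * Real.exp (-(n * t ^ 2 / 2)) * f t := by
    rw [hS, integral_finsetSum _ (fun k _ => (hg k).const_mul _)]
    simp_rw [integral_const_mul]
  have hb : ∀ t > (0 : ℝ), ‖cut n t * f t - S t‖ ≤ C / (n : ℝ) ^ K * B * (1 / (1 + t ^ 2)) := by
    intro t ht
    have e : cut n t * f t - S t = (cut n t - ∑ k ∈ Finset.range D, a k * (t ^ (2 * k + 2) * Real.exp (-(n * t ^ 2 / 2)))) * f t := by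
      rw [hS, sub_mul, Finset.sum_mul]
      congr 1; apply Finset.sum_congr rfl; intro k _; ring
    rw [e, Real.norm_eq_abs, abs_mul]
    calc _ ≤ C / (n : ℝ) ^ K * (t ^ 2 / (1 + t ^ 2) ^ 2) * |f t| := by gcongr; exact h t ht
      _ = C / (n : ℝ) ^ K * (|f t| * (t ^ 2 / (1 + t ^ 2) ^ 2)) := by ring
      _ ≤ C / (n : ℝ) ^ K * (B * (1 / (1 + t ^ 2))) := mul_le_mul_of_nonneg_left (hB t ht) (by positivity)
      _ = _ := by ring
  have hdi : IntegrableOn (fun t => cut n t * f t - S t) (Set.Ioi 0) := by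
    refine (integrable_rat.const_mul (C / (n : ℝ) ^ K * B)).mono' ?_ ?_
    · refine (((cut_measurable n).mul hf).aestronglyMeasurable).sub hSi.aestronglyMeasurable
    · exact (ae_restrict_iff' measurableSet_Ioi).mpr (Filter.Eventually.of_forall fun t ht => hb t ht)
  have hci : IntegrableOn (fun t => cut n t * f t) (Set.Ioi 0) := by
    have := hdi.add hSi
    refine this.congr_fun (fun t _ => ?_) measurableSet_Ioi
    simp
  rw [← cut_integral, ← hSint, ← integral_sub hci hSi, ← Real.norm_eq_abs]
  have := norm_integral_le_of_norm_le (integrable_rat.const_mul (C / (n : ℝ) ^ K * B))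
    ((ae_restrict_iff' measurableSet_Ioi).mpr (Filter.Eventually.of_forall fun t ht => hb t ht))
  refine this.trans_eq ?_
  rw [integral_const_mul]
  congr 1
  simp

end EH

open Real
namespace EH
open SchwartzMap FourierTransform MeasureTheory

noncomputable def cc (n : ℕ) (a : ℕ → ℝ) (k : ℕ) : ℝ := -(4 / π) * a k * sg n ^ (2 * k + 3)

theorem sg_le {n : ℕ} (hn : 1 ≤ n) : sg n ≤ 2 * π := by
  have h := sg_sq hn
  have hn' : (1 : ℝ) ≤ n := by exact_mod_cast hn
  have h2 : 2 * π / n ≤ 2 * π := by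
    apply div_le_self (by positivity) hn'
  have := Real.pi_gt_three
  by_contra hc
  push Not at hc
  nlinarith

theorem cc_bound {n D J : ℕ} (hn : 1 ≤ n) {C : ℝ} (a : ℕ → ℝ) (ha : ∀ k < D, |a k| ≤ C * (n : ℝ) ^ J) (hC : 0 < C) :
    ∀ k < D, |cc n a k| ≤ 2 * C * (2 * π) ^ (2 * D + 3) * (n : ℝ) ^ J := by
  intro k hk
  have hs := sg_pos hn
  have hs2 := sg_le hn
  have hpi := Real.pi_gt_three
  rw [cc, abs_mul, abs_mul, abs_neg, abs_of_pos (by positivity : 0 < 4 / π), abs_of_pos (pow_pos hs _)]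
  have h1 : sg n ^ (2 * k + 3) ≤ (2 * π) ^ (2 * D + 3) := by
    calc _ ≤ (2 * π) ^ (2 * k + 3) := by gcongr
      _ ≤ _ := by
        apply pow_le_pow_right₀ (by linarith) (by omega)
  have h2 : 4 / π ≤ 2 := by rw [div_le_iff₀ (by positivity)]; linarith
  calc _ ≤ 2 * (C * (n : ℝ) ^ J) * (2 * π) ^ (2 * D + 3) := by
        gcongr
        exact ha k hk
    _ = _ := by ring

theorem approx_near {n D K : ℕ} (hn : 1 ≤ n) {C : ℝ} (hC : 0 < C) (a : ℕ → ℝ)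
    (h : ∀ t > (0 : ℝ), |(if t ≤ π / 2 then Real.cos t ^ n * Real.sin t ^ 2 else 0) -
      ∑ k ∈ Finset.range D, a k * (t ^ (2 * k + 2) * Real.exp (-(n * t ^ 2 / 2)))| ≤
      C / (n : ℝ) ^ K * (t ^ 2 / (1 + t ^ 2) ^ 2)) (x : ℤ) (hx : (x - n) % 2 = 0) :
    |g n x / 2 ^ n - ∑ k ∈ Finset.range D, cc n a k * GR (k + 1) (x * ep n)| ≤ 4 * C / (n : ℝ) ^ K := by
  have hn' : (0 : ℝ) < n := by exact_mod_cast hn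
  have ht := transfer (B := 1) hn hC a h (fun t => Real.cos (x * t)) (by fun_prop) (by
    intro t ht
    rw [one_mul]
    calc _ ≤ 1 * (t ^ 2 / (1 + t ^ 2) ^ 2) := by
          gcongr
          exact Real.abs_cos_le_one _
      _ ≤ _ := by
        rw [one_mul, div_le_div_iff₀ (by positivity) (by positivity)]
        nlinarith [sq_nonneg t]) (by
    intro k
    have h1 := (integrable_gauss_mom (2 * k + 2) (c := n / 2) (by positivity)).integrableOn (s := Set.Ioi 0)
    refine (h1.norm).mono' (by apply Continuous.aestronglyMeasurable; fun_prop) ?_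
    filter_upwards with t
    rw [norm_mul]
    have e : -(n * t ^ 2 / 2) = -((n : ℝ) / 2) * t ^ 2 := by ring
    rw [e]
    refine mul_le_of_le_one_right (norm_nonneg _) ?_
    exact Real.abs_cos_le_one _)
  rw [g_integral n x hx]
  have e : -(8 * 2 ^ n / π) * (∫ t in (0 : ℝ)..(π / 2), Real.cos t ^ n * Real.sin t ^ 2 * Real.cos (x * t)) / 2 ^ n -
      ∑ k ∈ Finset.range D, cc n a k * GR (k + 1) (x * ep n) = -(8 / π) * ((∫ t in (0 : ℝ)..(π / 2), Real.cos t ^ n * Real.sin t ^ 2 * Real.cos (x * t)) -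
      ∑ k ∈ Finset.range D, a k * ∫ t in Set.Ioi (0 : ℝ), t ^ (2 * k + 2) * Real.exp (-(n * t ^ 2 / 2)) * Real.cos (x * t)) := by
    rw [mul_sub, Finset.mul_sum]
    congr 1
    · field_simp
    · apply Finset.sum_congr rfl
      intro k _
      rw [gauss_rescale hn, cc, GR, mul_add 2 k 1]
      ring
  rw [e, abs_mul, abs_neg, abs_of_pos (by positivity)]
  calc _ ≤ 8 / π * (C / (n : ℝ) ^ K * 1 * (π / 2)) := by gcongr
    _ = _ := by field_simp; ring

theorem approx_g (K : ℕ) : ∃ D J : ℕ, ∃ C : ℝ, 0 < C ∧ ∀ n : ℕ, 1 ≤ n → ∃ a : ℕ → ℝ,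
    (∀ k < D, |cc n a k| ≤ C * (n : ℝ) ^ J) ∧
    (∀ t > (0 : ℝ), |(if t ≤ π / 2 then Real.cos t ^ n * Real.sin t ^ 2 else 0) -
      ∑ k ∈ Finset.range D, a k * (t ^ (2 * k + 2) * Real.exp (-(n * t ^ 2 / 2)))| ≤
      C / (n : ℝ) ^ K * (t ^ 2 / (1 + t ^ 2) ^ 2)) ∧
    ∀ x : ℤ, x ≠ 0 → (x - n) % 2 = 0 →
      |g n x / 2 ^ n - ∑ k ∈ Finset.range D, cc n a k * GR (k + 1) (x * ep n)| ≤ C / (n : ℝ) ^ K * (1 / (x : ℝ) ^ 4) := by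
  obtain ⟨D, J, C, hC, H⟩ := gauss_approx (K + 4)
  set M := J + K + 2 with hM
  choose Cg hCg hG using fun k => GR_decay (k + 1) (2 * M + 4)
  set C2 := 2 * C * (2 * π) ^ (2 * D + 3) with hC2
  have hC2p : 0 < C2 := by positivity
  set CG := ∑ k ∈ Finset.range D, Cg k with hCG
  have hCGp : 0 ≤ CG := Finset.sum_nonneg fun k _ => (hCg k).le
  refine ⟨D, J, C + C2 + 324 * C + C2 * CG * (2 * π) ^ (M + 2), by positivity, fun n hn => ?_⟩
  obtain ⟨a, ha, hb⟩ := H n hn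
  have hn' : (1 : ℝ) ≤ n := by exact_mod_cast hn
  have hcc := cc_bound hn a ha hC
  have hp1 : 0 ≤ C2 * CG * (2 * π) ^ (M + 2) := by positivity
  refine ⟨a, fun k hk => (hcc k hk).trans ?_, fun t ht => (hb t ht).trans ?_, fun x hx hpar => ?_⟩
  · gcongr; rw [← hC2]; linarith
  · have h1 : (n : ℝ) ^ K ≤ (n : ℝ) ^ (K + 4) := pow_le_pow_right₀ hn' (by omega)
    gcongr
    linarith
  have hx1 : (1 : ℝ) ≤ |(x : ℝ)| := by
    rw [← Int.cast_abs]; exact_mod_cast Int.one_le_abs hx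
  have hx4 : (x : ℝ) ^ 4 = |(x : ℝ)| ^ 4 := by rw [show (4 : ℕ) = 2 * 2 by rfl, pow_mul, pow_mul, sq_abs]
  by_cases hle : |x| ≤ (n : ℤ) + 2
  · refine (approx_near hn hC a hb x hpar).trans ?_
    have h3 : |(x : ℝ)| ≤ 3 * n := by
      have : (|x| : ℤ) ≤ (3 * n : ℤ) := by omega
      rw [← Int.cast_abs]; exact_mod_cast this
    have h4 : |(x : ℝ)| ^ 4 ≤ 81 * (n : ℝ) ^ 4 := by
      calc _ ≤ (3 * (n : ℝ)) ^ 4 := by gcongr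
        _ = _ := by ring
    rw [hx4]
    calc 4 * C / (n : ℝ) ^ (K + 4) = 324 * C / (n : ℝ) ^ K * (1 / (81 * (n : ℝ) ^ 4)) := by
          rw [pow_add]; field_simp; norm_num
      _ ≤ 324 * C / (n : ℝ) ^ K * (1 / |(x : ℝ)| ^ 4) := by gcongr
      _ ≤ _ := by gcongr; linarith
  · push Not at hle
    rw [g_support n x hle, zero_div, zero_sub, abs_neg]
    have hxn : (n : ℝ) ≤ |(x : ℝ)| := by
      have : (n : ℤ) ≤ |x| := by omega
      rw [← Int.cast_abs]; exact_mod_cast this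
    have hyy : (n : ℝ) ^ M / (2 * π) ^ M * (|(x : ℝ)| ^ 4 / ((2 * π) ^ 2 * (n : ℝ) ^ 2)) ≤ |(x : ℝ) * ep n| ^ (2 * M + 4) := by
      have e1 : |(x : ℝ) * ep n| ^ 2 = |(x : ℝ)| ^ 2 * (1 / (2 * π * n)) := by
        rw [abs_mul, mul_pow, sq_abs (ep n), ep_sq hn]
      have e2 : |(x : ℝ) * ep n| ^ (2 * M + 4) = (|(x : ℝ) * ep n| ^ 2) ^ M * (|(x : ℝ) * ep n| ^ 2) ^ 2 := by
        rw [pow_add, pow_mul, ← pow_mul _ 2 2]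
      rw [e2, e1]
      have e3 : (|(x : ℝ)| ^ 2 * (1 / (2 * π * n))) ^ 2 = |(x : ℝ)| ^ 4 / ((2 * π) ^ 2 * (n : ℝ) ^ 2) := by
        field_simp
      rw [e3, ← div_pow]
      gcongr
      calc (n : ℝ) / (2 * π) = (n : ℝ) ^ 2 * (1 / (2 * π * n)) := by field_simp
        _ ≤ _ := by gcongr
    have hterm : ∀ k ∈ Finset.range D, |cc n a k * GR (k + 1) (x * ep n)| ≤
        C2 * (2 * π) ^ (M + 2) / (n : ℝ) ^ K * (1 / (x : ℝ) ^ 4) * Cg k := by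
      intro k hk
      have h1 := hcc k (Finset.mem_range.mp hk)
      have h2 := hG k (x * ep n)
      set P := (n : ℝ) ^ M / (2 * π) ^ M * (|(x : ℝ)| ^ 4 / ((2 * π) ^ 2 * (n : ℝ) ^ 2)) with hP
      have hPp : 0 < P := by positivity
      have h3 : |GR (k + 1) (x * ep n)| ≤ Cg k / P := by
        rw [le_div_iff₀ hPp]
        calc _ ≤ |GR (k + 1) (x * ep n)| * |(x : ℝ) * ep n| ^ (2 * M + 4) := by gcongr
          _ ≤ _ := by rw [mul_comm]; exact h2
      rw [abs_mul]
      calc _ ≤ C2 * (n : ℝ) ^ J * (Cg k / P) := by gcongr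
        _ = _ := by
          rw [hP, hx4, hM, pow_add (n : ℝ), pow_add (n : ℝ), pow_add (2 * π) _ 2]
          field_simp
          ring
    refine (Finset.abs_sum_le_sum_abs _ _).trans ((Finset.sum_le_sum hterm).trans ?_)
    rw [← Finset.mul_sum, ← hCG]
    calc _ = (C2 * CG * (2 * π) ^ (M + 2)) / (n : ℝ) ^ K * (1 / (x : ℝ) ^ 4) := by ring
      _ ≤ _ := by
        have : 0 ≤ (x : ℝ) ^ 4 := by rw [hx4]; positivity
        gcongr
        linarith

end EH

open Real
namespace EH
open SchwartzMap FourierTransform MeasureTheory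

noncomputable def PhiR (k : ℕ) (y : ℝ) : ℝ := ∑' m : ℤ, GR (k + 1) ((2 * m + 1) * y)
noncomputable def PsiR (k j : ℕ) (y : ℝ) : ℝ := if 0 < y then y ^ j * PhiR k y else 0
noncomputable def Mom (j k : ℕ) : ℝ := ∫ v in Set.Ioi (0 : ℝ), v ^ (2 * k + 1 - j) * Real.exp (-π * v ^ 2)
noncomputable def kap (j : ℕ) : ℝ := if j = 0 then 1 / 8 else 1 / 32

theorem PhiR_summable (k : ℕ) {y : ℝ} (hy : 0 < y) : Summable fun m : ℤ => GR (k + 1) ((2 * m + 1) * y) := by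
  have := Phi_summable (𝓕 (gS (k + 1))) hy
  simp_rw [FgS_eq] at this
  exact Complex.summable_ofReal.mp this

theorem Phi_eq (k : ℕ) (y : ℝ) : Phi (𝓕 (gS (k + 1))) y = (PhiR k y : ℂ) := by
  unfold Phi PhiR
  simp_rw [FgS_eq]
  rw [Complex.ofReal_tsum]

theorem Psi_eq (k j : ℕ) (y : ℝ) : Psi (𝓕 (gS (k + 1))) j y = (PsiR k j y : ℂ) := by
  unfold Psi PsiR
  rw [Phi_eq]
  split_ifs <;> simp

theorem sumR (j k N : ℕ) (hj : j ≤ 1) : ∃ C, 0 < C ∧ ∀ ε > (0 : ℝ), ∀ p : ℤ,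
    Summable (fun s : ℤ => PsiR k j (ε * (2 * s + p))) ∧
    |1 / 2 * ∑' s : ℤ, PsiR k j (ε * (2 * s + p)) - -(kap j / ε * Mom j k)| ≤ C * ε ^ (N + 1) := by
  have hs : ∀ ε > (0 : ℝ), ∀ p : ℤ, Summable (fun s : ℤ => PsiR k j (ε * (2 * s + p))) := by
    intro ε hε p
    have := Psi_summable _ (fourier_FgS_zero k) j hε p
    simp_rw [Psi_eq] at this
    exact Complex.summable_ofReal.mp this
  have key : ∃ C, 0 < C ∧ ∀ ε > (0 : ℝ), ∀ p : ℤ,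
      ‖(1 / 2 : ℂ) * ∑' s : ℤ, Psi (𝓕 (gS (k + 1))) j (ε * (2 * s + p)) - ((-(kap j / ε * Mom j k) : ℝ) : ℂ)‖ ≤ C * ε ^ (N + 1) := by
    interval_cases j
    · obtain ⟨C, hC, h⟩ := sum_B k N
      refine ⟨C, hC, fun ε hε p => ?_⟩
      have := h ε hε p
      have e2 : -(kap 0 / ε * Mom 0 k) = -(1 / (8 * ε)) * ∫ v in Set.Ioi (0 : ℝ), v ^ (2 * k + 1) * Real.exp (-π * v ^ 2) := by
        simp only [kap, Mom, if_true, Nat.sub_zero]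
        field_simp
      rw [e2]
      exact_mod_cast this
    · obtain ⟨C, hC, h⟩ := sum_A k N
      refine ⟨C, hC, fun ε hε p => ?_⟩
      have := h ε hε p
      have e : ∫ v : ℝ, v ^ (2 * k) * Real.exp (-π * v ^ 2) = 2 * Mom 1 k := by
        rw [Mom, ← integral_comp_abs (f := fun v : ℝ => v ^ (2 * k + 1 - 1) * Real.exp (-π * v ^ 2))]
        congr 1; ext v
        rw [Nat.add_sub_cancel, sq_abs, pow_mul, pow_mul, sq_abs]
      rw [e] at this
      have e2 : -(kap 1 / ε * Mom 1 k) = -(1 / (64 * ε)) * (2 * Mom 1 k) := by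
        rw [kap, if_neg one_ne_zero]
        field_simp
        ring
      rw [e2]
      exact_mod_cast this
  obtain ⟨C, hC, h⟩ := key
  refine ⟨C, hC, fun ε hε p => ⟨hs ε hε p, ?_⟩⟩
  have := h ε hε p
  simp_rw [Psi_eq] at this
  rw [← Complex.ofReal_tsum] at this
  rw [← Real.norm_eq_abs, ← Complex.norm_real]
  convert this using 2
  push_cast; ring

noncomputable def V (n : ℕ) (t : ℤ) : ℝ := 1 / 2 * ∑' m : ℤ, g n ((2 * m + 1) * t) / 2 ^ n
noncomputable def T (n j : ℕ) (t : ℤ) : ℝ := if 0 < t then (t : ℝ) ^ j * V n t else 0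

theorem V_par (n : ℕ) (t : ℤ) (h : (t - n) % 2 ≠ 0) : V n t = 0 := by
  unfold V
  have : ∀ m : ℤ, g n ((2 * m + 1) * t) / 2 ^ n = 0 := by
    intro m
    rw [g_parity, zero_div]
    have : (2 * m + 1) * t - n = 2 * (m * t) + (t - n) := by ring
    rw [this]; omega
  simp [this]

theorem sum_T (n j : ℕ) : ∑' h : ℕ, ((h : ℝ) + 2) ^ j * (W n h / 2 ^ n) = ∑' s : ℤ, T n j (2 * s + n) := by
  have h1 : ∑' h : ℕ, T n j ((h : ℤ) + 2) = ∑' t : ℤ, T n j t := by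
    apply Function.Injective.tsum_eq (g := fun h : ℕ => (h : ℤ) + 2) (f := T n j)
    · intro x y h; simpa using h
    · intro t ht
      by_contra hc
      apply ht
      unfold T
      split_ifs with h0
      · have : t = 1 := by
          by_contra h1
          apply hc
          refine ⟨(t - 2).toNat, ?_⟩
          simp only
          rw [Int.toNat_of_nonneg (by omega)]; ring
        subst this
        have := g_sum_one n
        unfold V
        rw [tsum_div_const]
        have h2 : ∑' m : ℤ, g n ((2 * m + 1) * 1) = 0 := by linarith
        rw [h2]; simp
      · rfl
  have h2 : ∑' s : ℤ, T n j (2 * s + n) = ∑' t : ℤ, T n j t := by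
    apply Function.Injective.tsum_eq (g := fun s : ℤ => 2 * s + n) (f := T n j)
    · intro x y h; simpa using h
    · intro t ht
      by_contra hc
      apply ht
      unfold T
      rw [V_par]
      · simp
      · intro h
        apply hc
        refine ⟨(t - n) / 2, ?_⟩
        simp only
        omega
  rw [h2, ← h1]
  apply tsum_congr
  intro h
  have : (0 : ℤ) < (h : ℤ) + 2 := by positivity
  rw [T, if_pos this, V, tsum_div_const, W_formula]
  push_cast
  ring

theorem V_approx {n D K : ℕ} (hn : 1 ≤ n) {C : ℝ} (a : ℕ → ℝ)
    (h : ∀ x : ℤ, x ≠ 0 → (x - n) % 2 = 0 →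
      |g n x / 2 ^ n - ∑ k ∈ Finset.range D, cc n a k * GR (k + 1) (x * ep n)| ≤ C / (n : ℝ) ^ K * (1 / (x : ℝ) ^ 4))
    (hC : 0 < C) (t : ℤ) (ht : 0 < t) (hp : (t - n) % 2 = 0) :
    |V n t - 1 / 2 * ∑ k ∈ Finset.range D, cc n a k * PhiR k (ep n * t)| ≤
      (C * ∑' m : ℤ, 1 / |(2 * m + 1 : ℝ)| ^ 2) / (n : ℝ) ^ K * (1 / (t : ℝ) ^ 4) := by
  have hn' : (0 : ℝ) < n := by exact_mod_cast hn
  have ht' : (0 : ℝ) < t := by exact_mod_cast ht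
  have hy : 0 < ep n * t := mul_pos (ep_pos hn) ht'
  have hS : Summable fun m : ℤ => ∑ k ∈ Finset.range D, cc n a k * GR (k + 1) ((2 * m + 1) * (ep n * t)) :=
    summable_sum fun k _ => (PhiR_summable k hy).mul_left _
  have hg : Summable fun m : ℤ => g n ((2 * m + 1) * t) / 2 ^ n := (g_summable n t ht.ne').div_const _
  have e : ∑ k ∈ Finset.range D, cc n a k * PhiR k (ep n * t) = ∑' m : ℤ, ∑ k ∈ Finset.range D, cc n a k * GR (k + 1) ((2 * m + 1) * (ep n * t)) := by
    rw [Summable.tsum_finsetSum (fun k _ => (PhiR_summable k hy).mul_left _)]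
    apply Finset.sum_congr rfl
    intro k _
    rw [tsum_mul_left, PhiR]
  rw [V, e, ← mul_sub, ← hg.tsum_sub hS, abs_mul, abs_of_pos (by norm_num : (0 : ℝ) < 1 / 2)]
  have hb := tsum_of_norm_bounded (f := fun m : ℤ => g n ((2 * m + 1) * t) / 2 ^ n - ∑ k ∈ Finset.range D, cc n a k * GR (k + 1) ((2 * m + 1) * (ep n * t))) ((summable_odd_inv_sq.mul_left (C / (n : ℝ) ^ K * (1 / (t : ℝ) ^ 4))).hasSum) (by
    intro m
    have hm : (2 * m + 1) * t ≠ 0 := mul_ne_zero (by omega) ht.ne'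
    have := h ((2 * m + 1) * t) hm (by
      have : (2 * m + 1) * t - n = 2 * (m * t) + (t - n) := by ring
      rw [this]; omega)
    push_cast at this
    rw [Real.norm_eq_abs]
    simp_rw [show ∀ m : ℤ, (2 * (m : ℝ) + 1) * (ep n * t) = (2 * m + 1) * t * ep n from fun m => by ring]
    refine this.trans ?_
    have h1 := int_odd_ne m
    have h4 : (1 : ℝ) / ((2 * m + 1) * t) ^ 4 = 1 / (t : ℝ) ^ 4 * (1 / |(2 * m + 1 : ℝ)| ^ 4) := by
      rw [show |(2 * m + 1 : ℝ)| ^ 4 = (2 * m + 1 : ℝ) ^ 4 by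
        rw [show (4 : ℕ) = 2 * 2 by rfl, pow_mul, pow_mul, sq_abs], mul_pow]
      rw [one_div_mul_one_div, mul_comm]
    rw [h4, ← mul_assoc]
    have : |(2 * m + 1 : ℝ)| ^ 2 ≤ |(2 * m + 1 : ℝ)| ^ 4 := pow_le_pow_right₀ h1 (by norm_num)
    gcongr)
  rw [tsum_mul_left, Real.norm_eq_abs] at hb
  have hp : 0 ≤ ∑' m : ℤ, 1 / |(2 * m + 1 : ℝ)| ^ 2 := tsum_nonneg fun m => by positivity
  have hq : 0 ≤ (C * ∑' m : ℤ, 1 / |(2 * m + 1 : ℝ)| ^ 2) / (n : ℝ) ^ K * (1 / (t : ℝ) ^ 4) := by positivity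
  calc _ ≤ 1 / 2 * (C / (n : ℝ) ^ K * (1 / (t : ℝ) ^ 4) * ∑' m : ℤ, 1 / |(2 * m + 1 : ℝ)| ^ 2) := by gcongr
    _ = 1 / 2 * ((C * ∑' m : ℤ, 1 / |(2 * m + 1 : ℝ)| ^ 2) / (n : ℝ) ^ K * (1 / (t : ℝ) ^ 4)) := by ring
    _ ≤ _ := by linarith

end EH

open Real
namespace EH
open SchwartzMap FourierTransform MeasureTheory

noncomputable def qq (j : ℕ) : ℝ := if j = 0 then 1 else π / 2

theorem sum_bound {n D K : ℕ} (j : ℕ) (hj : j ≤ 1) (hn : 1 ≤ n) {C : ℝ} (a : ℕ → ℝ)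
    (h : ∀ x : ℤ, x ≠ 0 → (x - n) % 2 = 0 →
      |g n x / 2 ^ n - ∑ k ∈ Finset.range D, cc n a k * GR (k + 1) (x * ep n)| ≤ C / (n : ℝ) ^ K * (1 / (x : ℝ) ^ 4))
    (hC : 0 < C) (hs : ∀ k, Summable (fun s : ℤ => PsiR k j (ep n * (2 * s + n)))) :
    |∑' s : ℤ, T n j (2 * s + n) - ∑ k ∈ Finset.range D, cc n a k / ep n ^ j * (1 / 2 * ∑' s : ℤ, PsiR k j (ep n * (2 * s + n)))|
      ≤ (C * ∑' m : ℤ, 1 / |(2 * m + 1 : ℝ)| ^ 2) * (∑' m : ℤ, 1 / |(m : ℝ)| ^ 2) / (n : ℝ) ^ K := by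
  have hn' : (0 : ℝ) < n := by exact_mod_cast hn
  have he := ep_pos hn
  set Q := C * ∑' m : ℤ, 1 / |(2 * m + 1 : ℝ)| ^ 2 with hQ
  have hQp : 0 ≤ Q := mul_nonneg hC.le (tsum_nonneg fun m => by positivity)
  set S : ℤ → ℝ := fun s => ∑ k ∈ Finset.range D, cc n a k / ep n ^ j * (1 / 2 * PsiR k j (ep n * (2 * s + n))) with hS
  have hSs : Summable S := summable_sum fun k _ => ((hs k).mul_left _).mul_left _
  have hSt : ∑ k ∈ Finset.range D, cc n a k / ep n ^ j * (1 / 2 * ∑' s : ℤ, PsiR k j (ep n * (2 * s + n))) = ∑' s, S s := by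
    rw [hS, Summable.tsum_finsetSum (fun k _ => ((hs k).mul_left _).mul_left _)]
    apply Finset.sum_congr rfl
    intro k _
    rw [tsum_mul_left, tsum_mul_left]
  have hinj : Function.Injective (fun s : ℤ => 2 * s + (n : ℤ)) := by intro x y h; simpa using h
  have hsum1 := summable_int_inv_sq.comp_injective hinj
  have hb : ∀ s : ℤ, ‖T n j (2 * s + n) - S s‖ ≤ Q / (n : ℝ) ^ K * (1 / |((2 * s + n : ℤ) : ℝ)| ^ 2) := by
    intro s
    by_cases h0 : (0 : ℤ) < 2 * s + n
    · have h0' : (0 : ℝ) < ((2 * s + n : ℤ) : ℝ) := by exact_mod_cast h0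
      have h1' : (1 : ℝ) ≤ ((2 * s + n : ℤ) : ℝ) := by exact_mod_cast h0
      have hv := V_approx hn a h hC (2 * s + n) h0 (by omega)
      have e : T n j (2 * s + n) - S s = ((2 * s + n : ℤ) : ℝ) ^ j * (V n (2 * s + n) - 1 / 2 * ∑ k ∈ Finset.range D, cc n a k * PhiR k (ep n * ((2 * s + n : ℤ) : ℝ))) := by
        rw [T, if_pos h0, mul_sub, hS, Finset.mul_sum, Finset.mul_sum]
        congr 1
        apply Finset.sum_congr rfl
        intro k _
        have e2 : (2 * (s : ℝ) + n) = ((2 * s + n : ℤ) : ℝ) := by push_cast; ring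
        rw [e2, PsiR, if_pos (mul_pos he h0'), mul_pow]
        field_simp
      rw [e, Real.norm_eq_abs, abs_mul, abs_of_pos (pow_pos h0' _), abs_of_pos h0']
      calc _ ≤ ((2 * s + n : ℤ) : ℝ) * (Q / (n : ℝ) ^ K * (1 / ((2 * s + n : ℤ) : ℝ) ^ 4)) := by
            apply mul_le_mul _ hv (abs_nonneg _) h0'.le
            calc _ ≤ ((2 * s + n : ℤ) : ℝ) ^ 1 := pow_le_pow_right₀ h1' hj
              _ = _ := pow_one _
        _ = Q / (n : ℝ) ^ K * (1 / ((2 * s + n : ℤ) : ℝ) ^ 3) := by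
            field_simp
        _ ≤ _ := by
            have : ((2 * s + n : ℤ) : ℝ) ^ 2 ≤ ((2 * s + n : ℤ) : ℝ) ^ 3 := pow_le_pow_right₀ h1' (by norm_num)
            gcongr
    · have e : T n j (2 * s + n) - S s = 0 := by
        rw [T, if_neg h0, hS]
        have : ∀ k, PsiR k j (ep n * (2 * s + n)) = 0 := by
          intro k
          rw [PsiR, if_neg]
          rw [not_lt]
          apply mul_nonpos_of_nonneg_of_nonpos he.le
          have : ((2 * s + n : ℤ) : ℝ) ≤ 0 := by exact_mod_cast not_lt.mp h0
          push_cast at this; exact this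
        simp [this]
      rw [e, norm_zero]; positivity
  have hds : Summable fun s : ℤ => T n j (2 * s + n) - S s :=
    Summable.of_norm_bounded (hsum1.mul_left _) hb
  have hT : Summable fun s : ℤ => T n j (2 * s + n) := by
    have := hds.add hSs
    simpa using this
  rw [hSt, ← hT.tsum_sub hSs, ← Real.norm_eq_abs]
  refine (tsum_of_norm_bounded (hsum1.mul_left _).hasSum hb).trans ?_
  rw [tsum_mul_left]
  have h5 : ∑' s : ℤ, ((fun k : ℤ => 1 / |(k : ℝ)| ^ 2) ∘ fun s : ℤ => 2 * s + (n : ℤ)) s ≤ ∑' m : ℤ, 1 / |(m : ℝ)| ^ 2 :=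
    tsum_comp_le_tsum_of_inj summable_int_inv_sq (fun m => by positivity) hinj
  calc _ ≤ Q / (n : ℝ) ^ K * ∑' m : ℤ, 1 / |(m : ℝ)| ^ 2 := by gcongr
    _ = _ := by ring

theorem main_identity (j K : ℕ) (hj : j ≤ 1) : ∃ C : ℝ, 0 < C ∧ ∀ n : ℕ, 1 ≤ n →
    |∑' h : ℕ, ((h : ℝ) + 2) ^ j * (W n h / 2 ^ n) -
      qq j * ∫ t in (0 : ℝ)..(π / 2), Real.cos t ^ n * Real.sin t ^ 2 * (1 / t ^ (1 + j))| ≤ C / (n : ℝ) ^ K := by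
  obtain ⟨D, J, C, hC, H⟩ := approx_g K
  choose Cs hCs hs using fun k => sumR j k (2 * (J + K) + j) hj
  set Q := (C * ∑' m : ℤ, 1 / |(2 * m + 1 : ℝ)| ^ 2) * (∑' m : ℤ, 1 / |(m : ℝ)| ^ 2) with hQ
  have hQp : 0 ≤ Q := mul_nonneg (mul_nonneg hC.le (tsum_nonneg fun m => by positivity)) (tsum_nonneg fun m => by positivity)
  set CS := ∑ k ∈ Finset.range D, Cs k with hCS
  have hCSp : 0 ≤ CS := Finset.sum_nonneg fun k _ => (hCs k).le
  refine ⟨Q + C * CS + π * C * π, by positivity, fun n hn => ?_⟩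
  obtain ⟨a, hcc, hgb, hg⟩ := H n hn
  have hn' : (1 : ℝ) ≤ n := by exact_mod_cast hn
  have he := ep_pos hn
  have hpi := Real.pi_gt_three
  have hep : ep n ^ 2 ≤ 1 / n := by
    rw [ep_sq hn]
    gcongr
    nlinarith
  have hep1 : ep n ≤ 1 := by
    have : 1 / (n : ℝ) ≤ 1 := by rw [div_le_one (by linarith)]; exact hn'
    by_contra hc
    push Not at hc
    nlinarith
  have step1 := sum_bound j hj hn a hg hC (fun k => by
    have := (hs k (ep n) he n).1
    exact_mod_cast this)
  rw [← sum_T] at step1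
  -- step 2
  have step2 : |∑ k ∈ Finset.range D, cc n a k / ep n ^ j * (1 / 2 * ∑' s : ℤ, PsiR k j (ep n * (2 * s + n))) -
      ∑ k ∈ Finset.range D, cc n a k / ep n ^ j * (-(kap j / ep n * Mom j k))| ≤ C * CS / (n : ℝ) ^ K := by
    rw [← Finset.sum_sub_distrib]
    refine (Finset.abs_sum_le_sum_abs _ _).trans ?_
    rw [hCS, Finset.mul_sum, Finset.sum_div]
    apply Finset.sum_le_sum
    intro k hk
    rw [← mul_sub, abs_mul, abs_div, abs_of_pos (pow_pos he j)]
    have h1 := hcc k (Finset.mem_range.mp hk)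
    have h2 := (hs k (ep n) he n).2
    push_cast at h2
    calc _ ≤ C * (n : ℝ) ^ J / ep n ^ j * (Cs k * ep n ^ (2 * (J + K) + j + 1)) := by
          gcongr
      _ = C * Cs k * (n : ℝ) ^ J * (ep n ^ 2) ^ (J + K) * ep n := by
          rw [← pow_mul, pow_add, pow_add]; field_simp
      _ ≤ C * Cs k * (n : ℝ) ^ J * (1 / n) ^ (J + K) * 1 := by
          have := hCs k
          gcongr
      _ = _ := by rw [pow_add, div_pow, div_pow, one_pow, one_pow]; field_simp
  -- step 3
  have hIntg : ∀ k, ∀ t ∈ Set.Ioi (0 : ℝ), t ^ (2 * k + 1 - j) * Real.exp (-(n * t ^ 2 / 2)) =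
      t ^ (2 * k + 2) * Real.exp (-(n * t ^ 2 / 2)) * (1 / t ^ (1 + j)) := by
    intro k t ht
    have ht' : (0 : ℝ) < t := ht
    have : t ^ (2 * k + 2) = t ^ (2 * k + 1 - j) * t ^ (1 + j) := by rw [← pow_add]; congr 1; omega
    rw [this]; field_simp
  have step3 := transfer (B := 1) hn hC a hgb (fun t => 1 / t ^ (1 + j)) (by fun_prop) (by
    intro t ht
    rw [abs_of_pos (by positivity), one_mul]
    interval_cases j
    · have : (1 / t ^ (1 + 0)) * (t ^ 2 / (1 + t ^ 2) ^ 2) = t / (1 + t ^ 2) ^ 2 := by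
        rw [add_zero, pow_one]; field_simp
      rw [this, div_le_div_iff₀ (by positivity) (by positivity)]
      nlinarith [sq_nonneg (t - 1), sq_nonneg t]
    · have : (1 / t ^ (1 + 1)) * (t ^ 2 / (1 + t ^ 2) ^ 2) = 1 / (1 + t ^ 2) ^ 2 := by field_simp
      rw [this, div_le_div_iff₀ (by positivity) (by positivity)]
      nlinarith [sq_nonneg t]) (by
    intro k
    have h1 := (integrable_gauss_mom (2 * k + 1 - j) (c := n / 2) (by positivity)).integrableOn (s := Set.Ioi 0)
    refine h1.congr_fun (fun t ht => ?_) measurableSet_Ioi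
    rw [← hIntg k t ht]
    have e : -(n * t ^ 2 / 2) = -((n : ℝ) / 2) * t ^ 2 := by ring
    rw [e])
  have e3 : ∑ k ∈ Finset.range D, cc n a k / ep n ^ j * (-(kap j / ep n * Mom j k)) =
      qq j * ∑ k ∈ Finset.range D, a k * ∫ t in Set.Ioi (0 : ℝ), t ^ (2 * k + 2) * Real.exp (-(n * t ^ 2 / 2)) * (1 / t ^ (1 + j)) := by
    rw [Finset.mul_sum]
    apply Finset.sum_congr rfl
    intro k _
    rw [← setIntegral_congr_fun measurableSet_Ioi (hIntg k), gauss_rescale0 hn, ← Mom]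
    have hsg := sg_pos hn
    interval_cases j
    · simp only [qq, kap, cc, ep, if_true, pow_zero, Nat.sub_zero]
      rw [pow_succ (sg n) (2 * k + 2)]
      field_simp
      norm_num
      left; ring
    · simp only [qq, kap, cc, ep, if_neg one_ne_zero, pow_one]
      rw [Nat.add_sub_cancel, show 2 * k + 3 = (2 * k + 1) + 2 by ring, pow_add (sg n) _ 2]
      field_simp
      norm_num
      left; ring
  rw [e3] at step2
  have hqq : 0 ≤ qq j ∧ qq j ≤ π := by
    unfold qq
    split_ifs
    · constructor <;> linarith
    · constructor <;> linarith
  have step4 : |qq j * ∑ k ∈ Finset.range D, a k * (∫ t in Set.Ioi (0 : ℝ), t ^ (2 * k + 2) * Real.exp (-(n * t ^ 2 / 2)) * (1 / t ^ (1 + j))) -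
      qq j * ∫ t in (0 : ℝ)..(π / 2), Real.cos t ^ n * Real.sin t ^ 2 * (1 / t ^ (1 + j))| ≤ π * C * π / (n : ℝ) ^ K := by
    rw [← mul_sub, abs_mul, abs_sub_comm, abs_of_nonneg hqq.1]
    calc _ ≤ π * (C / (n : ℝ) ^ K * 1 * (π / 2)) := by
          gcongr
          exact hqq.2
      _ = π * C * π / (n : ℝ) ^ K / 2 := by ring
      _ ≤ _ := half_le_self (by positivity)
  calc _ ≤ Q / (n : ℝ) ^ K + C * CS / (n : ℝ) ^ K + π * C * π / (n : ℝ) ^ K :=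
        (abs_sub_le _ _ _).trans (add_le_add ((abs_sub_le _ _ _).trans (add_le_add step1 step2)) step4)
    _ = _ := by ring

end EH

open Real
namespace EH
open MeasureTheory

noncomputable def MA (n k : ℕ) : ℝ := ∫ t in (0 : ℝ)..(π / 2), Real.cos t ^ n * Real.sin t ^ k

theorem MA_rec (n k : ℕ) : ((n : ℝ) + k + 2) * MA n (k + 2) = (k + 1) * MA n k := by
  have hd : ∀ t ∈ Set.uIcc (0 : ℝ) (π / 2), HasDerivAt (fun t => Real.cos t ^ (n + 1) * Real.sin t ^ (k + 1))
      (((k : ℝ) + 1) * (Real.cos t ^ n * Real.sin t ^ k) - ((n : ℝ) + k + 2) * (Real.cos t ^ n * Real.sin t ^ (k + 2))) t := by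
    intro t _
    refine (((Real.hasDerivAt_cos t).pow (n + 1)).mul ((Real.hasDerivAt_sin t).pow (k + 1))).congr_deriv ?_
    have := Real.sin_sq_add_cos_sq t
    have hc : Real.cos t ^ 2 = 1 - Real.sin t ^ 2 := by linarith
    push_cast
    simp only [Pi.pow_apply]
    have e : Real.cos t ^ (n + 1) * (((k : ℝ) + 1) * Real.sin t ^ k * Real.cos t) =
      Real.cos t ^ n * Real.cos t ^ 2 * ((k : ℝ) + 1) * Real.sin t ^ k := by ring
    rw [e, hc]; ring
  have := intervalIntegral.integral_eq_sub_of_hasDerivAt hd (by apply Continuous.intervalIntegrable; fun_prop)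
  rw [intervalIntegral.integral_sub (by apply Continuous.intervalIntegrable; fun_prop) (by apply Continuous.intervalIntegrable; fun_prop),
    intervalIntegral.integral_const_mul, intervalIntegral.integral_const_mul] at this
  simp at this
  unfold MA
  linarith

theorem MA_one (n : ℕ) : MA n 1 = 1 / (n + 1) := by
  have hd : ∀ t ∈ Set.uIcc (0 : ℝ) (π / 2), HasDerivAt (fun t => -(Real.cos t ^ (n + 1) / (n + 1)))
      (Real.cos t ^ n * Real.sin t ^ 1) t := by
    intro t _
    refine (((Real.hasDerivAt_cos t).pow (n + 1)).div_const _).neg.congr_deriv ?_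
    push_cast
    field_simp
  unfold MA
  rw [intervalIntegral.integral_eq_sub_of_hasDerivAt hd (by apply Continuous.intervalIntegrable; fun_prop)]
  simp

noncomputable def Wa (n : ℕ) : ℝ := MA n 0

theorem Wa_rec (n : ℕ) : ((n : ℝ) + 2) * Wa (n + 2) = (n + 1) * Wa n := by
  have h1 := MA_rec n 0
  have h2 : MA n (0 + 2) = MA n 0 - MA (n + 2) 0 := by
    unfold MA
    rw [← intervalIntegral.integral_sub (by apply Continuous.intervalIntegrable; fun_prop) (by apply Continuous.intervalIntegrable; fun_prop)]
    congr 1; ext t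
    have := Real.sin_sq_add_cos_sq t
    have hc : Real.sin t ^ 2 = 1 - Real.cos t ^ 2 := by linarith
    simp only [zero_add, pow_zero, mul_one, hc]; ring
  rw [h2] at h1
  unfold Wa
  push_cast at h1
  linarith

theorem Wa_prod (n : ℕ) : ((n : ℝ) + 1) * (Wa n * Wa (n + 1)) = π / 2 := by
  induction n with
  | zero => simp [Wa, MA]
  | succ n ih =>
    have := Wa_rec n
    push_cast
    rw [← ih]
    linear_combination Wa (n + 1) * this

theorem Wa_anti (n : ℕ) : Wa (n + 1) ≤ Wa n := by
  unfold Wa MA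
  apply intervalIntegral.integral_mono_on (by positivity) (by apply Continuous.intervalIntegrable; fun_prop) (by apply Continuous.intervalIntegrable; fun_prop)
  intro t ht
  have h0 : 0 ≤ Real.cos t := Real.cos_nonneg_of_mem_Icc ⟨by linarith [ht.1, Real.pi_pos], ht.2⟩
  rw [pow_zero, mul_one, mul_one]
  exact pow_le_pow_of_le_one h0 (Real.cos_le_one t) (by omega)

theorem Wa_nonneg (n : ℕ) : 0 ≤ Wa n := by
  unfold Wa MA
  apply intervalIntegral.integral_nonneg (by positivity)
  intro t ht
  have h0 : 0 ≤ Real.cos t := Real.cos_nonneg_of_mem_Icc ⟨by linarith [ht.1, Real.pi_pos], ht.2⟩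
  positivity

theorem Wa_pos (n : ℕ) : 0 < Wa n := by
  refine lt_of_le_of_ne (Wa_nonneg n) fun h => ?_
  have := Wa_prod n
  rw [← h] at this
  have := Real.pi_pos
  simp at *
  linarith

noncomputable def YY (n : ℕ) : ℝ := Wa n ^ 2 * (2 * n / π)

theorem YY_upper (n : ℕ) : YY n ≤ 1 := by
  rcases n with _ | n
  · simp [YY]
  · have h1 := Wa_prod n
    have h2 := Wa_anti n
    have h3 := Wa_pos (n + 1)
    have : Wa (n + 1) ^ 2 ≤ Wa n * Wa (n + 1) := by nlinarith
    unfold YY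
    rw [← mul_div_assoc, div_le_one Real.pi_pos]
    push_cast
    nlinarith

theorem YY_lower (n : ℕ) : (n : ℝ) / (n + 1) ≤ YY n := by
  have h1 := Wa_prod n
  have h2 := Wa_anti n
  have h3 := Wa_pos n
  have : Wa n * Wa (n + 1) ≤ Wa n ^ 2 := by nlinarith
  unfold YY
  have h4 : π / 2 ≤ (n + 1) * Wa n ^ 2 := by
    rw [← h1]; gcongr
  rw [div_le_iff₀ (by positivity), ← mul_div_assoc, div_mul_eq_mul_div, le_div_iff₀ Real.pi_pos]
  nlinarith [mul_le_mul_of_nonneg_left h4 (Nat.cast_nonneg (α := ℝ) n)]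

theorem YY_tendsto : Filter.Tendsto YY Filter.atTop (nhds 1) := by
  refine tendsto_of_tendsto_of_tendsto_of_le_of_le (tendsto_natCast_div_add_atTop (1 : ℝ)) tendsto_const_nhds YY_lower YY_upper

theorem YY_step (n : ℕ) : YY (n + 2) * (n * (n + 2)) = YY n * (n + 1) ^ 2 := by
  have h := Wa_rec n
  have hn : (n : ℝ) + 2 ≠ 0 := by positivity
  have h2 : Wa (n + 2) = (n + 1) / (n + 2) * Wa n := by field_simp; linarith
  unfold YY
  rw [h2]
  push_cast
  field_simp

noncomputable def yp (c x : ℝ) : ℝ := 1 - 1 / (2 * x) + 1 / (8 * x ^ 2) + 1 / (16 * x ^ 3) + c / x ^ 4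

theorem yp_tendsto (c : ℝ) : Filter.Tendsto (yp c) Filter.atTop (nhds 1) := by
  have h : Filter.Tendsto (fun x : ℝ => x⁻¹) Filter.atTop (nhds 0) := tendsto_inv_atTop_zero
  have h2 : Filter.Tendsto (fun x : ℝ => 1 - x⁻¹ / 2 + (x⁻¹) ^ 2 / 8 + (x⁻¹) ^ 3 / 16 + c * (x⁻¹) ^ 4) Filter.atTop
      (nhds (1 - 0 / 2 + 0 ^ 2 / 8 + 0 ^ 3 / 16 + c * 0 ^ 4)) :=
    ((((tendsto_const_nhds.sub (h.div_const _)).add ((h.pow 2).div_const _)).add ((h.pow 3).div_const _)).add ((h.pow 4).const_mul c))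
  have e : (1 - 0 / 2 + 0 ^ 2 / 8 + 0 ^ 3 / 16 + c * 0 ^ 4 : ℝ) = 1 := by norm_num
  rw [e] at h2
  refine h2.congr fun x => ?_
  unfold yp
  rw [inv_pow, inv_pow, inv_pow]
  simp only [mul_inv, div_eq_mul_inv]
  ring

theorem yp_pos {c x : ℝ} (hc : -1 ≤ c) (hx : 2 ≤ x) : 0 < yp c x := by
  have hx0 : 0 < x := by linarith
  have : yp c x = (16 * x ^ 4 - 8 * x ^ 3 + 2 * x ^ 2 + x + 16 * c) / (16 * x ^ 4) := by
    unfold yp; field_simp; ring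
  rw [this]
  apply div_pos _ (by positivity)
  have h1 : (16 : ℝ) ≤ x ^ 4 := by
    calc (16 : ℝ) = 2 ^ 4 := by norm_num
      _ ≤ _ := by gcongr
  have h2 : 2 * x ^ 3 ≤ x ^ 4 := by
    rw [pow_succ x 3]; nlinarith [pow_pos hx0 3]
  nlinarith [sq_nonneg x]

theorem yp_step_pos {x : ℝ} (hx : 2 ≤ x) : x * (x + 2) * yp 1 (x + 2) ≤ (x + 1) ^ 2 * yp 1 x := by
  have hx0 : 0 < x := by linarith
  have : (x + 1) ^ 2 * yp 1 x - x * (x + 2) * yp 1 (x + 2) =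
    (16 + 65 * x + 110 * x ^ 2 + 189 / 2 * x ^ 3 + 87 / 2 * x ^ 4 + 133 / 16 * x ^ 5) / (x ^ 4 * (x + 2) ^ 4) := by
    unfold yp; field_simp; ring
  have h2 : 0 ≤ (16 + 65 * x + 110 * x ^ 2 + 189 / 2 * x ^ 3 + 87 / 2 * x ^ 4 + 133 / 16 * x ^ 5) / (x ^ 4 * (x + 2) ^ 4) := by
    positivity
  linarith

theorem yp_step_neg {x : ℝ} (hx : 2 ≤ x) : (x + 1) ^ 2 * yp (-1) x ≤ x * (x + 2) * yp (-1) (x + 2) := by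
  have hx0 : 0 < x := by linarith
  have : x * (x + 2) * yp (-1) (x + 2) - (x + 1) ^ 2 * yp (-1) x =
    (16 + 63 * x + 98 * x ^ 2 + 163 / 2 * x ^ 3 + 77 / 2 * x ^ 4 + 123 / 16 * x ^ 5) / (x ^ 4 * (x + 2) ^ 4) := by
    unfold yp; field_simp; ring
  have h2 : 0 ≤ (16 + 63 * x + 98 * x ^ 2 + 163 / 2 * x ^ 3 + 77 / 2 * x ^ 4 + 123 / 16 * x ^ 5) / (x ^ 4 * (x + 2) ^ 4) := by
    positivity
  linarith

theorem YY_ratio_tendsto (c : ℝ) (n : ℕ) : Filter.Tendsto (fun k : ℕ => YY (n + 2 * k) / yp c ((n + 2 * k : ℕ) : ℝ)) Filter.atTop (nhds 1) := by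
  have h0 : Filter.Tendsto (fun k : ℕ => n + 2 * k) Filter.atTop Filter.atTop :=
    Filter.tendsto_atTop_mono (fun k => by simp only [id]; omega) Filter.tendsto_id
  have h1 := YY_tendsto.comp h0
  have h2 := ((yp_tendsto c).comp tendsto_natCast_atTop_atTop).comp h0
  have := h1.div h2 one_ne_zero
  rw [div_one] at this
  exact this

theorem YY_pos {n : ℕ} (hn : 1 ≤ n) : 0 < YY n := by
  have := Wa_pos n
  have hn' : (0 : ℝ) < n := by exact_mod_cast hn
  unfold YY; positivity

theorem YY_bounds {n : ℕ} (hn : 2 ≤ n) : yp (-1) n ≤ YY n ∧ YY n ≤ yp 1 n := by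
  have hx : ∀ k : ℕ, (2 : ℝ) ≤ ((n + 2 * k : ℕ) : ℝ) := fun k => by
    have : 2 ≤ n + 2 * k := by omega
    exact_mod_cast this
  have hs : ∀ k : ℕ, YY (n + 2 * (k + 1)) * (((n + 2 * k : ℕ) : ℝ) * (((n + 2 * k : ℕ) : ℝ) + 2)) = YY (n + 2 * k) * (((n + 2 * k : ℕ) : ℝ) + 1) ^ 2 :=
    fun k => YY_step (n + 2 * k)
  have hc : ∀ k : ℕ, ((n + 2 * (k + 1) : ℕ) : ℝ) = ((n + 2 * k : ℕ) : ℝ) + 2 := fun k => by push_cast; ring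
  have hnx : (2 : ℝ) ≤ n := by exact_mod_cast hn
  constructor
  · have hanti : Antitone fun k : ℕ => YY (n + 2 * k) / yp (-1) ((n + 2 * k : ℕ) : ℝ) := by
      apply antitone_nat_of_succ_le
      intro k
      have hk := hx k
      have h1 := hs k
      have h3 := yp_step_neg hk
      have h4 := yp_pos (c := -1) le_rfl hk
      have h5 := yp_pos (c := -1) le_rfl (hx (k + 1))
      rw [hc k] at h5 ⊢
      generalize ((n + 2 * k : ℕ) : ℝ) = x at *
      rw [div_le_div_iff₀ h5 h4]
      have hY : 0 < YY (n + 2 * k) := YY_pos (by omega)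
      have hp : 0 < x * (x + 2) := by nlinarith
      refine le_of_mul_le_mul_right ?_ hp
      calc _ = YY (n + 2 * (k + 1)) * (x * (x + 2)) * yp (-1) x := by ring
        _ = YY (n + 2 * k) * ((x + 1) ^ 2 * yp (-1) x) := by rw [h1]; ring
        _ ≤ YY (n + 2 * k) * (x * (x + 2) * yp (-1) (x + 2)) := by gcongr
        _ = _ := by ring
    have := hanti.le_of_tendsto (YY_ratio_tendsto (-1) n) 0
    simp only [mul_zero, add_zero] at this
    rwa [le_div_iff₀ (yp_pos le_rfl hnx), one_mul] at this
  · have hmono : Monotone fun k : ℕ => YY (n + 2 * k) / yp 1 ((n + 2 * k : ℕ) : ℝ) := by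
      apply monotone_nat_of_le_succ
      intro k
      have hk := hx k
      have h1 := hs k
      have h3 := yp_step_pos hk
      have h4 := yp_pos (c := 1) (by norm_num) hk
      have h5 := yp_pos (c := 1) (by norm_num) (hx (k + 1))
      rw [hc k] at h5 ⊢
      generalize ((n + 2 * k : ℕ) : ℝ) = x at *
      rw [div_le_div_iff₀ h4 h5]
      have hY : 0 < YY (n + 2 * k) := YY_pos (by omega)
      have hp : 0 < x * (x + 2) := by nlinarith
      refine le_of_mul_le_mul_right ?_ hp
      calc _ = YY (n + 2 * k) * (x * (x + 2) * yp 1 (x + 2)) := by ring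
        _ ≤ YY (n + 2 * k) * ((x + 1) ^ 2 * yp 1 x) := by gcongr
        _ = YY (n + 2 * (k + 1)) * (x * (x + 2)) * yp 1 x := by rw [h1]; ring
        _ = _ := by ring
    have := hmono.ge_of_tendsto (YY_ratio_tendsto 1 n) 0
    simp only [mul_zero, add_zero] at this
    rwa [div_le_iff₀ (yp_pos (by norm_num) hnx), one_mul] at this

end EH

open Real
namespace EH
open MeasureTheory

/-- expansion in powers of `1/n` up to relative order `n^{-4}` -/
def AP (f : ℕ → ℝ) (p0 p1 p2 p3 : ℝ) : Prop :=
  ∃ C : ℝ, 0 < C ∧ ∀ n : ℕ, 2 ≤ n → |f n - (p0 + p1 / n + p2 / (n : ℝ) ^ 2 + p3 / (n : ℝ) ^ 3)| ≤ C / (n : ℝ) ^ 4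

theorem AP.add {f g : ℕ → ℝ} {p0 p1 p2 p3 q0 q1 q2 q3 : ℝ} (hf : AP f p0 p1 p2 p3) (hg : AP g q0 q1 q2 q3) :
    AP (fun n => f n + g n) (p0 + q0) (p1 + q1) (p2 + q2) (p3 + q3) := by
  obtain ⟨C, hC, h⟩ := hf
  obtain ⟨D, hD, k⟩ := hg
  refine ⟨C + D, by positivity, fun n hn => ?_⟩
  have := add_le_add (h n hn) (k n hn)
  rw [← add_div] at this
  refine le_trans ?_ this
  refine le_trans (le_of_eq ?_) (abs_add_le _ _)
  congr 1; ring

theorem AP.const (c : ℝ) : AP (fun _ => c) c 0 0 0 :=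
  ⟨1, one_pos, fun n _ => by simp⟩

theorem AP.polybound (p0 p1 p2 p3 : ℝ) {n : ℕ} (hn : 2 ≤ n) :
    |p0 + p1 / n + p2 / (n : ℝ) ^ 2 + p3 / (n : ℝ) ^ 3| ≤ |p0| + |p1| + |p2| + |p3| := by
  have hn' : (1 : ℝ) ≤ n := by exact_mod_cast (by omega : 1 ≤ n)
  have aux : ∀ p : ℝ, ∀ k : ℕ, |p / (n : ℝ) ^ k| ≤ |p| := by
    intro p k
    rw [abs_div, abs_of_pos (by positivity : (0 : ℝ) < (n : ℝ) ^ k)]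
    exact div_le_self (abs_nonneg _) (one_le_pow₀ hn')
  have h1 := aux p1 1
  rw [pow_one] at h1
  calc _ ≤ |p0| + |p1 / n| + |p2 / (n : ℝ) ^ 2| + |p3 / (n : ℝ) ^ 3| :=
        (abs_add_le _ _).trans (add_le_add_left ((abs_add_le _ _).trans (add_le_add_left (abs_add_le _ _) _)) _)
    _ ≤ _ := by linarith [aux p2 2, aux p3 3]

theorem AP.mul {f g : ℕ → ℝ} {p0 p1 p2 p3 q0 q1 q2 q3 : ℝ} (hf : AP f p0 p1 p2 p3) (hg : AP g q0 q1 q2 q3) :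
    AP (fun n => f n * g n) (p0 * q0) (p0 * q1 + p1 * q0) (p0 * q2 + p1 * q1 + p2 * q0) (p0 * q3 + p1 * q2 + p2 * q1 + p3 * q0) := by
  obtain ⟨C, hC, h⟩ := hf
  obtain ⟨D, hD, k⟩ := hg
  set P := |p0| + |p1| + |p2| + |p3| with hP
  set Q := |q0| + |q1| + |q2| + |q3| with hQ
  set R := |p1 * q3 + p2 * q2 + p3 * q1| + |p2 * q3 + p3 * q2| + |p3 * q3| + |(0 : ℝ)| with hR
  have hPp : 0 ≤ P := by positivity
  have hQp : 0 ≤ Q := by positivity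
  have hRp : 0 ≤ R := by positivity
  refine ⟨C * (Q + D) + P * D + R, by positivity, fun n hn => ?_⟩
  have hn' : (1 : ℝ) ≤ n := by exact_mod_cast (by omega : 1 ≤ n)
  have h1 := h n hn
  have k1 := k n hn
  have hp := AP.polybound p0 p1 p2 p3 hn
  have hq := AP.polybound q0 q1 q2 q3 hn
  have hr := AP.polybound (p1 * q3 + p2 * q2 + p3 * q1) (p2 * q3 + p3 * q2) (p3 * q3) 0 hn
  rw [← hP] at hp
  rw [← hQ] at hq
  rw [← hR] at hr
  set p := p0 + p1 / n + p2 / (n : ℝ) ^ 2 + p3 / (n : ℝ) ^ 3 with hpe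
  set q := q0 + q1 / n + q2 / (n : ℝ) ^ 2 + q3 / (n : ℝ) ^ 3 with hqe
  set r := p1 * q3 + p2 * q2 + p3 * q1 + (p2 * q3 + p3 * q2) / n + p3 * q3 / (n : ℝ) ^ 2 + 0 / (n : ℝ) ^ 3 with hre
  have e : f n * g n - (p0 * q0 + (p0 * q1 + p1 * q0) / n + (p0 * q2 + p1 * q1 + p2 * q0) / (n : ℝ) ^ 2 + (p0 * q3 + p1 * q2 + p2 * q1 + p3 * q0) / (n : ℝ) ^ 3)
      = (f n - p) * g n + p * (g n - q) + r / (n : ℝ) ^ 4 := by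
    have : p * q = p0 * q0 + (p0 * q1 + p1 * q0) / n + (p0 * q2 + p1 * q1 + p2 * q0) / (n : ℝ) ^ 2 + (p0 * q3 + p1 * q2 + p2 * q1 + p3 * q0) / (n : ℝ) ^ 3 + r / (n : ℝ) ^ 4 := by
      rw [hpe, hqe, hre]; field_simp; ring
    linear_combination this
  have hg : |g n| ≤ Q + D := by
    have h4 : D / (n : ℝ) ^ 4 ≤ D := div_le_self hD.le (one_le_pow₀ hn')
    have : |g n| ≤ |g n - q| + |q| := by
      have := abs_add_le (g n - q) q
      simpa using this
    linarith
  rw [e]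
  calc _ ≤ |(f n - p) * g n| + |p * (g n - q)| + |r / (n : ℝ) ^ 4| :=
        (abs_add_le _ _).trans (add_le_add_left (abs_add_le _ _) _)
    _ = |f n - p| * |g n| + |p| * |g n - q| + |r| / (n : ℝ) ^ 4 := by
        rw [abs_mul, abs_mul, abs_div, abs_of_pos (by positivity : (0 : ℝ) < (n : ℝ) ^ 4)]
    _ ≤ C / (n : ℝ) ^ 4 * (Q + D) + P * (D / (n : ℝ) ^ 4) + R / (n : ℝ) ^ 4 := by gcongr
    _ = _ := by ring

theorem AP.inv_add (c : ℝ) (hc : 0 ≤ c) : AP (fun n => 1 / ((n : ℝ) + c)) 0 1 (-c) (c ^ 2) := by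
  refine ⟨c ^ 3 + 1, by positivity, fun n hn => ?_⟩
  have hn' : (1 : ℝ) ≤ n := by exact_mod_cast (by omega : 1 ≤ n)
  have e : 1 / ((n : ℝ) + c) - (0 + 1 / n + -c / (n : ℝ) ^ 2 + c ^ 2 / (n : ℝ) ^ 3) = -(c ^ 3 / ((n : ℝ) ^ 3 * (n + c))) := by
    field_simp; ring
  rw [e, abs_neg, abs_of_nonneg (by positivity)]
  have : (n : ℝ) ^ 4 ≤ (n : ℝ) ^ 3 * (n + c) := by
    rw [pow_succ (n : ℝ) 3]; gcongr; linarith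
  gcongr
  linarith

/-- `n/(n+c)` -/
theorem AP.ratio (c : ℝ) (hc : 0 ≤ c) : AP (fun n => (n : ℝ) / ((n : ℝ) + c)) 1 (-c) (c ^ 2) (-c ^ 3) := by
  refine ⟨c ^ 4 + 1, by positivity, fun n hn => ?_⟩
  have hn' : (1 : ℝ) ≤ n := by exact_mod_cast (by omega : 1 ≤ n)
  have e : (n : ℝ) / ((n : ℝ) + c) - (1 + -c / n + c ^ 2 / (n : ℝ) ^ 2 + -c ^ 3 / (n : ℝ) ^ 3) = (c ^ 4 / ((n : ℝ) ^ 3 * (n + c))) := by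
    field_simp; ring
  rw [e, abs_of_nonneg (by positivity)]
  have : (n : ℝ) ^ 4 ≤ (n : ℝ) ^ 3 * (n + c) := by
    rw [pow_succ (n : ℝ) 3]; gcongr; linarith
  gcongr
  linarith

theorem AP.perturb {f g : ℕ → ℝ} {p0 p1 p2 p3 : ℝ} (hf : AP f p0 p1 p2 p3)
    (h : ∃ C, 0 < C ∧ ∀ n : ℕ, 2 ≤ n → |g n - f n| ≤ C / (n : ℝ) ^ 4) : AP g p0 p1 p2 p3 := by
  obtain ⟨D, hD, k⟩ := h
  obtain ⟨C, hC, h⟩ := hf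
  refine ⟨D + C, by positivity, fun n hn => ?_⟩
  rw [add_div]
  exact (abs_sub_le _ _ _).trans (add_le_add (k n hn) (h n hn))

/-- normalised Wallis integral -/
noncomputable def Wh (n : ℕ) : ℝ := Real.sqrt (YY n)

theorem AP_Wh : AP Wh 1 (-(1 / 4)) (1 / 32) (5 / 128) := by
  refine ⟨5, by norm_num, fun n hn => ?_⟩
  have hx : (2 : ℝ) ≤ n := by exact_mod_cast hn
  obtain ⟨h1, h2⟩ := YY_bounds hn
  have hY := YY_pos (by omega : 1 ≤ n)
  unfold Wh
  set x : ℝ := (n : ℝ) with hxdef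
  have hx0 : 0 < x := by linarith
  set w := 1 + -(1 / 4) / x + 1 / 32 / x ^ 2 + 5 / 128 / x ^ 3 with hw
  have hw1 : 1 / 2 ≤ w := by
    have : w - 1 / 2 = (64 * x ^ 3 - 32 * x ^ 2 + 4 * x + 5) / (128 * x ^ 3) := by
      rw [hw]; field_simp; ring
    have : 0 ≤ (64 * x ^ 3 - 32 * x ^ 2 + 4 * x + 5) / (128 * x ^ 3) := by
      apply div_nonneg _ (by positivity)
      nlinarith [mul_nonneg (sq_nonneg x) (by linarith : 0 ≤ x - 2)]
    linarith
  have hww : |w ^ 2 - yp 0 x| ≤ 1 / x ^ 4 := by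
    have e : w ^ 2 - yp 0 x = (-(19 / 1024) + 5 / 2048 / x + 25 / 16384 / x ^ 2) / x ^ 4 := by
      rw [hw]; unfold yp; field_simp; ring
    rw [e, abs_div, abs_of_pos (by positivity : 0 < x ^ 4)]
    gcongr
    have a1 : 5 / 2048 / x ≤ 5 / 2048 := div_le_self (by norm_num) (by linarith)
    have a2 : 25 / 16384 / x ^ 2 ≤ 25 / 16384 := div_le_self (by norm_num) (one_le_pow₀ (by linarith))
    have a3 : 0 ≤ 5 / 2048 / x := by positivity
    have a4 : 0 ≤ 25 / 16384 / x ^ 2 := by positivity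
    rw [abs_le]; constructor <;> linarith
  have hyy : |YY n - yp 0 x| ≤ 1 / x ^ 4 := by
    have e1 : yp (-1) x = yp 0 x - 1 / x ^ 4 := by unfold yp; ring
    have e2 : yp 1 x = yp 0 x + 1 / x ^ 4 := by unfold yp; ring
    rw [e1] at h1
    rw [e2] at h2
    rw [abs_le]; constructor <;> linarith
  have hd : |YY n - w ^ 2| ≤ 2 / x ^ 4 := by
    rw [abs_sub_comm] at hww
    have := abs_sub_le (YY n) (yp 0 x) (w ^ 2)
    have e : 2 / x ^ 4 = 1 / x ^ 4 + 1 / x ^ 4 := by ring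
    linarith
  have hs := Real.sqrt_nonneg (YY n)
  have hsq := Real.sq_sqrt hY.le
  have e : YY n - w ^ 2 = (Real.sqrt (YY n) - w) * (Real.sqrt (YY n) + w) := by
    rw [← sub_eq_zero]; nth_rewrite 1 [← hsq]; ring
  rw [e, abs_mul, abs_of_pos (by linarith : 0 < Real.sqrt (YY n) + w)] at hd
  have h6 : |Real.sqrt (YY n) - w| * (1 / 2) ≤ |Real.sqrt (YY n) - w| * (Real.sqrt (YY n) + w) := by
    gcongr; linarith
  have e5 : 2 / x ^ 4 * 2 = 4 / x ^ 4 := by ring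
  have h7 : 4 / x ^ 4 ≤ 5 / x ^ 4 := by gcongr; norm_num
  linarith

end EH

open Real
namespace EH
open MeasureTheory

/-- truncated series of `arcsin s` -/
noncomputable def asT (s : ℝ) : ℝ := s + s ^ 3 / 6 + 3 * s ^ 5 / 40 + 5 * s ^ 7 / 112

theorem asT_deriv (t : ℝ) : HasDerivAt (fun t => t - asT (Real.sin t))
    (1 - Real.cos t * (1 + Real.sin t ^ 2 / 2 + 3 * Real.sin t ^ 4 / 8 + 5 * Real.sin t ^ 6 / 16)) t := by
  have hs := Real.hasDerivAt_sin t
  unfold asT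
  refine ((hasDerivAt_id t).sub (((hs.add ((hs.pow 3).div_const 6)).add (((hs.pow 5).const_mul 3).div_const 40)).add (((hs.pow 7).const_mul 5).div_const 112))).congr_deriv ?_
  push_cast
  ring

theorem asT_deriv_bound {t : ℝ} (h0 : 0 ≤ t) (h1 : t ≤ π / 2) :
    0 ≤ 1 - Real.cos t * (1 + Real.sin t ^ 2 / 2 + 3 * Real.sin t ^ 4 / 8 + 5 * Real.sin t ^ 6 / 16) ∧
    1 - Real.cos t * (1 + Real.sin t ^ 2 / 2 + 3 * Real.sin t ^ 4 / 8 + 5 * Real.sin t ^ 6 / 16) ≤ t ^ 8 := by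
  have hc : 0 ≤ Real.cos t := Real.cos_nonneg_of_mem_Icc ⟨by linarith [Real.pi_pos], h1⟩
  have hs : 0 ≤ Real.sin t := Real.sin_nonneg_of_nonneg_of_le_pi h0 (by linarith [Real.pi_pos])
  have hst : Real.sin t ≤ t := Real.sin_le h0
  have hs1 := Real.sin_le_one t
  have hsq := Real.sin_sq_add_cos_sq t
  have hst8 : Real.sin t ^ 8 ≤ t ^ 8 := by gcongr
  set u := Real.sin t ^ 2 with hu
  have hu0 : 0 ≤ u := by positivity
  have hu1 : u ≤ 1 := by rw [hu]; nlinarith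
  have e4 : Real.sin t ^ 4 = u ^ 2 := by rw [hu]; ring
  have e6 : Real.sin t ^ 6 = u ^ 3 := by rw [hu]; ring
  have e8 : Real.sin t ^ 8 = u ^ 4 := by rw [hu]; ring
  rw [e8] at hst8
  rw [e4, e6]
  set r := 1 + u / 2 + 3 * u ^ 2 / 8 + 5 * u ^ 3 / 16 with hr
  have hr0 : 0 ≤ r := by positivity
  have hcc : Real.cos t ^ 2 = 1 - u := by linarith
  have key : 1 - (Real.cos t * r) ^ 2 = u ^ 4 * (35 / 64 + 14 / 64 * u + 35 / 256 * u ^ 2 + 25 / 256 * u ^ 3) := by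
    rw [mul_pow, hcc, hr]; ring
  have hu2 : u ^ 2 ≤ 1 := pow_le_one₀ hu0 hu1
  have hu3 : u ^ 3 ≤ 1 := pow_le_one₀ hu0 hu1
  have k1 : 0 ≤ 1 - (Real.cos t * r) ^ 2 := by rw [key]; positivity
  have k2 : 1 - (Real.cos t * r) ^ 2 ≤ u ^ 4 := by
    rw [key]
    apply mul_le_of_le_one_right (by positivity)
    linarith
  have hm : 0 ≤ Real.cos t * r := mul_nonneg hc hr0
  have hm1 : Real.cos t * r ≤ 1 := by nlinarith
  constructor
  · linarith
  · nlinarith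

theorem asT_bound {t : ℝ} (h0 : 0 ≤ t) (h1 : t ≤ π / 2) :
    0 ≤ t - asT (Real.sin t) ∧ t - asT (Real.sin t) ≤ t ^ 9 := by
  have hconv : Convex ℝ (Set.Icc (0 : ℝ) (π / 2)) := convex_Icc _ _
  have hmem0 : (0 : ℝ) ∈ Set.Icc (0 : ℝ) (π / 2) := ⟨le_rfl, by positivity⟩
  have hmem : t ∈ Set.Icc (0 : ℝ) (π / 2) := ⟨h0, h1⟩
  constructor
  · have hm : MonotoneOn (fun t => t - asT (Real.sin t)) (Set.Icc 0 (π / 2)) := by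
      apply monotoneOn_of_deriv_nonneg hconv
      · exact fun x _ => (asT_deriv x).continuousAt.continuousWithinAt
      · exact fun x _ => (asT_deriv x).differentiableAt.differentiableWithinAt
      · intro x hx
        rw [interior_Icc] at hx
        rw [(asT_deriv x).deriv]
        exact (asT_deriv_bound hx.1.le hx.2.le).1
    have := hm hmem0 hmem h0
    simpa [asT] using this
  · have hd : ∀ x : ℝ, HasDerivAt (fun t => t ^ 9 - (t - asT (Real.sin t))) (9 * x ^ 8 -
      (1 - Real.cos x * (1 + Real.sin x ^ 2 / 2 + 3 * Real.sin x ^ 4 / 8 + 5 * Real.sin x ^ 6 / 16))) x := by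
      intro x
      refine ((hasDerivAt_pow 9 x).sub (asT_deriv x)).congr_deriv ?_
      norm_num
    have hm : MonotoneOn (fun t => t ^ 9 - (t - asT (Real.sin t))) (Set.Icc 0 (π / 2)) := by
      apply monotoneOn_of_deriv_nonneg hconv
      · exact fun x _ => (hd x).continuousAt.continuousWithinAt
      · exact fun x _ => (hd x).differentiableAt.differentiableWithinAt
      · intro x hx
        rw [interior_Icc] at hx
        rw [(hd x).deriv]
        have := (asT_deriv_bound hx.1.le hx.2.le).2
        have h8 : 0 ≤ x ^ 8 := by have := hx.1; positivity
        linarith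
    have := hm hmem0 hmem h0
    simp only [asT] at this
    simp at this
    unfold asT
    linarith

noncomputable def pB (u : ℝ) : ℝ := 1 - u / 6 - 17 / 360 * u ^ 2 - 367 / 15120 * u ^ 3
noncomputable def pA (u : ℝ) : ℝ := 1 - u / 3 - u ^ 2 / 15 - 31 / 945 * u ^ 3

theorem sinc_bounds {t : ℝ} (h0 : 0 < t) (h1 : t ≤ π / 2) :
    |Real.sin t / t - pB (Real.sin t ^ 2)| ≤ 1027 * Real.sin t ^ 8 ∧
    |(Real.sin t / t) ^ 2 - pA (Real.sin t ^ 2)| ≤ 1027 * Real.sin t ^ 8 := by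
  have hs : 0 < Real.sin t := Real.sin_pos_of_pos_of_lt_pi h0 (by linarith [Real.pi_pos])
  have hst : Real.sin t ≤ t := Real.sin_le h0.le
  have hs1 := Real.sin_le_one t
  have hts : t ≤ 2 * Real.sin t := by
    have := Real.mul_le_sin h0.le h1
    have h2 : 1 / 2 ≤ 2 / π := by
      rw [div_le_div_iff₀ (by norm_num) Real.pi_pos]; linarith [Real.pi_lt_four]
    nlinarith
  obtain ⟨b1, b2⟩ := asT_bound h0.le h1
  have b3 : t ^ 9 ≤ 512 * Real.sin t ^ 9 := by
    calc _ ≤ (2 * Real.sin t) ^ 9 := by gcongr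
      _ = _ := by ring
  set s := Real.sin t with hsdef
  set u := s ^ 2 with hu
  have hu0 : 0 ≤ u := by positivity
  have hu1 : u ≤ 1 := by rw [hu]; nlinarith
  have hu2 : u ^ 2 ≤ 1 := pow_le_one₀ hu0 hu1
  have hu3 : u ^ 3 ≤ 1 := pow_le_one₀ hu0 hu1
  have hu2' : 0 ≤ u ^ 2 := by positivity
  have hu3' : 0 ≤ u ^ 3 := by positivity
  have e8 : s ^ 8 = u ^ 4 := by rw [hu]; ring
  have hp : |pB u| ≤ 1 := by
    unfold pB; rw [abs_le]; constructor <;> linarith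
  set η := t - asT s with hη
  have c1 : s - pB u * asT s = s * u ^ 4 * (13633 / 907200 + 11 / 2800 * u + 367 / 338688 * u ^ 2) := by
    unfold pB asT; rw [hu]; ring
  have c2 : |s - pB u * t| ≤ 513 * s * u ^ 4 := by
    have e : s - pB u * t = (s - pB u * asT s) - pB u * η := by rw [hη]; ring
    rw [e]
    refine (abs_sub _ _).trans ?_
    rw [c1, abs_mul (pB u), abs_of_nonneg b1, abs_of_nonneg (by positivity)]
    have f1 : s * u ^ 4 * (13633 / 907200 + 11 / 2800 * u + 367 / 338688 * u ^ 2) ≤ s * u ^ 4 :=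
      mul_le_of_le_one_right (by positivity) (by linarith)
    have f2 : |pB u| * η ≤ 1 * (512 * s ^ 9) := by
      apply mul_le_mul hp (b2.trans b3) b1 (by norm_num)
    have f3 : s ^ 9 = s * u ^ 4 := by rw [hu]; ring
    rw [f3] at f2
    linarith
  have c3 : |s / t - pB u| ≤ 513 * u ^ 4 := by
    have e : s / t - pB u = (s - pB u * t) / t := by field_simp
    rw [e, abs_div, abs_of_pos h0, div_le_iff₀ h0]
    refine c2.trans ?_
    have : 0 ≤ u ^ 4 := by positivity
    nlinarith
  have hu4 : 0 ≤ u ^ 4 := by positivity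
  rw [e8]
  refine ⟨c3.trans (by linarith), ?_⟩
  have hq0 : 0 ≤ s / t := by positivity
  have hq1 : s / t ≤ 1 := by rw [div_le_one h0]; exact hst
  have e : (s / t) ^ 2 - pA u = (s / t - pB u) * (s / t + pB u) + u ^ 4 * (3121 / 302400 + 6239 / 2721600 * u + 134689 / 228614400 * u ^ 2) := by
    unfold pA pB; ring
  rw [e]
  refine (abs_add_le _ _).trans ?_
  rw [abs_mul, abs_of_nonneg (by positivity : 0 ≤ u ^ 4 * (3121 / 302400 + 6239 / 2721600 * u + 134689 / 228614400 * u ^ 2))]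
  have g1 : u ^ 4 * (3121 / 302400 + 6239 / 2721600 * u + 134689 / 228614400 * u ^ 2) ≤ u ^ 4 :=
    mul_le_of_le_one_right (by positivity) (by linarith)
  have g2 : |s / t + pB u| ≤ 2 := by
    refine (abs_add_le _ _).trans ?_
    rw [abs_of_nonneg hq0]; linarith
  have g3 : |s / t - pB u| * |s / t + pB u| ≤ 513 * u ^ 4 * 2 :=
    mul_le_mul c3 g2 (abs_nonneg _) (by positivity)
  linarith

end EH

open Real
namespace EH
open MeasureTheory

/-- comparison of two integrals on `(0, π/2]` -/
theorem int_compare {f F G M : ℝ → ℝ} (hF : Continuous F) (hG : Continuous G) (hM : Continuous M)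
    (h1 : ∀ t, 0 < t → t ≤ π / 2 → f t = F t) (h2 : ∀ t, 0 < t → t ≤ π / 2 → |F t - G t| ≤ M t) :
    |(∫ t in (0 : ℝ)..(π / 2), f t) - ∫ t in (0 : ℝ)..(π / 2), G t| ≤ ∫ t in (0 : ℝ)..(π / 2), M t := by
  have hpi : (0 : ℝ) ≤ π / 2 := by positivity
  have e : (∫ t in (0 : ℝ)..(π / 2), f t) = ∫ t in (0 : ℝ)..(π / 2), F t := by
    apply intervalIntegral.integral_congr_ae
    refine Filter.Eventually.of_forall fun t ht => ?_
    rw [Set.uIoc_of_le hpi] at ht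
    exact h1 t ht.1 ht.2
  rw [e, ← intervalIntegral.integral_sub (hF.intervalIntegrable _ _) (hG.intervalIntegrable _ _), ← Real.norm_eq_abs]
  refine intervalIntegral.norm_integral_le_of_norm_le hpi ?_ (hM.intervalIntegrable _ _)
  refine Filter.Eventually.of_forall fun t ht => ?_
  rw [Real.norm_eq_abs]
  exact h2 t ht.1 ht.2

theorem int_lin (n a b c d : ℕ) (x y z w : ℝ) :
    ∫ t in (0 : ℝ)..(π / 2), (x * (cos t ^ n * sin t ^ a) + y * (cos t ^ n * sin t ^ b) +
      z * (cos t ^ n * sin t ^ c) + w * (cos t ^ n * sin t ^ d)) =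
    x * MA n a + y * MA n b + z * MA n c + w * MA n d := by
  have hc : ∀ (x : ℝ) (k : ℕ), IntervalIntegrable (fun t => x * (cos t ^ n * sin t ^ k)) volume 0 (π / 2) := by
    intro x k; apply Continuous.intervalIntegrable; fun_prop
  rw [intervalIntegral.integral_add (((hc x a).add (hc y b)).add (hc z c)) (hc w d),
    intervalIntegral.integral_add ((hc x a).add (hc y b)) (hc z c),
    intervalIntegral.integral_add (hc x a) (hc y b)]
  simp only [intervalIntegral.integral_const_mul, MA]

theorem IA_bound (n : ℕ) :
    |(∫ t in (0 : ℝ)..(π / 2), cos t ^ n * sin t ^ 2 * (1 / t ^ (1 + 1))) -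
      (1 * MA n 0 + (-1 / 3) * MA n 2 + (-1 / 15) * MA n 4 + (-31 / 945) * MA n 6)| ≤ 1027 * MA n 8 := by
  rw [← int_lin]
  have e : 1027 * MA n 8 = ∫ t in (0 : ℝ)..(π / 2), 1027 * (cos t ^ n * sin t ^ 8) := by
    rw [intervalIntegral.integral_const_mul, MA]
  rw [e]
  refine int_compare (F := fun t => cos t ^ n * Real.sinc t ^ 2) ?_ ?_ ?_ ?_ ?_
  · have := Real.continuous_sinc; fun_prop
  · fun_prop
  · fun_prop
  · intro t ht _
    simp only [Real.sinc_of_ne_zero ht.ne']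
    field_simp
  · intro t ht ht1
    have hc : 0 ≤ cos t := Real.cos_nonneg_of_mem_Icc ⟨by linarith [Real.pi_pos], ht1⟩
    have hcn : 0 ≤ cos t ^ n := by positivity
    have := (sinc_bounds ht ht1).2
    simp only [Real.sinc_of_ne_zero ht.ne']
    have e2 : cos t ^ n * (sin t / t) ^ 2 - (1 * (cos t ^ n * sin t ^ 0) + -1 / 3 * (cos t ^ n * sin t ^ 2) +
      -1 / 15 * (cos t ^ n * sin t ^ 4) + -31 / 945 * (cos t ^ n * sin t ^ 6)) =
      cos t ^ n * ((sin t / t) ^ 2 - pA (sin t ^ 2)) := by unfold pA; ring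
    rw [e2, abs_mul, abs_of_nonneg hcn]
    nlinarith [mul_le_mul_of_nonneg_left this hcn]

theorem IB_bound (n : ℕ) :
    |(∫ t in (0 : ℝ)..(π / 2), cos t ^ n * sin t ^ 2 * (1 / t ^ (1 + 0))) -
      (1 * MA n 1 + (-1 / 6) * MA n 3 + (-17 / 360) * MA n 5 + (-367 / 15120) * MA n 7)| ≤ 1027 * MA n 9 := by
  rw [← int_lin]
  have e : 1027 * MA n 9 = ∫ t in (0 : ℝ)..(π / 2), 1027 * (cos t ^ n * sin t ^ 9) := by
    rw [intervalIntegral.integral_const_mul, MA]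
  rw [e]
  refine int_compare (F := fun t => cos t ^ n * (sin t * Real.sinc t)) ?_ ?_ ?_ ?_ ?_
  · have := Real.continuous_sinc; fun_prop
  · fun_prop
  · fun_prop
  · intro t ht _
    simp only [Real.sinc_of_ne_zero ht.ne']
    field_simp
    norm_num
  · intro t ht ht1
    have hc : 0 ≤ cos t := Real.cos_nonneg_of_mem_Icc ⟨by linarith [Real.pi_pos], ht1⟩
    have hs : 0 ≤ sin t := Real.sin_nonneg_of_nonneg_of_le_pi ht.le (by linarith [Real.pi_pos])
    have hcn : 0 ≤ cos t ^ n * sin t := by positivity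
    have := (sinc_bounds ht ht1).1
    simp only [Real.sinc_of_ne_zero ht.ne']
    have e2 : cos t ^ n * (sin t * (sin t / t)) - (1 * (cos t ^ n * sin t ^ 1) + -1 / 6 * (cos t ^ n * sin t ^ 3) +
      -17 / 360 * (cos t ^ n * sin t ^ 5) + -367 / 15120 * (cos t ^ n * sin t ^ 7)) =
      cos t ^ n * sin t * ((sin t / t) - pB (sin t ^ 2)) := by unfold pB; ring
    rw [e2, abs_mul, abs_of_nonneg hcn]
    nlinarith [mul_le_mul_of_nonneg_left this hcn]

theorem MA_step (n k : ℕ) : MA n (k + 2) = (k + 1) * MA n k * (1 / ((n : ℝ) + ((k : ℝ) + 2))) := by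
  have := MA_rec n k
  have h : (n : ℝ) + ((k : ℝ) + 2) ≠ 0 := by positivity
  field_simp
  linarith

theorem IA_eq (n : ℕ) : 1 * MA n 0 + (-1 / 3) * MA n 2 + (-1 / 15) * MA n 4 + (-31 / 945) * MA n 6 =
    Wa n * (1 + (1 / ((n : ℝ) + 2)) * (-1 / 3 + (1 / ((n : ℝ) + 4)) * (-1 / 5 + (-31 / 63) * (1 / ((n : ℝ) + 6))))) := by
  rw [MA_step n 4, MA_step n 2, MA_step n 0]
  unfold Wa
  norm_num
  ring

theorem IB_eq (n : ℕ) : 1 * MA n 1 + (-1 / 6) * MA n 3 + (-17 / 360) * MA n 5 + (-367 / 15120) * MA n 7 =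
    (1 / ((n : ℝ) + 1)) * (1 + (1 / ((n : ℝ) + 3)) * (-1 / 3 + (1 / ((n : ℝ) + 5)) * (-17 / 45 + (-367 / 315) * (1 / ((n : ℝ) + 7))))) := by
  rw [MA_step n 5, MA_step n 3, MA_step n 1, MA_one]
  norm_num
  ring

theorem MA8_le {n : ℕ} (hn : 1 ≤ n) : MA n 8 ≤ 105 * Wa n / (n : ℝ) ^ 4 := by
  have hn' : (1 : ℝ) ≤ n := by exact_mod_cast hn
  have e : MA n 8 = 105 * Wa n / (((n : ℝ) + 2) * (n + 4) * (n + 6) * (n + 8)) := by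
    rw [MA_step n 6, MA_step n 4, MA_step n 2, MA_step n 0]
    unfold Wa
    field_simp
    norm_num
    ring
  rw [e]
  have := Wa_pos n
  have h : (n : ℝ) ^ 4 ≤ ((n : ℝ) + 2) * (n + 4) * (n + 6) * (n + 8) := by
    rw [show (n : ℝ) ^ 4 = n * n * n * n by ring]
    gcongr <;> linarith
  gcongr

theorem MA9_le {n : ℕ} (hn : 1 ≤ n) : MA n 9 ≤ 384 / (n : ℝ) ^ 5 := by
  have hn' : (1 : ℝ) ≤ n := by exact_mod_cast hn
  have e : MA n 9 = 384 / (((n : ℝ) + 1) * (n + 3) * (n + 5) * (n + 7) * (n + 9)) := by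
    rw [MA_step n 7, MA_step n 5, MA_step n 3, MA_step n 1, MA_one]
    field_simp
    norm_num
    try ring
  rw [e]
  have h : (n : ℝ) ^ 5 ≤ ((n : ℝ) + 1) * (n + 3) * (n + 5) * (n + 7) * (n + 9) := by
    rw [show (n : ℝ) ^ 5 = n * n * n * n * n by ring]
    gcongr <;> linarith
  gcongr

end EH

open Real
namespace EH

noncomputable def AA (n : ℕ) : ℝ := ∑' h : ℕ, ((h : ℝ) + 2) ^ 1 * ((W n h : ℝ) / 2 ^ n)
noncomputable def BB (n : ℕ) : ℝ := ∑' h : ℕ, ((h : ℝ) + 2) ^ 0 * ((W n h : ℝ) / 2 ^ n)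

theorem AP_BB : AP (fun n => n * BB n) 1 (-4 / 3) (88 / 45) (-976 / 315) := by
  obtain ⟨C, hC, h⟩ := main_identity 0 5 (by norm_num)
  have hR : AP (fun n : ℕ => ((n : ℝ) / ((n : ℝ) + 1)) * (1 + (1 / ((n : ℝ) + 3)) * (-1 / 3 + (1 / ((n : ℝ) + 5)) * (-17 / 45 + (-367 / 315) * (1 / ((n : ℝ) + 7)))))) 1 (-4 / 3) (88 / 45) (-976 / 315) := by
    have := (AP.ratio 1 (by norm_num)).mul ((AP.const 1).add ((AP.inv_add 3 (by norm_num)).mul ((AP.const (-1 / 3)).add ((AP.inv_add 5 (by norm_num)).mul ((AP.const (-17 / 45)).add ((AP.const (-367 / 315)).mul (AP.inv_add 7 (by norm_num))))))))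
    convert this using 1 <;> norm_num
  refine hR.perturb ⟨C + 1027 * 384, by positivity, fun n hn => ?_⟩
  have hn1 : 1 ≤ n := by omega
  have hn' : (1 : ℝ) ≤ n := by exact_mod_cast hn1
  have h1 := h n hn1
  have h2 := IB_bound n
  rw [IB_eq] at h2
  have h3 := MA9_le hn1
  simp only [qq, if_true, one_mul] at h1
  change |BB n - _| ≤ _ at h1
  set I := ∫ t in (0 : ℝ)..(π / 2), cos t ^ n * sin t ^ 2 * (1 / t ^ (1 + 0)) with hI
  set R := 1 + (1 / ((n : ℝ) + 3)) * (-1 / 3 + (1 / ((n : ℝ) + 5)) * (-17 / 45 + (-367 / 315) * (1 / ((n : ℝ) + 7)))) with hRd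
  have h4 : |BB n - 1 / ((n : ℝ) + 1) * R| ≤ (C + 1027 * 384) / (n : ℝ) ^ 5 := by
    have := abs_add_le (BB n - I) (I - 1 / ((n : ℝ) + 1) * R)
    rw [sub_add_sub_cancel] at this
    have e : (C + 1027 * 384) / (n : ℝ) ^ 5 = C / (n : ℝ) ^ 5 + 1027 * (384 / (n : ℝ) ^ 5) := by ring
    rw [e]
    linarith
  have e : (n : ℝ) * BB n - (n : ℝ) / ((n : ℝ) + 1) * R = n * (BB n - 1 / ((n : ℝ) + 1) * R) := by ring
  rw [e, abs_mul, abs_of_nonneg (by positivity : (0 : ℝ) ≤ n)]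
  calc _ ≤ (n : ℝ) * ((C + 1027 * 384) / (n : ℝ) ^ 5) := by gcongr
    _ = _ := by field_simp

theorem AP_AA : AP (fun n => AA n * (2 / π * √(2 * n / π))) 1 (-7 / 12) (93 / 160) (-5753 / 8064) := by
  obtain ⟨C, hC, h⟩ := main_identity 1 5 (by norm_num)
  have hR : AP (fun n : ℕ => Wh n * (1 + (1 / ((n : ℝ) + 2)) * (-1 / 3 + (1 / ((n : ℝ) + 4)) * (-1 / 5 + (-31 / 63) * (1 / ((n : ℝ) + 6)))))) 1 (-7 / 12) (93 / 160) (-5753 / 8064) := by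
    have := AP_Wh.mul ((AP.const 1).add ((AP.inv_add 2 (by norm_num)).mul ((AP.const (-1 / 3)).add ((AP.inv_add 4 (by norm_num)).mul ((AP.const (-1 / 5)).add ((AP.const (-31 / 63)).mul (AP.inv_add 6 (by norm_num))))))))
    convert this using 1 <;> norm_num
  refine hR.perturb ⟨C + 1027 * 105, by positivity, fun n hn => ?_⟩
  have hn1 : 1 ≤ n := by omega
  have hn' : (1 : ℝ) ≤ n := by exact_mod_cast hn1
  have h1 := h n hn1
  have h2 := IA_bound n
  rw [IA_eq] at h2
  have h3 := MA8_le hn1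
  have hpi := Real.pi_gt_three
  have hqq : qq 1 = π / 2 := by simp [qq]
  rw [hqq] at h1
  change |AA n - _| ≤ _ at h1
  set I := ∫ t in (0 : ℝ)..(π / 2), cos t ^ n * sin t ^ 2 * (1 / t ^ (1 + 1)) with hI
  set R := 1 + (1 / ((n : ℝ) + 2)) * (-1 / 3 + (1 / ((n : ℝ) + 4)) * (-1 / 5 + (-31 / 63) * (1 / ((n : ℝ) + 6)))) with hRd
  have hW : Wh n = Wa n * √(2 * n / π) := by
    unfold Wh YY
    rw [Real.sqrt_mul (by positivity), Real.sqrt_sq (Wa_nonneg n)]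
  have hW1 : Wa n * √(2 * n / π) ≤ 1 := by
    rw [← hW]; unfold Wh
    exact Real.sqrt_le_one.mpr (YY_upper n)
  have hs : √(2 * n / π) ≤ n := by
    rw [Real.sqrt_le_left (by positivity), div_le_iff₀ (by positivity)]
    nlinarith
  have h2pi : 2 / π ≤ 1 := by rw [div_le_one (by positivity)]; linarith
  have hs0 : 0 ≤ √(2 * n / π) := Real.sqrt_nonneg _
  rw [hW]
  set s := √(2 * n / π) with hsd
  have e : AA n * (2 / π * s) - Wa n * s * R = (AA n - π / 2 * I) * (2 / π * s) + s * (I - Wa n * R) := by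
    field_simp; ring
  rw [e]
  calc _ ≤ |AA n - π / 2 * I| * (2 / π * s) + s * |I - Wa n * R| := by
        refine (abs_add_le _ _).trans (le_of_eq ?_)
        rw [abs_mul, abs_mul s, abs_of_nonneg hs0, abs_of_nonneg (by positivity : 0 ≤ 2 / π * s)]
    _ ≤ C / (n : ℝ) ^ 5 * (1 * n) + s * (1027 * (105 * Wa n / (n : ℝ) ^ 4)) := by
        gcongr
        linarith
    _ = C / (n : ℝ) ^ 4 + (Wa n * s) * (1027 * 105 / (n : ℝ) ^ 4) := by
        field_simp
    _ ≤ C / (n : ℝ) ^ 4 + 1 * (1027 * 105 / (n : ℝ) ^ 4) := by gcongr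
    _ = _ := by ring

end EH

open Real
namespace EH

noncomputable def xx (n : ℕ) : ℝ := 1 + 3 / 4 / n + -539 / 1440 / (n : ℝ) ^ 2 + 50713 / 120960 / (n : ℝ) ^ 3

theorem AP_xx : AP xx 1 (3 / 4) (-539 / 1440) (50713 / 120960) :=
  ⟨1, one_pos, fun n _ => by simp [xx]⟩

theorem ratio_bound : ∃ C : ℝ, 0 < C ∧ ∃ N : ℕ, 2 ≤ N ∧ ∀ n : ℕ, N ≤ n → 0 < BB n ∧
    |AA n * (2 / π * √(2 * n / π)) / (n * BB n) - xx n| ≤ C / (n : ℝ) ^ 4 := by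
  have hd := AP_AA.add ((AP.const (-1)).mul (AP_xx.mul AP_BB))
  obtain ⟨C, hC, h⟩ := hd
  obtain ⟨D, hD, k⟩ := AP_BB
  refine ⟨2 * C, by positivity, ⌈2 * (10 + D)⌉₊ + 2, by omega, fun n hn => ?_⟩
  have hn2 : 2 ≤ n := by omega
  have hn' : (1 : ℝ) ≤ n := by exact_mod_cast (by omega : 1 ≤ n)
  have hnD : 2 * (10 + D) ≤ n := (Nat.le_ceil _).trans (by exact_mod_cast (by omega : ⌈2 * (10 + D)⌉₊ ≤ n))
  have h1 := h n hn2
  have k1 := k n hn2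
  have hb : 1 / 2 ≤ n * BB n := by
    have a1 := (abs_le.mp k1).1
    have a2 : D / (n : ℝ) ^ 4 ≤ D / n := by
      gcongr; exact le_self_pow₀ hn' (by norm_num)
    have a3 : (976 / 315) / (n : ℝ) ^ 3 ≤ (976 / 315) / n := by
      gcongr; exact le_self_pow₀ hn' (by norm_num)
    have a4 : 0 ≤ (88 / 45) / (n : ℝ) ^ 2 := by positivity
    have a5 : (10 + D) / n ≤ 1 / 2 := by
      rw [div_le_iff₀ (by positivity)]; linarith
    have a6 : (10 + D) / (n : ℝ) = 10 * (1 / (n : ℝ)) + D / n := by ring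
    have a7 : (976 / 315) / (n : ℝ) = (976 / 315) * (1 / (n : ℝ)) := by ring
    have a8 : (-4 / 3) / (n : ℝ) = (-4 / 3) * (1 / (n : ℝ)) := by ring
    have a9 : (-976 / 315) / (n : ℝ) ^ 3 = - ((976 / 315) / (n : ℝ) ^ 3) := by ring
    have a10 : 0 ≤ 1 / (n : ℝ) := by positivity
    rw [a8, a9] at a1
    linarith
  have hB : 0 < BB n := by
    by_contra hcon
    push Not at hcon
    nlinarith
  refine ⟨hB, ?_⟩
  set b := (n : ℝ) * BB n with hbd
  set a := AA n * (2 / π * √(2 * n / π)) with had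
  have hb0 : 0 < b := by positivity
  have e : a / b - xx n = (a + -1 * (xx n * b)) / b := by field_simp; ring
  have h2 : |a + -1 * (xx n * b)| ≤ C / (n : ℝ) ^ 4 := by
    refine le_trans (le_of_eq ?_) h1
    congr 1
    rw [had, hbd]
    ring
  rw [e, abs_div, abs_of_pos hb0, div_le_iff₀ hb0]
  have hp : 0 ≤ C / (n : ℝ) ^ 4 := by positivity
  have e3 : 2 * C / (n : ℝ) ^ 4 = 2 * (C / (n : ℝ) ^ 4) := by ring
  rw [e3]
  nlinarith

theorem expHeight_eq {n : ℕ} (hB : 0 < BB n) : expHeightZ n = AA n / BB n - 2 := by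
  have hf : ∀ g : ℕ → ℝ, Summable (fun h : ℕ => g h * (W n h : ℝ)) := by
    intro g
    refine summable_of_ne_finset_zero (s := Finset.range (n + 1)) ?_
    intro h hh
    rw [W_large n h (by simpa using hh)]
    simp
  have eB : BB n = (∑' h : ℕ, (W n h : ℝ)) / 2 ^ n := by
    unfold BB
    rw [← tsum_div_const]
    simp
  have eA : AA n = ((∑' h : ℕ, (h : ℝ) * (W n h : ℝ)) + 2 * ∑' h : ℕ, (W n h : ℝ)) / 2 ^ n := by
    unfold AA
    rw [← tsum_mul_left, ← (hf (fun h => (h : ℝ))).tsum_add (hf (fun _ => 2)), ← tsum_div_const]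
    congr 1; ext h; ring
  have hS : (∑' h : ℕ, (W n h : ℝ)) ≠ 0 := by
    intro h0
    rw [eB, h0] at hB
    simp at hB
  unfold expHeightZ
  rw [eA, eB]
  field_simp
  ring

theorem final : ∃ C > (0 : ℝ), ∃ N₀ : ℕ, ∀ n : ℕ, N₀ ≤ n →
      |expHeightZ n -
          (Real.sqrt (2 * π ^ 3) / 4 * Real.sqrt n - 2 +
            3 * Real.sqrt (2 * π ^ 3) / (16 * Real.sqrt n) -
            539 * Real.sqrt (2 * π ^ 3) / (5760 * (n : ℝ) ^ ((3 : ℝ) / 2)) +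
            50713 * Real.sqrt (2 * π ^ 3) / (483840 * (n : ℝ) ^ ((5 : ℝ) / 2)))| ≤
        C * (n : ℝ) ^ (-(7 : ℝ) / 2) := by
  obtain ⟨C, hC, N, hN, h⟩ := ratio_bound
  refine ⟨√(2 * π ^ 3) / 4 * C, by positivity, N, fun n hn => ?_⟩
  obtain ⟨hB, h1⟩ := h n hn
  have hn' : (1 : ℝ) ≤ n := by exact_mod_cast (by omega : 1 ≤ n)
  have hn0 : (0 : ℝ) < n := by linarith
  rw [expHeight_eq hB]
  set r := √(n : ℝ) with hr
  have hr0 : 0 < r := by positivity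
  have hrr : r ^ 2 = n := Real.sq_sqrt hn0.le
  set q := √(2 * π ^ 3) with hq
  have hq0 : 0 < q := by positivity
  have p3 : (n : ℝ) ^ ((3 : ℝ) / 2) = n * r := by
    rw [hr, Real.sqrt_eq_rpow, show (3 : ℝ) / 2 = 1 + 1 / 2 by norm_num, Real.rpow_add hn0, Real.rpow_one]
  have p5 : (n : ℝ) ^ ((5 : ℝ) / 2) = n ^ 2 * r := by
    rw [hr, Real.sqrt_eq_rpow, show (5 : ℝ) / 2 = (2 : ℕ) + 1 / 2 by norm_num, Real.rpow_add hn0, Real.rpow_natCast]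
  have p7 : (n : ℝ) ^ (-(7 : ℝ) / 2) = r / n ^ 4 := by
    rw [hr, Real.sqrt_eq_rpow, show -(7 : ℝ) / 2 = 1 / 2 - (4 : ℕ) by norm_num, Real.rpow_sub hn0, Real.rpow_natCast]
  have es : q / 4 * (2 / π * √(2 * n / π)) = r := by
    have e1 : q * √(2 * n / π) = 2 * π * r := by
      rw [hq, hr, ← Real.sqrt_mul (by positivity), show 2 * π ^ 3 * (2 * n / π) = (2 * π) ^ 2 * n by field_simp,
        Real.sqrt_mul (by positivity), Real.sqrt_sq (by positivity)]
    calc _ = (q * √(2 * n / π)) / (2 * π) := by field_simp; ring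
      _ = r := by rw [e1]; field_simp
  have key : AA n / BB n = q / 4 * r * (AA n * (2 / π * √(2 * n / π)) / (n * BB n)) := by
    have : q / 4 * r * (AA n * (2 / π * √(2 * n / π)) / (n * BB n)) = (q / 4 * (2 / π * √(2 * n / π))) * r * AA n / (n * BB n) := by ring
    rw [this, es, ← hrr]
    field_simp
  have e : AA n / BB n - 2 - (q / 4 * r - 2 + 3 * q / (16 * r) - 539 * q / (5760 * (n * r)) + 50713 * q / (483840 * (n ^ 2 * r)))
      = q / 4 * r * (AA n * (2 / π * √(2 * n / π)) / (n * BB n) - xx n) := by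
    rw [mul_sub, ← key]
    unfold xx
    rw [← hrr]
    field_simp
    ring
  rw [p3, p5, p7, e, abs_mul, abs_of_pos (by positivity : 0 < q / 4 * r)]
  calc _ ≤ q / 4 * r * (C / (n : ℝ) ^ 4) := by gcongr
    _ = _ := by ring

end EH

/-- Asymptotic expansion of the expected height of admissible walks on `ℤ`:
`E H̃_n = (√(2π³)/4)√n − 2 + 3√(2π³)/(16√n) − 539√(2π³)/(5760 n^{3/2})
 + 50713√(2π³)/(483840 n^{5/2}) + O(n^{−7/2})`. -/
theorem expHeightZ_asymptotics :
    ∃ C > (0 : ℝ), ∃ N₀ : ℕ, ∀ n : ℕ, N₀ ≤ n →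
      |expHeightZ n -
          (Real.sqrt (2 * π ^ 3) / 4 * Real.sqrt n - 2 +
            3 * Real.sqrt (2 * π ^ 3) / (16 * Real.sqrt n) -
            539 * Real.sqrt (2 * π ^ 3) / (5760 * (n : ℝ) ^ ((3 : ℝ) / 2)) +
            50713 * Real.sqrt (2 * π ^ 3) / (483840 * (n : ℝ) ^ ((5 : ℝ) / 2)))| ≤
        C * (n : ℝ) ^ (-(7 : ℝ) / 2) := by
  exact EH.final
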